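/- Let 5 ≤ p₁ < p₂ < ⋯ < p_s be primes and for each i let G_i be a finite abelian p_i-group. Then lim_{n→∞} (1/(3^{n+1} n^{2n})) · ∑_K det(B_n[K])² · 1[⊕_{i=1}^s Syl_{p_i}(cok(B_n[K])) ≅ ⊕_{i=1}^s G_i] = ∏_{i=1}^s ( |Aut(G_i)|^{-1} · ∏_{j=1}^∞ (1 − p_i^{−j}) ), where the sum is over all n-element subsets K of [n]³ with det(B_n[K]) ≠ 0, and Syl_p(A) denotes the p-Sylow subgroup of the finite abelian group A. (Equivalently: for the determinantal random n×n matrix A_n = B_n[X_n], where ℙ(X_n = K) = det(B_n[K])²/det(B_nᵀB_n), the joint distribution of the p_i-Sylow subgroups of cok(A_n) converges to the Cohen–Lenstra distribution.) -/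

import Mathlib

open scoped Classical

noncomputable section

namespace CLPaper

/-- The matrix `B_n`: rows indexed by `[n]³`, columns by `[n]`;
the row of `(x₁,x₂,x₃)` is `e_{x₁} + e_{x₂} + e_{x₃}`. -/
def B (n : ℕ) : Matrix (Fin n × Fin n × Fin n) (Fin n) ℤ :=
  fun x j => (if x.1 = j then 1 else 0) + (if x.2.1 = j then 1 else 0) +
    (if x.2.2 = j then 1 else 0)

/-- `det (B_n[K])` for an `n`-element subset `K` of `[n]³` (rows enumerated by a fixed
bijection; the quantities we consider do not depend on this choice), `0` otherwise. -/
def subdet (n : ℕ) (K : Finset (Fin n × Fin n × Fin n)) : ℤ :=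
  if h : K.card = n then
    ((B n).submatrix
      (fun i : Fin n => ((K.equivFin.symm (Fin.cast h.symm i)) : Fin n × Fin n × Fin n))
      id).det
  else 0

/-- The cokernel `ℤ^n / (row span of the rows of `B_n` indexed by `K`)`. -/
def cokK (n : ℕ) (K : Finset (Fin n × Fin n × Fin n)) : Type :=
  (Fin n → ℤ) ⧸ Submodule.span ℤ ((fun x => B n x) '' (K : Set (Fin n × Fin n × Fin n)))

instance (n : ℕ) (K : Finset (Fin n × Fin n × Fin n)) : AddCommGroup (cokK n K) :=
  inferInstanceAs (AddCommGroup ((Fin n → ℤ) ⧸ Submodule.span ℤ _))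

/-- The `p`-Sylow subgroup of an abelian group: the subgroup of elements annihilated
by a power of `p`. -/
def sylow (p : ℕ) (A : Type*) [AddCommGroup A] : AddSubgroup A where
  carrier := {x | ∃ k : ℕ, p ^ k • x = 0}
  zero_mem' := ⟨0, by simp⟩
  add_mem' := by
    rintro x y ⟨k, hk⟩ ⟨l, hl⟩
    refine ⟨k + l, ?_⟩
    rw [smul_add, pow_add, mul_comm, mul_smul, hk, smul_zero, mul_comm, mul_smul, hl,
      smul_zero, add_zero]
  neg_mem' := by
    rintro x ⟨k, hk⟩
    exact ⟨k, by rw [smul_neg, hk, neg_zero]⟩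

/-- Number of surjective homomorphisms from `A` to `G`. -/
def numSur (A G : Type*) [AddCommGroup A] [AddCommGroup G] : ℕ :=
  Nat.card {f : A →+ G // Function.Surjective f}

end CLPaper

namespace CLAux

/-- surjective with kernel having no `p`-torsion for `p ∈ T` -/
def Good (T : Finset ℕ) {A G : Type*} [AddCommGroup A] [AddCommGroup G] (f : A →+ G) : Prop :=
  Function.Surjective f ∧ ∀ p ∈ T, ∀ x, f x = 0 → p • x = 0 → x = 0

/-- the free presentation of `G` -/
def psi (G : Type) [AddCommGroup G] [Fintype G] : (G → ℤ) →+ G where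
  toFun l := ∑ g, l g • g
  map_zero' := by simp
  map_add' := by intro a b; simp [add_smul, Finset.sum_add_distrib]

lemma psi_surj (G : Type) [AddCommGroup G] [Fintype G] : Function.Surjective (psi G) := by
  intro g
  refine ⟨Pi.single g 1, ?_⟩
  simp only [psi, AddMonoidHom.coe_mk, ZeroHom.coe_mk]
  rw [Finset.sum_eq_single g]
  · simp
  · intro b _ hb; simp [Pi.single_eq_of_ne hb]
  · simp

abbrev Rel (G : Type) [AddCommGroup G] [Fintype G] : AddSubgroup (G → ℤ) := (psi G).ker

section Extn
variable {G : Type} [AddCommGroup G] [Fintype G] {V : Type} [AddCommGroup V]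

def relSub (θ : Rel G →+ V) : AddSubgroup ((G → ℤ) × V) :=
  (AddMonoidHom.prod (Rel G).subtype (-θ)).range

def Extn (θ : Rel G →+ V) : Type := ((G → ℤ) × V) ⧸ relSub θ

instance (θ : Rel G →+ V) : AddCommGroup (Extn θ) :=
  inferInstanceAs (AddCommGroup (((G → ℤ) × V) ⧸ relSub θ))

def mkE (θ : Rel G →+ V) : ((G → ℤ) × V) →+ Extn θ := QuotientAddGroup.mk' (relSub θ)

lemma mkE_surj (θ : Rel G →+ V) : Function.Surjective (mkE θ) :=
  QuotientAddGroup.mk'_surjective _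

lemma mkE_eq_zero (θ : Rel G →+ V) (x) : mkE θ x = 0 ↔ ∃ r : Rel G, (r : G → ℤ) = x.1 ∧ - θ r = x.2 := by
  have : mkE θ x = 0 ↔ x ∈ relSub θ := QuotientAddGroup.eq_zero_iff x
  rw [this, relSub, AddMonoidHom.mem_range]
  constructor
  · rintro ⟨r, rfl⟩; exact ⟨r, rfl, rfl⟩
  · rintro ⟨r, h1, h2⟩; exact ⟨r, Prod.ext h1 h2⟩

def inL (θ : Rel G →+ V) : (G → ℤ) →+ Extn θ := (mkE θ).comp (AddMonoidHom.inl _ _)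
def inV (θ : Rel G →+ V) : V →+ Extn θ := (mkE θ).comp (AddMonoidHom.inr _ _)

def prE (θ : Rel G →+ V) : Extn θ →+ G :=
  QuotientAddGroup.lift (relSub θ) ((psi G).comp (AddMonoidHom.fst _ _)) (by
    rintro x ⟨r, rfl⟩
    exact r.2)

lemma prE_mk (θ : Rel G →+ V) (x) : prE θ (mkE θ x) = psi G x.1 := rfl
@[simp] lemma prE_inL (θ : Rel G →+ V) (x) : prE θ (inL θ x) = psi G x := rfl
@[simp] lemma prE_inV (θ : Rel G →+ V) (x) : prE θ (inV θ x) = 0 := (prE_mk θ _).trans (by simp)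

lemma mkE_eq (θ : Rel G →+ V) (l v) : mkE θ (l, v) = inL θ l + inV θ v := by
  simp [inL, inV, ← map_add]

lemma inV_inj (θ : Rel G →+ V) : Function.Injective (inV θ) := by
  rw [injective_iff_map_eq_zero]
  intro v hv
  obtain ⟨r, h1, h2⟩ := (mkE_eq_zero θ (0, v)).1 hv
  have : r = 0 := Subtype.ext h1
  subst this
  simpa using h2.symm

lemma inL_rel (θ : Rel G →+ V) (r : Rel G) : inL θ r = inV θ (θ r) := by
  rw [← sub_eq_zero]
  have : inL θ r - inV θ (θ r) = mkE θ (r, -θ r) := by rw [mkE_eq, map_neg, sub_eq_add_neg]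
  rw [this, mkE_eq_zero]
  exact ⟨r, rfl, rfl⟩

lemma prE_eq_zero (θ : Rel G →+ V) (x : Extn θ) (hx : prE θ x = 0) : ∃ v, inV θ v = x := by
  obtain ⟨⟨l, v⟩, rfl⟩ := mkE_surj θ x
  rw [prE_mk] at hx
  refine ⟨θ ⟨l, hx⟩ + v, ?_⟩
  rw [mkE_eq, map_add, ← inL_rel]

lemma prE_surj (θ : Rel G →+ V) : Function.Surjective (prE θ) := by
  intro g
  obtain ⟨l, rfl⟩ := psi_surj G g
  exact ⟨inL θ l, rfl⟩

lemma card_Extn (θ : Rel G →+ V) : Nat.card (Extn θ) = Nat.card G * Nat.card V := by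
  rw [AddSubgroup.card_eq_card_quotient_mul_card_addSubgroup (prE θ).ker]
  congr 1
  · exact Nat.card_congr (QuotientAddGroup.quotientKerEquivOfSurjective _ (prE_surj θ)).toEquiv
  · refine (Nat.card_congr (Equiv.ofBijective (fun v => (⟨inV θ v, prE_inV θ v⟩ : (prE θ).ker)) ⟨?_, ?_⟩)).symm
    · intro a b h; exact inV_inj θ (congrArg Subtype.val h)
    · rintro ⟨x, hx⟩
      obtain ⟨v, rfl⟩ := prE_eq_zero θ x hx
      exact ⟨v, rfl⟩

instance [Finite V] (θ : Rel G →+ V) : Finite (Extn θ) := by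
  apply Nat.finite_of_card_ne_zero
  rw [card_Extn]
  exact Nat.mul_ne_zero Nat.card_pos.ne' Nat.card_pos.ne'

variable {A : Type} [AddCommGroup A]

lemma exists_lift (f : A →+ G) (hf : Function.Surjective f) :
    ∃ s : (G → ℤ) →+ A, ∀ l, f (s l) = psi G l := by
  choose a ha using hf
  refine ⟨⟨⟨fun l => ∑ g, l g • a g, by simp⟩, by intro x y; simp [add_smul, Finset.sum_add_distrib]⟩, ?_⟩
  intro l
  simp [psi, map_sum, ha]

/-- description of a homomorphism `A → Extn θ` -/
def Desc (f : A →+ G) (s : (G → ℤ) →+ A) (φ : f.ker →+ V) (t : (G → ℤ) →+ V)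
    (σ : Σ θ : Rel G →+ V, (A →+ Extn θ)) : Prop :=
  (∀ x : f.ker, σ.2 x = inV σ.1 (φ x)) ∧ (∀ l, σ.2 (s l) = inL σ.1 l + inV σ.1 (t l)) ∧
  (∀ x, prE σ.1 (σ.2 x) = f x)

lemma exists_Desc (f : A →+ G) (s : (G → ℤ) →+ A) (hs : ∀ l, f (s l) = psi G l)
    (φ : f.ker →+ V) (t : (G → ℤ) →+ V) : ∃ σ, Desc f s φ t σ := by
  let sR : Rel G →+ f.ker := AddMonoidHom.codRestrict (s.comp (Rel G).subtype) f.ker (by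
    intro x; rw [AddMonoidHom.mem_ker]; exact (hs _).trans x.2)
  let θ : Rel G →+ V := φ.comp sR - t.comp (Rel G).subtype
  have key : ∀ (y : A) (l : G → ℤ) (x : f.ker), (x : A) = y - s l → ∀ (l' : G → ℤ) (x' : f.ker), (x' : A) = y - s l' →
      inL θ l + inV θ (t l + φ x) = inL θ l' + inV θ (t l' + φ x') := by
    intro y l x hx l' x' hx'
    have h1 : l - l' ∈ Rel G := by
      have e1 := x.2
      have e2 := x'.2
      rw [hx, AddMonoidHom.mem_ker, map_sub, hs] at e1
      rw [hx', AddMonoidHom.mem_ker, map_sub, hs] at e2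
      rw [AddMonoidHom.mem_ker, map_sub]
      rw [sub_eq_zero] at *
      rw [← e1, ← e2]
    have h2 : sR ⟨l - l', h1⟩ = x' - x := by
      apply Subtype.ext
      change s (l - l') = x' - x
      rw [hx, hx', map_sub]; abel
    have h3 : inL θ (l - l') = inV θ (φ (x' - x) - t (l - l')) := by
      have := inL_rel θ ⟨l - l', h1⟩
      rw [← h2]; exact this
    have h4 : inL θ l - inL θ l' = inV θ (φ x') - inV θ (φ x) - (inV θ (t l) - inV θ (t l')) := by
      rw [← map_sub, h3]; simp only [map_sub]
    rw [map_add, map_add, ← sub_eq_zero]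
    rw [← sub_eq_zero] at h4
    rw [← h4]; abel
  choose L hL using psi_surj G
  let X : A → f.ker := fun y => ⟨y - s (L (f y)), by rw [AddMonoidHom.mem_ker, map_sub, hs, hL, sub_self]⟩
  let h : A →+ Extn θ := AddMonoidHom.mk' (fun y => inL θ (L (f y)) + inV θ (t (L (f y)) + φ (X y))) (by
    intro y z
    have := key (y + z) (L (f (y+z))) (X (y+z)) rfl (L (f y) + L (f z)) (X y + X z) (by
      change (y - s (L (f y))) + (z - s (L (f z))) = _
      rw [map_add]; abel)
    rw [this]
    simp only [map_add]; abel)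
  have hh : ∀ (y : A) (l : G → ℤ) (x : f.ker), (x : A) = y - s l → h y = inL θ l + inV θ (t l + φ x) := by
    intro y l x hx
    exact key y (L (f y)) (X y) rfl l x hx
  refine ⟨⟨θ, h⟩, ?_, ?_, ?_⟩
  · intro x
    have := hh x 0 x (by simp)
    simpa using this
  · intro l
    have := hh (s l) l 0 (by simp)
    simpa using this
  · intro x
    change prE θ (inL θ (L (f x)) + inV θ (t (L (f x)) + φ (X x))) = f x
    rw [map_add, prE_inL, prE_inV, hL, add_zero]

lemma Desc_unique_data {f : A →+ G} {s : (G → ℤ) →+ A} {φ φ' : f.ker →+ V} {t t' : (G → ℤ) →+ V} {σ}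
    (h : Desc f s φ t σ) (h' : Desc f s φ' t' σ) : φ = φ' ∧ t = t' := by
  constructor
  · ext x
    apply inV_inj σ.1
    rw [← h.1, ← h'.1]
  · apply DFunLike.ext
    intro l
    apply inV_inj σ.1
    exact add_left_cancel ((h.2.1 l).symm.trans (h'.2.1 l))

lemma Desc_unique_sig {f : A →+ G} {s : (G → ℤ) →+ A} (hs : ∀ l, f (s l) = psi G l)
    {φ : f.ker →+ V} {t : (G → ℤ) →+ V} {σ σ'}
    (h : Desc f s φ t σ) (h' : Desc f s φ t σ') : σ = σ' := by
  obtain ⟨θ, h1⟩ := σ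
  obtain ⟨θ', h1'⟩ := σ'
  have e : ∀ (θ) (h1), Desc f s φ t ⟨θ, h1⟩ → ∀ r : Rel G, θ r = φ ⟨s r, by rw [AddMonoidHom.mem_ker, hs]; exact r.2⟩ - t r := by
    intro θ h1 h r
    apply inV_inj θ
    have a := h.1 ⟨s r, by rw [AddMonoidHom.mem_ker, hs]; exact r.2⟩
    have b := h.2.1 r
    dsimp only at a b
    rw [inL_rel] at b
    rw [map_sub, ← a, b]; abel
  have : θ = θ' := by
    ext r
    rw [e _ _ h, e _ _ h']
  subst this
  congr 1
  apply DFunLike.ext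
  intro y
  obtain ⟨l, hl⟩ := psi_surj G (f y)
  have hy : y - s l ∈ f.ker := by rw [AddMonoidHom.mem_ker, map_sub, hs, hl, sub_self]
  have e1 : y = s l + (⟨y - s l, hy⟩ : f.ker) := by simp
  rw [e1, map_add, map_add]
  have a := h.1 ⟨y - s l, hy⟩
  have b := h.2.1 l
  have a' := h'.1 ⟨y - s l, hy⟩
  have b' := h'.2.1 l
  dsimp only at a b a' b'
  rw [a, b, a', b']

lemma exists_Desc_of (s : (G → ℤ) →+ A) (θ : Rel G →+ V) (h : A →+ Extn θ)
    (hs : ∀ l, prE θ (h (s l)) = psi G l) :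
    ∃ (φ : ((prE θ).comp h).ker →+ V) (t : (G → ℤ) →+ V), Desc ((prE θ).comp h) s φ t ⟨θ, h⟩ := by
  have h1 : ∀ x : ((prE θ).comp h).ker, ∃ v, inV θ v = h x := fun x => prE_eq_zero θ _ x.2
  choose φ hφ using h1
  have h2 : ∀ l : G → ℤ, ∃ v, inV θ v = h (s l) - inL θ l := fun l => prE_eq_zero θ _ (by
    rw [map_sub, hs, prE_inL, sub_self])
  choose t ht using h2
  refine ⟨AddMonoidHom.mk' φ ?_, AddMonoidHom.mk' t ?_, ?_, ?_, ?_⟩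
  · intro a b; apply inV_inj θ; simp [hφ]
  · intro a b; apply inV_inj θ; simp only [ht, map_add]; abel
  · intro x; exact (hφ x).symm
  · intro l; simp [ht]
  · intro x; rfl

lemma Desc_good {T : Finset ℕ} {q : ℕ} (hT : ∀ p ∈ T, Nat.Coprime p q) (hV : ∀ v : V, q • v = 0)
    {f : A →+ G} {s : (G → ℤ) →+ A} 
    {φ : f.ker →+ V} {t : (G → ℤ) →+ V} {σ} (h : Desc f s φ t σ) :
    Good T σ.2 ↔ Good T f ∧ Function.Surjective φ := by
  obtain ⟨h1, h2, h3⟩ := h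
  constructor
  · rintro ⟨a, b⟩
    refine ⟨⟨?_, ?_⟩, ?_⟩
    · intro g
      obtain ⟨e, rfl⟩ := prE_surj σ.1 g
      obtain ⟨x, rfl⟩ := a e
      exact ⟨x, (h3 x).symm⟩
    · intro p hp x hx hpx
      apply b p hp x _ hpx
      have := h1 ⟨x, hx⟩
      change σ.2 x = _ at this
      rw [this]
      have h4 : p • φ ⟨x, hx⟩ = 0 := by
        rw [← map_nsmul]
        convert map_zero φ
        exact Subtype.ext hpx
      have h5 : φ ⟨x, hx⟩ = 0 := by
        have c := hT p hp
        have o1 := addOrderOf_dvd_of_nsmul_eq_zero h4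
        have o2 := addOrderOf_dvd_of_nsmul_eq_zero (hV (φ ⟨x, hx⟩))
        have := Nat.eq_one_of_dvd_coprimes c o1 o2
        exact AddMonoid.addOrderOf_eq_one_iff.1 this
      rw [h5, map_zero]
    · intro v
      obtain ⟨x, hx⟩ := a (inV σ.1 v)
      have : f x = 0 := by rw [← h3, hx, prE_inV]
      refine ⟨⟨x, this⟩, ?_⟩
      apply inV_inj σ.1
      rw [← h1, ← hx]
  · rintro ⟨⟨a, b⟩, c⟩
    refine ⟨?_, ?_⟩
    · intro e
      obtain ⟨x, hx⟩ := a (prE σ.1 e)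
      obtain ⟨v, hv⟩ := prE_eq_zero σ.1 (e - σ.2 x) (by rw [map_sub, h3, hx, sub_self])
      obtain ⟨y, rfl⟩ := c v
      refine ⟨y + x, ?_⟩
      rw [map_add, h1, hv]; abel
    · intro p hp x hx hpx
      apply b p hp x _ hpx
      rw [← h3, hx, map_zero]

theorem pair_count [Finite A] [Finite V] {T : Finset ℕ} {q : ℕ} (hT : ∀ p ∈ T, Nat.Coprime p q) (hV : ∀ v : V, q • v = 0) :
    Nat.card (Σ θ : Rel G →+ V, {h : A →+ Extn θ // Good T h}) =
    Nat.card (Σ f : {f : A →+ G // Good T f}, {φ : f.1.ker →+ V // Function.Surjective φ})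
      * Nat.card ((G → ℤ) →+ V) := by
  rw [← Nat.card_prod]
  symm
  choose s hs using fun f : {f : A →+ G // Good T f} => exists_lift f.1 f.2.1
  choose σ hσ using fun f : {f : A →+ G // Good T f} => exists_Desc (V := V) f.1 (s f) (hs f)
  let Φ : (Σ f : {f : A →+ G // Good T f}, {φ : f.1.ker →+ V // Function.Surjective φ}) × ((G → ℤ) →+ V) →
      (Σ θ : Rel G →+ V, {h : A →+ Extn θ // Good T h}) := fun x =>
    ⟨(σ x.1.1 x.1.2.1 x.2).1, ⟨(σ x.1.1 x.1.2.1 x.2).2,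
      (Desc_good hT hV (hσ x.1.1 x.1.2.1 x.2)).2 ⟨x.1.1.2, x.1.2.2⟩⟩⟩
  have hΦ : ∀ x, Desc x.1.1.1 (s x.1.1) x.1.2.1 x.2 ⟨(Φ x).1, (Φ x).2.1⟩ := fun x => hσ _ _ _
  apply Nat.card_congr
  refine Equiv.ofBijective Φ ⟨?_, ?_⟩
  · rintro ⟨⟨f, φ⟩, t⟩ ⟨⟨f', φ'⟩, t'⟩ h
    have H := hΦ ⟨⟨f, φ⟩, t⟩
    have H' := hΦ ⟨⟨f', φ'⟩, t'⟩
    rw [← h] at H'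
    have e : f = f' := by
      apply Subtype.ext
      ext x
      exact (H.2.2 x).symm.trans (H'.2.2 x)
    subst e
    obtain ⟨e1, e2⟩ := Desc_unique_data H H'
    have e3 : φ = φ' := Subtype.ext e1
    dsimp only at e2
    rw [e3, e2]
  · rintro ⟨θ, h, hh⟩
    obtain ⟨s0, hs0⟩ := exists_lift ((prE θ).comp h) ((prE_surj θ).comp hh.1)
    obtain ⟨φ0, t0, hD0⟩ := exists_Desc_of s0 θ h hs0
    have hg : Good T ((prE θ).comp h) := ((Desc_good hT hV hD0).1 hh).1
    obtain ⟨φ, t, hD⟩ := exists_Desc_of (s ⟨_, hg⟩) θ h (hs ⟨_, hg⟩)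
    have hφ := ((Desc_good hT hV hD).1 hh).2
    refine ⟨⟨⟨⟨_, hg⟩, ⟨φ, hφ⟩⟩, t⟩, ?_⟩
    have H := hΦ ⟨⟨⟨_, hg⟩, ⟨φ, hφ⟩⟩, t⟩
    have := Desc_unique_sig (hs ⟨_, hg⟩) H hD
    generalize Φ ⟨⟨⟨_, hg⟩, ⟨φ, hφ⟩⟩, t⟩ = z at this
    obtain ⟨θ', h', hh'⟩ := z
    dsimp only at this
    cases this
    rfl

lemma card_hom_free (V : Type) [AddCommGroup V] (M : Type) [AddCommGroup M] [Module.Finite ℤ M] [Module.Free ℤ M] :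
    Nat.card (M →+ V) = Nat.card V ^ (Module.finrank ℤ M) := by
  have b := Module.finBasis ℤ M
  have e : (M →+ V) ≃ (Fin (Module.finrank ℤ M) → V) :=
    (addMonoidHomLequivInt (A := M) (B := V) ℤ).toEquiv.trans (b.constr ℤ).toEquiv.symm
  rw [Nat.card_congr e, Nat.card_fun, Nat.card_fin]

lemma card_hom_eq : Nat.card (Rel G →+ V) = Nat.card ((G → ℤ) →+ V) := by
  have : (Rel G).FiniteIndex := by
    have : Finite ((G → ℤ) ⧸ Rel G) :=
      Finite.of_equiv G (QuotientAddGroup.quotientKerEquivOfSurjective _ (psi_surj G)).symm.toEquiv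
    exact AddSubgroup.finiteIndex_of_finite_quotient
  have : Module.Free ℤ (Rel G) := inferInstanceAs (Module.Free ℤ (AddSubgroup.toIntSubmodule (Rel G)))
  have : Module.Finite ℤ (Rel G) := inferInstanceAs (Module.Finite ℤ (AddSubgroup.toIntSubmodule (Rel G)))
  rw [card_hom_free, card_hom_free]
  congr 1
  have := AddSubgroup.finrank_eq_of_finiteIndex (Rel G)
  exact this

end Extn
end CLAux

namespace CLAux

section SurCount
variable {K : Type} [AddCommGroup K] {q : ℕ} [Fact q.Prime]

lemma surj_iff_linInd {e : ℕ} (φ : K →+ (Fin e → ZMod q)) :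
    Function.Surjective φ ↔
      LinearIndependent (ZMod q) (fun i : Fin e => (Pi.evalAddMonoidHom (fun _ => ZMod q) i).comp φ) := by
  rw [Fintype.linearIndependent_iff]
  constructor
  · intro hs g hg i
    obtain ⟨x, hx⟩ := hs (Pi.single i 1)
    have := DFunLike.congr_fun hg x
    simp only [AddMonoidHom.finsetSum_apply, AddMonoidHom.smul_apply, AddMonoidHom.comp_apply, hx,
      Pi.evalAddMonoidHom_apply, smul_eq_mul, AddMonoidHom.zero_apply] at this
    rw [Finset.sum_eq_single i] at this
    · simpa using this
    · intro b _ hb; simp [Pi.single_eq_of_ne hb]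
    · simp
  · intro h
    let S : Submodule (ZMod q) (Fin e → ZMod q) := AddSubgroup.toZModSubmodule q φ.range
    have hS : S = ⊤ := by
      by_contra hne
      obtain ⟨g, hg, hle⟩ := Submodule.exists_le_ker_of_lt_top S (lt_top_iff_ne_top.2 hne)
      apply hg
      have := h (fun i => g (Pi.single i 1)) (by
        ext x
        have hx : φ x ∈ S := ⟨x, rfl⟩
        have h0 := hle hx
        rw [LinearMap.mem_ker, LinearMap.pi_apply_eq_sum_univ g] at h0
        simp only [AddMonoidHom.finsetSum_apply, AddMonoidHom.smul_apply, AddMonoidHom.comp_apply,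
          Pi.evalAddMonoidHom_apply, smul_eq_mul, AddMonoidHom.zero_apply]
        rw [← h0]
        apply Finset.sum_congr rfl
        intro i _
        rw [smul_eq_mul, mul_comm]
        congr 2
        funext j
        simp [Pi.single_apply, eq_comm])
      apply LinearMap.pi_ext'
      intro i
      apply LinearMap.ext_ring
      simpa using this i
    intro y
    have : y ∈ S := hS ▸ Submodule.mem_top
    exact this

lemma sep_elem_aux {k W : Type} [Field k] [AddCommGroup W] [Module k W] (v : W)
    (h : ∀ f : W →ₗ[k] k, f v = 0) : v = 0 :=
  (Module.forall_dual_apply_eq_zero_iff k v).1 h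

lemma sep_elem {W : Type} [AddCommGroup W] (hz : ∀ x : W, q • x = 0) (v : W)
    (h : ∀ f : W →+ ZMod q, f v = 0) : v = 0 := by
  let inst : Module (ZMod q) W := AddCommGroup.zmodModule hz
  exact sep_elem_aux v (fun f => h f.toAddMonoidHom)

lemma hom_trivial_iff [Finite K] : (∀ φ : K →+ ZMod q, φ = 0) ↔ ∀ x : K, q • x = 0 → x = 0 := by
  let m : K →+ K := nsmulAddMonoidHom q
  have hm : ∀ x, m x = q • x := fun x => rfl
  have hinj : (∀ x : K, q • x = 0 → x = 0) ↔ Function.Injective m := by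
    rw [injective_iff_map_eq_zero]; rfl
  rw [hinj, Finite.injective_iff_surjective]
  constructor
  · intro h
    have hz : ∀ x : K ⧸ m.range, q • x = 0 := by
      intro x
      obtain ⟨y, rfl⟩ := QuotientAddGroup.mk'_surjective _ x
      rw [← map_nsmul]
      exact (QuotientAddGroup.eq_zero_iff _).2 ⟨y, rfl⟩
    intro y
    have : (QuotientAddGroup.mk' m.range y) = 0 := by
      apply sep_elem (q := q) hz
      intro f
      have := h (f.comp (QuotientAddGroup.mk' m.range))
      exact DFunLike.congr_fun this y
    exact (QuotientAddGroup.eq_zero_iff _).1 this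
  · intro h φ
    ext x
    obtain ⟨y, rfl⟩ := h x
    rw [hm, map_nsmul]
    simp

lemma sur_count (K : Type) [AddCommGroup K] (q : ℕ) [Fact q.Prime] [Finite K] : ∃ r : ℕ, (r = 0 ↔ ∀ x : K, q • x = 0 → x = 0) ∧
    ∀ e : ℕ, (Nat.card {φ : K →+ (Fin e → ZMod q) // Function.Surjective φ} : ℝ) =
      ∏ i ∈ Finset.range e, ((q : ℝ) ^ r - (q : ℝ) ^ i) := by
  have : Finite (K →+ ZMod q) := DFunLike.finite _
  refine ⟨Module.finrank (ZMod q) (K →+ ZMod q), ?_, ?_⟩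
  · rw [Module.finrank_zero_iff, ← hom_trivial_iff]
    constructor
    · intro h φ; exact Subsingleton.elim _ _
    · intro h; exact ⟨fun a b => (h a).trans (h b).symm⟩
  · intro e
    have e1 : Nat.card {φ : K →+ (Fin e → ZMod q) // Function.Surjective φ} =
        Nat.card {s : Fin e → (K →+ ZMod q) // LinearIndependent (ZMod q) s} := by
      apply Nat.card_congr
      refine Equiv.ofBijective (fun φ => ⟨_, (surj_iff_linInd φ.1).1 φ.2⟩) ⟨?_, ?_⟩
      · intro a b h
        apply Subtype.ext
        ext x i
        have := congrFun (congrArg Subtype.val h) i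
        exact DFunLike.congr_fun this x
      · rintro ⟨s, hs⟩
        let φ : K →+ (Fin e → ZMod q) := AddMonoidHom.mk' (fun x i => s i x) (by
          intro a b; funext i; simp)
        have hφ : (fun i : Fin e => (Pi.evalAddMonoidHom (fun _ => ZMod q) i).comp φ) = s := by
          funext i; ext x; rfl
        refine ⟨⟨φ, (surj_iff_linInd φ).2 (hφ ▸ hs)⟩, Subtype.ext hφ⟩
    rw [e1]
    by_cases he : e ≤ Module.finrank (ZMod q) (K →+ ZMod q)
    · rw [card_linearIndependent he, ZMod.card, ← Fin.prod_univ_eq_prod_range (fun i => ((q : ℝ) ^ _ - (q : ℝ) ^ i)), Nat.cast_prod]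
      apply Finset.prod_congr rfl
      intro i _
      rw [Nat.cast_sub]
      · push_cast; rfl
      · exact Nat.pow_le_pow_right (Fact.out : q.Prime).pos (by omega)
    · push Not at he
      rw [Finset.prod_eq_zero (Finset.mem_range.2 he) (sub_self _)]
      have : IsEmpty {s : Fin e → (K →+ ZMod q) // LinearIndependent (ZMod q) s} := by
        constructor
        rintro ⟨s, hs⟩
        have := hs.fintype_card_le_finrank
        simp at this
        omega
      simp

/-- coefficients -/
def cc (q : ℝ) (e : ℕ) : ℝ := (-1) ^ e / ∏ i ∈ Finset.range e, (q ^ (i + 1) - 1)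

lemma bonf_sum (q x : ℝ) (hq : 1 < q) (m : ℕ) :
    ∑ e ∈ Finset.range (m + 1), cc q e * ∏ i ∈ Finset.range e, (x - q ^ i) =
      (-1) ^ m * ∏ i ∈ Finset.range m, ((x - q ^ (i + 1)) / (q ^ (i + 1) - 1)) := by
  induction m with
  | zero => simp [cc]
  | succ m ih =>
    rw [Finset.sum_range_succ, ih, Finset.prod_range_succ' (fun i => x - q ^ i),
      cc, Finset.prod_range_succ, Finset.prod_range_succ, Finset.prod_div_distrib]
    have h1 : ∏ i ∈ Finset.range m, (q ^ (i + 1) - 1) ≠ 0 := by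
      apply Finset.prod_ne_zero_iff.2
      intro i _
      have := one_lt_pow₀ hq (Nat.succ_ne_zero i)
      exact (sub_pos.2 this).ne'
    have h2 : q ^ (m + 1) - 1 ≠ 0 := (sub_pos.2 (one_lt_pow₀ hq (Nat.succ_ne_zero m))).ne'
    field_simp
    ring

lemma bonf_zero (q : ℝ) (hq : 1 < q) (m : ℕ) :
    ∑ e ∈ Finset.range (m + 1), cc q e * ∏ i ∈ Finset.range e, (q ^ 0 - q ^ i) = 1 := by
  rw [bonf_sum q _ hq]
  have : ∀ i ∈ Finset.range m, ((q ^ 0 - q ^ (i + 1)) / (q ^ (i + 1) - 1)) = -1 := by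
    intro i _
    have h2 : q ^ (i + 1) - 1 ≠ 0 := (sub_pos.2 (one_lt_pow₀ hq (Nat.succ_ne_zero i))).ne'
    field_simp
    ring
  rw [Finset.prod_congr rfl this]
  simp [← mul_pow]

lemma bonf_pos (q : ℝ) (hq : 1 < q) (m r : ℕ) (hr : r ≠ 0) :
    0 ≤ ∏ i ∈ Finset.range m, ((q ^ r - q ^ (i + 1)) / (q ^ (i + 1) - 1)) := by
  by_cases h : r ≤ m
  · rw [Finset.prod_eq_zero (i := r - 1) (Finset.mem_range.2 (by omega))]
    rw [Nat.sub_add_cancel (by omega)]; simp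
  · apply Finset.prod_nonneg
    intro i hi
    have h2 : 0 < q ^ (i + 1) - 1 := (sub_pos.2 (one_lt_pow₀ hq (Nat.succ_ne_zero i)))
    apply div_nonneg _ h2.le
    rw [sub_nonneg]
    apply pow_le_pow_right₀ hq.le
    have := Finset.mem_range.1 hi
    omega

lemma bonf_even (q : ℝ) (hq : 1 < q) (m r : ℕ) :
    (if r = 0 then (1:ℝ) else 0) ≤ ∑ e ∈ Finset.range (2 * m + 1), cc q e * ∏ i ∈ Finset.range e, (q ^ r - q ^ i) := by
  split_ifs with h
  · subst h; rw [bonf_zero q hq]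
  · rw [bonf_sum q _ hq]
    have := bonf_pos q hq (2 * m) r h
    simpa using this

lemma bonf_odd (q : ℝ) (hq : 1 < q) (m r : ℕ) :
    ∑ e ∈ Finset.range (2 * m + 2), cc q e * ∏ i ∈ Finset.range e, (q ^ r - q ^ i) ≤ (if r = 0 then (1:ℝ) else 0) := by
  split_ifs with h
  · subst h; rw [bonf_zero q hq]
  · rw [show 2 * m + 2 = (2 * m + 1) + 1 by ring, bonf_sum q _ hq]
    have := bonf_pos q hq (2 * m + 1) r h
    simpa [pow_succ] using this
end SurCount

section Euler
open Filter

/-- `F(z) = ∑ (-1)^e z^e /∏ (q^i-1)` with the Euler functional equation -/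
lemma cc_succ (q : ℝ) (hq : 1 < q) (e : ℕ) : cc q (e + 1) * (q ^ (e + 1) - 1) = - cc q e := by
  have h2 : q ^ (e + 1) - 1 ≠ 0 := (sub_pos.2 (one_lt_pow₀ hq (Nat.succ_ne_zero e))).ne'
  unfold cc
  rw [Finset.prod_range_succ]
  have h1 : ∏ i ∈ Finset.range e, (q ^ (i + 1) - 1) ≠ 0 := by
    apply Finset.prod_ne_zero_iff.2
    intro i _
    have := one_lt_pow₀ hq (Nat.succ_ne_zero i)
    exact (sub_pos.2 this).ne'
  field_simp
  ring

lemma cc_abs (q : ℝ) (hq : 3 ≤ q) (e : ℕ) : |cc q e| ≤ (1 / 2) ^ e := by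
  induction e with
  | zero => simp [cc]
  | succ e ih =>
    have h := cc_succ q (by linarith) e
    have h3 : q ≤ q ^ (e + 1) := le_self_pow₀ (by linarith) (Nat.succ_ne_zero e)
    have h4 : |cc q (e + 1)| * (q ^ (e + 1) - 1) = |cc q e| := by
      rw [← abs_neg (cc q e), ← h, abs_mul, abs_of_nonneg (a := q ^ (e + 1) - 1) (by linarith)]
    rw [pow_succ]
    nlinarith [abs_nonneg (cc q (e+1))]

lemma cc_summable (q : ℝ) (hq : 3 ≤ q) (z : ℝ) (hz : |z| ≤ 1) : Summable (fun e => cc q e * z ^ e) := by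
  apply Summable.of_norm_bounded (g := fun e => (1 / 2 : ℝ) ^ e) (summable_geometric_of_lt_one (by norm_num) (by norm_num))
  intro e
  rw [Real.norm_eq_abs, abs_mul, abs_pow]
  calc _ ≤ (1/2 : ℝ) ^ e * 1 := by
        apply mul_le_mul (cc_abs q hq e) (pow_le_one₀ (abs_nonneg _) hz) (by positivity) (by positivity)
    _ = _ := mul_one _

def EF (q z : ℝ) : ℝ := ∑' e, cc q e * z ^ e

lemma EF_fe (q : ℝ) (hq : 3 ≤ q) (z : ℝ) (hz : |z| ≤ 1) : EF q z = (1 - z / q) * EF q (z / q) := by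
  have hq0 : 0 < q := by linarith
  have hz' : |z / q| ≤ 1 := by
    rw [abs_div, abs_of_pos hq0]
    rw [div_le_one hq0]; linarith
  have s1 := cc_summable q hq z hz
  have s2 := cc_summable q hq (z / q) hz'
  have h : EF q z - EF q (z / q) = - (z / q) * EF q (z / q) := by
    unfold EF
    rw [← s1.tsum_sub s2, ← tsum_mul_left]
    rw [(s1.sub s2).tsum_eq_zero_add]
    simp only [pow_zero, sub_self, zero_add]
    apply tsum_congr
    intro e
    have := cc_succ q (by linarith) e
    have h2 : q ^ (e + 1) ≠ 0 := by positivity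
    have h2' : q ^ e ≠ 0 := by positivity
    have e1 : cc q e = - (cc q (e + 1) * (q ^ (e + 1) - 1)) := by linarith
    rw [e1]
    simp only [div_pow]
    field_simp
    ring
  linarith

lemma EF_near (q : ℝ) (hq : 3 ≤ q) (z : ℝ) (hz : |z| ≤ 1) : |EF q z - 1| ≤ |z| := by
  have s1 := cc_summable q hq z hz
  unfold EF
  rw [s1.tsum_eq_zero_add]
  have : cc q 0 * z ^ 0 = 1 := by simp [cc]
  rw [this, add_sub_cancel_left]
  have hg : HasSum (fun e : ℕ => |z| * ((1/2) * (1 / 2 : ℝ) ^ e)) (|z| * ((1/2) * 2)) := by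
    apply HasSum.mul_left
    apply HasSum.mul_left
    exact hasSum_geometric_two
  have := tsum_of_norm_bounded hg (f := fun e => cc q (e + 1) * z ^ (e + 1)) (by
    intro e
    rw [Real.norm_eq_abs, abs_mul, abs_pow, pow_succ |z|]
    have h1 := cc_abs q hq (e + 1)
    have h2 : |z| ^ e ≤ 1 := pow_le_one₀ (abs_nonneg _) hz
    calc |cc q (e + 1)| * (|z| ^ e * |z|) ≤ (1/2) ^ (e + 1) * (1 * |z|) := by gcongr
      _ = _ := by ring)
  rw [Real.norm_eq_abs] at this
  linarith

lemma EF_prod (q : ℝ) (hq : 3 ≤ q) (J : ℕ) :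
    EF q 1 = (∏ j ∈ Finset.range J, (1 - q⁻¹ ^ (j + 1))) * EF q (q⁻¹ ^ J) := by
  have hq0 : 0 < q := by linarith
  induction J with
  | zero => simp
  | succ J ih =>
    rw [ih, Finset.prod_range_succ, EF_fe q hq (q⁻¹ ^ J)]
    · rw [div_eq_mul_inv, ← pow_succ]; ring
    · rw [abs_of_nonneg (by positivity)]
      exact pow_le_one₀ (by positivity) (inv_le_one_of_one_le₀ (by linarith))

lemma euler_id (q : ℝ) (hq : 3 ≤ q) : EF q 1 = ∏' j : ℕ, (1 - q⁻¹ ^ (j + 1)) := by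
  have hq0 : 0 < q := by linarith
  have hq1 : q⁻¹ < 1 := inv_lt_one_of_one_lt₀ (by linarith)
  have hq2 : 0 < q⁻¹ := inv_pos.2 hq0
  have hm : Multipliable (fun j : ℕ => (1 - q⁻¹ ^ (j + 1))) := by
    simp_rw [sub_eq_add_neg]
    apply Real.multipliable_one_add_of_summable
    apply Summable.neg
    exact (summable_geometric_of_lt_one hq2.le hq1).comp_injective (add_left_injective 1)
  have h1 := hm.hasProd.tendsto_prod_nat
  have h2 : Tendsto (fun J : ℕ => EF q (q⁻¹ ^ J)) atTop (nhds 1) := by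
    rw [tendsto_iff_norm_sub_tendsto_zero]
    apply squeeze_zero (fun _ => norm_nonneg _) (g := fun J => q⁻¹ ^ J)
    · intro J
      have := EF_near q hq (q⁻¹ ^ J) (by
        rw [abs_of_nonneg (by positivity)]
        exact pow_le_one₀ (by positivity) hq1.le)
      rwa [abs_of_nonneg (a := q⁻¹ ^ J) (by positivity)] at this
    · exact tendsto_pow_atTop_nhds_zero_of_lt_one hq2.le hq1
  have h3 := h1.mul h2
  rw [mul_one] at h3
  refine tendsto_nhds_unique ?_ h3
  have : (fun J : ℕ => (∏ j ∈ Finset.range J, (1 - q⁻¹ ^ (j + 1))) * EF q (q⁻¹ ^ J)) = fun _ => EF q 1 := by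
    funext J; rw [← EF_prod q hq J]
  rw [this]
  exact tendsto_const_nhds

lemma cc_tendsto (q : ℝ) (hq : 3 ≤ q) :
    Tendsto (fun m => ∑ e ∈ Finset.range m, cc q e) atTop (nhds (∏' j : ℕ, (1 - q⁻¹ ^ (j + 1)))) := by
  rw [← euler_id q hq]
  have := (cc_summable q hq 1 (by simp)).hasSum.tendsto_sum_nat
  simpa [EF] using this
end Euler
end CLAux

namespace CLAux
open Filter

/-- number of good surjections -/
def FF (T : Finset ℕ) (A G : Type) [AddCommGroup A] [AddCommGroup G] : ℕ :=
  Nat.card {f : A →+ G // Good T f}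

/-- number of pairs (good surjection, surjection from its kernel to `F_q^e`) -/
def SS (T : Finset ℕ) (q e : ℕ) (A G : Type) [AddCommGroup A] [AddCommGroup G] : ℕ :=
  Nat.card (Σ f : {f : A →+ G // Good T f}, {φ : f.1.ker →+ (Fin e → ZMod q) // Function.Surjective φ})

lemma good_insert (T : Finset ℕ) (q : ℕ) {A G : Type} [AddCommGroup A] [AddCommGroup G] (f : A →+ G) :
    Good (insert q T) f ↔ Good T f ∧ ∀ x : f.ker, q • x = 0 → x = 0 := by
  unfold Good
  constructor
  · rintro ⟨h1, h2⟩
    refine ⟨⟨h1, fun p hp => h2 p (Finset.mem_insert_of_mem hp)⟩, ?_⟩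
    rintro ⟨x, hx⟩ h
    apply Subtype.ext
    exact h2 q (Finset.mem_insert_self _ _) x hx (congrArg Subtype.val h)
  · rintro ⟨⟨h1, h2⟩, h3⟩
    refine ⟨h1, ?_⟩
    intro p hp x hx hpx
    rcases Finset.mem_insert.1 hp with rfl | hp
    · exact congrArg Subtype.val (h3 ⟨x, hx⟩ (Subtype.ext hpx))
    · exact h2 p hp x hx hpx

lemma SS_data (T : Finset ℕ) (q : ℕ) [Fact q.Prime] (A G : Type) [AddCommGroup A] [AddCommGroup G]
    [Finite A] [Finite G] [Fintype {f : A →+ G // Good T f}] :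
    ∃ r : {f : A →+ G // Good T f} → ℕ,
      (FF (insert q T) A G : ℝ) = ∑ f, (if r f = 0 then (1:ℝ) else 0) ∧
      ∀ e, (SS T q e A G : ℝ) = ∑ f, ∏ i ∈ Finset.range e, ((q : ℝ) ^ r f - (q : ℝ) ^ i) := by
  choose r h1 h2 using fun f : {f : A →+ G // Good T f} => sur_count f.1.ker q
  refine ⟨r, ?_, ?_⟩
  · have e : {f : A →+ G // Good (insert q T) f} ≃ {f : {f : A →+ G // Good T f} // r f = 0} := by
      refine Equiv.trans ?_ (Equiv.subtypeSubtypeEquivSubtypeExists _ _).symm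
      apply Equiv.subtypeEquivRight
      intro f
      rw [good_insert]
      constructor
      · rintro ⟨a, b⟩; exact ⟨a, (h1 ⟨f, a⟩).2 b⟩
      · rintro ⟨a, b⟩; exact ⟨a, (h1 ⟨f, a⟩).1 b⟩
    rw [FF, Nat.card_congr e, Nat.card_eq_fintype_card, Fintype.card_subtype]
    simp
  · intro e
    have : ∀ f : {f : A →+ G // Good T f}, Finite {φ : f.1.ker →+ (Fin e → ZMod q) // Function.Surjective φ} := by
      intro f
      have : Finite (f.1.ker →+ (Fin e → ZMod q)) := DFunLike.finite _
      infer_instance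
    rw [SS, Nat.card_sigma, Nat.cast_sum]
    apply Finset.sum_congr rfl
    intro f _
    exact h2 f e

lemma FF_bounds (T : Finset ℕ) (q : ℕ) [Fact q.Prime] (A G : Type) [AddCommGroup A] [AddCommGroup G]
    [Finite A] [Finite G] (m : ℕ) :
    (FF (insert q T) A G : ℝ) ≤ ∑ e ∈ Finset.range (2 * m + 1), cc q e * SS T q e A G ∧
    ∑ e ∈ Finset.range (2 * m + 2), cc q e * SS T q e A G ≤ (FF (insert q T) A G : ℝ) := by
  have : Finite (A →+ G) := DFunLike.finite _
  have : Fintype {f : A →+ G // Good T f} := Fintype.ofFinite _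
  obtain ⟨r, h1, h2⟩ := SS_data T q A G
  have hq : (1 : ℝ) < q := by exact_mod_cast (Fact.out : q.Prime).one_lt
  rw [h1]
  simp_rw [h2, Finset.mul_sum]
  rw [Finset.sum_comm, Finset.sum_comm (s := Finset.range (2 * m + 2))]
  constructor
  · exact Finset.sum_le_sum fun f _ => bonf_even q hq m (r f)
  · exact Finset.sum_le_sum fun f _ => bonf_odd q hq m (r f)

lemma SS_eq (T : Finset ℕ) (q e : ℕ) [Fact q.Prime] (hT : ∀ p ∈ T, Nat.Coprime p q) (A G : Type) [AddCommGroup A] [AddCommGroup G]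
    [Finite A] [Fintype G] [Fintype (Rel G →+ (Fin e → ZMod q))] :
    (SS T q e A G : ℝ) = (Nat.card (Rel G →+ (Fin e → ZMod q)) : ℝ)⁻¹ *
      ∑ θ : Rel G →+ (Fin e → ZMod q), (FF T A (Extn θ) : ℝ) := by
  have h := pair_count (A := A) (G := G) (V := Fin e → ZMod q) hT (by
    intro v; funext i; simp)
  rw [← card_hom_eq] at h
  have : ∀ θ : Rel G →+ (Fin e → ZMod q), Finite {h : A →+ Extn θ // Good T h} := by
    intro θ
    have : Finite (A →+ Extn θ) := DFunLike.finite _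
    infer_instance
  rw [Nat.card_sigma] at h
  have h0 : (Nat.card (Rel G →+ (Fin e → ZMod q)) : ℝ) ≠ 0 := by
    have : Nat.card (Rel G →+ (Fin e → ZMod q)) ≠ 0 := Nat.card_pos.ne'
    exact_mod_cast this
  rw [eq_inv_mul_iff_mul_eq₀ h0]
  unfold SS FF
  rw [mul_comm]
  exact_mod_cast h.symm

theorem moment_CL (Ω : ℕ → Type) [∀ n, Fintype (Ω n)] (w : ∀ n, Ω n → ℝ) (hw : ∀ n ω, 0 ≤ w n ω)
    (A : ∀ n, Ω n → Type) [∀ n ω, AddCommGroup (A n ω)] [∀ n ω, Finite (A n ω)]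
    (hmom : ∀ (G : Type) [AddCommGroup G] [Fintype G], Nat.Coprime (Nat.card G) 6 →
      Tendsto (fun n => ∑ ω, w n ω * FF ∅ (A n ω) G) atTop (nhds 1))
    (T : Finset ℕ) (hT : ∀ p ∈ T, p.Prime ∧ 5 ≤ p) :
    ∀ (G : Type) [AddCommGroup G] [Fintype G], Nat.Coprime (Nat.card G) 6 →
      Tendsto (fun n => ∑ ω, w n ω * FF T (A n ω) G) atTop
        (nhds (∏ p ∈ T, ∏' j : ℕ, (1 - (p : ℝ)⁻¹ ^ (j + 1)))) := by
  induction T using Finset.induction_on with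
  | empty => simpa using hmom
  | insert q T hqT ih =>
    intro G _ _ hG
    have ih := ih (fun p hp => hT p (Finset.mem_insert_of_mem hp))
    obtain ⟨hq, hq5⟩ := hT q (Finset.mem_insert_self _ _)
    have hfq : Fact q.Prime := ⟨hq⟩
    have hcop : ∀ p ∈ T, Nat.Coprime p q := by
      intro p hp
      rw [Nat.coprime_primes (hT p (Finset.mem_insert_of_mem hp)).1 hq]
      rintro rfl
      exact hqT hp
    set L := ∏ p ∈ T, ∏' j : ℕ, (1 - (p : ℝ)⁻¹ ^ (j + 1)) with hL
    have hS : ∀ e, Tendsto (fun n => ∑ ω, w n ω * SS T q e (A n ω) G) atTop (nhds L) := by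
      intro e
      have hfin : Finite (Rel G →+ (Fin e → ZMod q)) := by
        apply Nat.finite_of_card_ne_zero
        have hfg : Module.finrank ℤ (G → ℤ) = Module.finrank ℤ (G → ℤ) := rfl
        rw [card_hom_eq, card_hom_free]
        exact pow_ne_zero _ Nat.card_pos.ne'
      have : Fintype (Rel G →+ (Fin e → ZMod q)) := Fintype.ofFinite _
      have hc : Nat.Coprime q 6 := by
        rw [Nat.Prime.coprime_iff_not_dvd hq]
        intro h
        have := Nat.le_of_dvd (by norm_num) h
        interval_cases q
        · omega
        · revert hq; decide
      have h1 : Tendsto (fun n => ∑ θ : Rel G →+ (Fin e → ZMod q), ∑ ω, w n ω * FF T (A n ω) (Extn θ)) atTop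
          (nhds (∑ θ : Rel G →+ (Fin e → ZMod q), L)) := by
        apply tendsto_finsetSum
        intro θ _
        have : Fintype (Extn θ) := Fintype.ofFinite _
        apply ih
        rw [card_Extn]
        apply Nat.Coprime.mul_left hG
        rw [Nat.card_fun, Nat.card_zmod]
        exact Nat.Coprime.pow_left _ hc
      have h2 := h1.const_mul ((Nat.card (Rel G →+ (Fin e → ZMod q)) : ℝ)⁻¹)
      have h0 : (Nat.card (Rel G →+ (Fin e → ZMod q)) : ℝ) ≠ 0 := by
        have : Nat.card (Rel G →+ (Fin e → ZMod q)) ≠ 0 := Nat.card_pos.ne'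
        exact_mod_cast this
      rw [Finset.sum_const, Finset.card_univ, ← Nat.card_eq_fintype_card, nsmul_eq_mul, inv_mul_cancel_left₀ h0] at h2
      refine h2.congr ?_
      intro n
      rw [Finset.sum_comm, Finset.mul_sum]
      apply Finset.sum_congr rfl
      intro ω _
      rw [SS_eq T q e hcop, ← Finset.mul_sum]
      ring
    have hP : ∀ M, Tendsto (fun n => ∑ ω, w n ω * ∑ e ∈ Finset.range M, cc q e * SS T q e (A n ω) G) atTop
        (nhds (L * ∑ e ∈ Finset.range M, cc q e)) := by
      intro M
      have : Tendsto (fun n => ∑ e ∈ Finset.range M, cc q e * ∑ ω, w n ω * SS T q e (A n ω) G) atTop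
        (nhds (∑ e ∈ Finset.range M, cc q e * L)) := tendsto_finsetSum _ (fun e _ => (hS e).const_mul _)
      rw [← Finset.sum_mul, mul_comm] at this
      refine this.congr ?_
      intro n
      simp_rw [Finset.mul_sum]
      rw [Finset.sum_comm]
      refine Finset.sum_congr rfl fun ω _ => Finset.sum_congr rfl fun e _ => by ring
    have hE : Tendsto (fun M => L * ∑ e ∈ Finset.range M, cc q e) atTop
        (nhds (∏ p ∈ insert q T, ∏' j : ℕ, (1 - (p : ℝ)⁻¹ ^ (j + 1)))) := by
      rw [Finset.prod_insert hqT, mul_comm]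
      apply Tendsto.const_mul
      apply cc_tendsto
      exact_mod_cast (by omega : 3 ≤ q)
    rw [tendsto_order] at hE ⊢
    constructor
    · intro a ha
      obtain ⟨N, hN⟩ := eventually_atTop.1 (hE.1 a ha)
      have h1 := hN (2 * N + 2) (by omega)
      have h2 := (tendsto_order.1 (hP (2 * N + 2))).1 a h1
      filter_upwards [h2] with n hn
      refine hn.trans_le ?_
      apply Finset.sum_le_sum
      intro ω _
      exact mul_le_mul_of_nonneg_left (FF_bounds T q _ G N).2 (hw _ _)
    · intro a ha
      obtain ⟨N, hN⟩ := eventually_atTop.1 (hE.2 a ha)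
      have h1 := hN (2 * N + 1) (by omega)
      have h2 := (tendsto_order.1 (hP (2 * N + 1))).2 a h1
      filter_upwards [h2] with n hn
      refine lt_of_le_of_lt ?_ hn
      apply Finset.sum_le_sum
      intro ω _
      exact mul_le_mul_of_nonneg_left (FF_bounds T q _ G N).1 (hw _ _)

end CLAux

namespace CLAux
open CLPaper

lemma zero_of_coprime_pow {A : Type*} [AddCommGroup A] {p q a b : ℕ} (h : Nat.Coprime p q) {x : A}
    (h1 : p ^ a • x = 0) (h2 : q ^ b • x = 0) : x = 0 := by
  have o1 := addOrderOf_dvd_of_nsmul_eq_zero h1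
  have o2 := addOrderOf_dvd_of_nsmul_eq_zero h2
  exact AddMonoid.addOrderOf_eq_one_iff.1 (Nat.eq_one_of_dvd_coprimes (Nat.Coprime.pow a b h) o1 o2)

lemma exists_proj (A : Type) [AddCommGroup A] [Finite A] (p k' : ℕ) (hp : p.Prime) :
    ∃ N : ℕ, (∀ x ∈ sylow p A, N • x = x) ∧ (∀ x : A, N • x ∈ sylow p A) ∧
      ∀ (B : Type) [AddCommGroup B] (y : B), p ^ k' • y = 0 → N • y = y := by
  obtain ⟨k, m, hm, hc⟩ := Nat.exists_eq_pow_mul_and_not_dvd (Nat.card_pos (α := A)).ne' p hp.ne_one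
  have hcop : Nat.Coprime (p ^ (k + k')) m := Nat.Coprime.pow_left _ ((Nat.Prime.coprime_iff_not_dvd hp).2 hm)
  obtain ⟨N, hN1, hN2⟩ := Nat.chineseRemainder hcop 1 0
  have key : ∀ (B : Type) [AddCommGroup B] (y : B), p ^ (k + k') • y = 0 → N • y = y := by
    intro B _ y hy
    have h1 : N ≡ 1 [MOD addOrderOf y] := hN1.of_dvd (addOrderOf_dvd_of_nsmul_eq_zero hy)
    have := nsmul_eq_nsmul_iff_modEq.2 h1
    simpa using this
  refine ⟨N, ?_, ?_, ?_⟩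
  · rintro x ⟨j, hj⟩
    apply key
    have o1 := addOrderOf_dvd_of_nsmul_eq_zero hj
    have o2 := addOrderOf_dvd_natCard x
    rw [hc] at o2
    have h3 : Nat.Coprime (addOrderOf x) m :=
      Nat.Coprime.coprime_dvd_left o1 (Nat.Coprime.pow_left _ ((Nat.Prime.coprime_iff_not_dvd hp).2 hm))
    have h4 := h3.dvd_of_dvd_mul_right o2
    rw [← addOrderOf_dvd_iff_nsmul_eq_zero]
    exact h4.trans (pow_dvd_pow _ (by omega))
  · intro x
    refine ⟨k, ?_⟩
    rw [← mul_smul, ← addOrderOf_dvd_iff_nsmul_eq_zero]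
    refine (addOrderOf_dvd_natCard x).trans ?_
    rw [hc]
    exact mul_dvd_mul_left _ ((Nat.modEq_zero_iff_dvd).1 hN2)
  · intro B _ y hy
    apply key
    rw [pow_add, mul_smul, hy, smul_zero]

lemma no_pow_tors {A : Type} [AddCommGroup A] (S : AddSubgroup A) (p : ℕ) (h : ∀ x ∈ S, p • x = 0 → x = 0) (k : ℕ) :
    ∀ x ∈ S, p ^ k • x = 0 → x = 0 := by
  induction k with
  | zero => intro x _ hx; simpa using hx
  | succ k ih =>
    intro x hx h2
    rw [pow_succ, mul_smul] at h2
    exact h x hx (ih _ (S.nsmul_mem hx p) h2)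

lemma card_good_pi {s : ℕ} (p : Fin s → ℕ) (hprime : ∀ i, (p i).Prime) (hmono : StrictMono p)
    (Gi : Fin s → Type) [∀ i, AddCommGroup (Gi i)] [∀ i, Fintype (Gi i)]
    (hGp : ∀ i, ∃ k : ℕ, Nat.card (Gi i) = p i ^ k)
    (A : Type) [AddCommGroup A] [Finite A] :
    FF (Finset.univ.image p) A (∀ i, Gi i) = ∏ i, Nat.card (sylow (p i) A ≃+ Gi i) := by
  choose k hk using hGp
  have hG0 : ∀ i (y : Gi i), p i ^ k i • y = 0 := by
    intro i y
    rw [← hk, ← addOrderOf_dvd_iff_nsmul_eq_zero]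
    exact addOrderOf_dvd_natCard y
  have hcop : ∀ i j, i ≠ j → Nat.Coprime (p i) (p j) := by
    intro i j hij
    rw [Nat.coprime_primes (hprime i) (hprime j)]
    exact fun h => hij (hmono.injective h)
  choose N hN1 hN2 hN3 using fun i => exists_proj A (p i) (k i) (hprime i)
  have hcross : ∀ i j, i ≠ j → ∀ x ∈ sylow (p j) A, N i • x = 0 := by
    intro i j hij x hx
    obtain ⟨a, ha⟩ := (sylow (p j) A).nsmul_mem hx (N i)
    obtain ⟨b, hb⟩ := hN2 i x
    exact zero_of_coprime_pow (hcop i j hij) hb ha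
  rw [FF, ← Nat.card_pi]
  have hinj : ∀ (f : A →+ (∀ i, Gi i)), Good (Finset.univ.image p) f → ∀ i,
      Function.Injective (((Pi.evalAddMonoidHom Gi i).comp f).comp (sylow (p i) A).subtype) := by
    intro f hf i
    rw [injective_iff_map_eq_zero]
    rintro ⟨x, a, ha⟩ hx
    change f x i = 0 at hx
    have hfx : f x = 0 := by
      funext j
      by_cases hij : j = i
      · subst hij; exact hx
      · apply zero_of_coprime_pow (hcop j i hij) (hG0 j _) (b := a)
        have : f (p i ^ a • x) j = 0 := by rw [ha]; simp
        rw [map_nsmul] at this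
        exact this
    apply Subtype.ext
    refine no_pow_tors f.ker (p i) ?_ a x hfx ha
    intro y hy hpy
    exact hf.2 (p i) (Finset.mem_image_of_mem _ (Finset.mem_univ _)) y hy hpy
  have hsurj : ∀ (f : A →+ (∀ i, Gi i)), Good (Finset.univ.image p) f → ∀ i,
      Function.Surjective (((Pi.evalAddMonoidHom Gi i).comp f).comp (sylow (p i) A).subtype) := by
    intro f hf i y
    obtain ⟨x, hx⟩ := hf.1 (Pi.single i y)
    refine ⟨⟨N i • x, hN2 i x⟩, ?_⟩
    change f (N i • x) i = y
    rw [map_nsmul, hx, Pi.smul_apply, Pi.single_eq_same]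
    exact hN3 i _ y (hG0 i y)
  refine Nat.card_congr (Equiv.ofBijective
    (fun f i => AddEquiv.ofBijective _ ⟨hinj f.1 f.2 i, hsurj f.1 f.2 i⟩) ⟨?_, ?_⟩)
  · rintro ⟨f, hf⟩ ⟨f', hf'⟩ h
    apply Subtype.ext
    ext x i
    have h1 := DFunLike.congr_fun (congrFun h i) ⟨N i • x, hN2 i x⟩
    change f (N i • x) i = f' (N i • x) i at h1
    rw [map_nsmul, map_nsmul, Pi.smul_apply, Pi.smul_apply, hN3 i _ _ (hG0 i _), hN3 i _ _ (hG0 i _)] at h1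
    exact h1
  · intro φ
    let f : A →+ (∀ i, Gi i) := AddMonoidHom.mk' (fun x i => φ i ⟨N i • x, hN2 i x⟩) (by
      intro x y
      funext i
      rw [Pi.add_apply, ← map_add]
      congr 1
      exact Subtype.ext (smul_add _ _ _))
    have hfx : ∀ i (x : sylow (p i) A), f x i = φ i x := by
      intro i x
      change φ i ⟨N i • x, hN2 i x⟩ = φ i x
      congr 1
      exact Subtype.ext (hN1 i x x.2)
    have hf : Good (Finset.univ.image p) f := by
      constructor
      · intro y
        refine ⟨∑ j, ((φ j).symm (y j) : A), ?_⟩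
        funext i
        rw [map_sum, Finset.sum_apply, Finset.sum_eq_single i]
        · rw [hfx]; simp
        · intro j _ hji
          change φ i ⟨N i • _, _⟩ = 0
          rw [← map_zero (φ i)]
          congr 1
          exact Subtype.ext (hcross i j hji.symm _ ((φ j).symm (y j)).2)
        · simp
      · intro q hq x hx hqx
        obtain ⟨i, _, rfl⟩ := Finset.mem_image.1 hq
        have hxs : x ∈ sylow (p i) A := ⟨1, by simpa using hqx⟩
        have := hfx i ⟨x, hxs⟩
        change f x i = _ at this
        rw [hx] at this
        have h2 : (⟨x, hxs⟩ : sylow (p i) A) = 0 := (φ i).injective (by rw [← this]; simp)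
        exact congrArg Subtype.val h2
    refine ⟨⟨f, hf⟩, ?_⟩
    funext i
    apply AddEquiv.ext
    intro x
    exact hfx i x

lemma nonempty_pi_iff {s : ℕ} (p : Fin s → ℕ) (hprime : ∀ i, (p i).Prime) (hmono : StrictMono p)
    (Gi : Fin s → Type) [∀ i, AddCommGroup (Gi i)] [∀ i, Fintype (Gi i)]
    (hGp : ∀ i, ∃ k : ℕ, Nat.card (Gi i) = p i ^ k)
    (A : Type) [AddCommGroup A] [Finite A] :
    Nonempty ((∀ i, sylow (p i) A) ≃+ (∀ i, Gi i)) ↔ ∀ i, Nonempty (sylow (p i) A ≃+ Gi i) := by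
  choose k hk using hGp
  have hG0 : ∀ i (y : Gi i), p i ^ k i • y = 0 := by
    intro i y
    rw [← hk, ← addOrderOf_dvd_iff_nsmul_eq_zero]
    exact addOrderOf_dvd_natCard y
  have hcop : ∀ i j, i ≠ j → Nat.Coprime (p i) (p j) := by
    intro i j hij
    rw [Nat.coprime_primes (hprime i) (hprime j)]
    exact fun h => hij (hmono.injective h)
  constructor
  · rintro ⟨e⟩ i
    have h1 : ∀ x : sylow (p i) A, e (Pi.single i x) = Pi.single i (e (Pi.single i x) i) := by
      intro x
      funext j
      by_cases hij : j = i
      · subst hij; simp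
      · rw [Pi.single_eq_of_ne hij]
        obtain ⟨a, ha⟩ := x.2
        apply zero_of_coprime_pow (hcop j i hij) (hG0 j _) (b := a)
        have : e (p i ^ a • Pi.single i x) j = 0 := by
          rw [← Pi.single_smul]
          have : p i ^ a • x = 0 := Subtype.ext ha
          rw [this]; simp
        rw [map_nsmul] at this
        exact this
    have h2 : ∀ y : Gi i, e.symm (Pi.single i y) = Pi.single i (e.symm (Pi.single i y) i) := by
      intro y
      funext j
      by_cases hij : j = i
      · subst hij; simp
      · rw [Pi.single_eq_of_ne hij]
        obtain ⟨a, ha⟩ := (e.symm (Pi.single i y) j).2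
        apply zero_of_coprime_pow (hcop j i hij) (a := a) (Subtype.ext ha) (b := k i)
        have : e.symm (p i ^ k i • Pi.single i y) j = 0 := by
          rw [← Pi.single_smul, hG0]; simp
        rw [map_nsmul] at this
        exact this
    refine ⟨AddEquiv.ofBijective ((Pi.evalAddMonoidHom Gi i).comp (e.toAddMonoidHom.comp (AddMonoidHom.single (fun i => sylow (p i) A) i))) ⟨?_, ?_⟩⟩
    · rw [injective_iff_map_eq_zero]
      intro x hx
      change e (Pi.single i x) i = 0 at hx
      have := h1 x
      rw [hx, Pi.single_zero] at this
      have h3 : (Pi.single i x : ∀ i, sylow (p i) A) = 0 := e.injective (by rw [this, map_zero])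
      simpa using h3
    · intro y
      refine ⟨e.symm (Pi.single i y) i, ?_⟩
      change e (Pi.single i (e.symm (Pi.single i y) i)) i = y
      rw [← h2]; simp
  · intro h
    exact ⟨AddEquiv.piCongrRight (fun i => (h i).some)⟩

lemma FF_final {s : ℕ} (p : Fin s → ℕ) (hprime : ∀ i, (p i).Prime) (hmono : StrictMono p)
    (Gi : Fin s → Type) [∀ i, AddCommGroup (Gi i)] [∀ i, Fintype (Gi i)]
    (hGp : ∀ i, ∃ k : ℕ, Nat.card (Gi i) = p i ^ k)
    (A : Type) [AddCommGroup A] [Finite A] :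
    FF (Finset.univ.image p) A (∀ i, Gi i) =
    (∏ i, Nat.card (Gi i ≃+ Gi i)) * (if Nonempty ((∀ i, sylow (p i) A) ≃+ (∀ i, Gi i)) then 1 else 0) := by
  rw [card_good_pi p hprime hmono Gi hGp A]
  have := nonempty_pi_iff p hprime hmono Gi hGp A
  split_ifs with h
  · rw [this] at h
    rw [mul_one]
    apply Finset.prod_congr rfl
    intro i _
    obtain ⟨e⟩ := h i
    exact Nat.card_congr ⟨fun f => e.symm.trans f, fun f => e.trans f, fun f => by ext; simp, fun f => by ext; simp⟩
  · rw [this] at h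
    push Not at h
    obtain ⟨i, hi⟩ := h
    rw [mul_zero]
    apply Finset.prod_eq_zero (Finset.mem_univ i)
    simp
end CLAux

namespace CLAux
open CLPaper Finset

/-- Cauchy–Binet for Gram matrices. -/
lemma cauchy_binet {X : Type*} [Fintype X] (n : ℕ) (A : Matrix X (Fin n) ℝ)
    (e : Finset X → Fin n → X) (he : ∀ K : Finset X, K.card = n → Function.Injective (e K) ∧ univ.image (e K) = K) :
    (Matrix.det (fun i j => ∑ x, A x i * A x j)) =
      ∑ K ∈ univ.filter (fun K : Finset X => K.card = n), (Matrix.det (A.submatrix (e K) id)) ^ 2 := by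
  have h1 : (Matrix.det (fun i j => ∑ x, A x i * A x j)) =
      ∑ f : Fin n → X, (∏ i, A (f i) i) * Matrix.det (A.submatrix f id) := by
    have : (fun i j => ∑ x, A x i * A x j : Matrix (Fin n) (Fin n) ℝ) = fun i => ∑ x, A x i • A x := by
      funext i j
      simp [Finset.sum_apply]
    have h2 := (Matrix.detRowAlternating (n := Fin n) (R := ℝ)).toMultilinearMap.map_sum (fun i (x : X) => A x i • A x)
    change Matrix.detRowAlternating _ = _
    rw [this]
    change _ = ∑ f : Fin n → X, (Matrix.detRowAlternating (n := Fin n) (R := ℝ)).toMultilinearMap (fun i => A (f i) i • A (f i)) at h2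
    refine h2.trans (Finset.sum_congr rfl fun f _ => ?_)
    rw [MultilinearMap.map_smul_univ]
    rfl
  rw [h1]
  have h2 : ∑ f : Fin n → X, (∏ i, A (f i) i) * Matrix.det (A.submatrix f id) =
      ∑ f ∈ univ.filter (fun f : Fin n → X => Function.Injective f), (∏ i, A (f i) i) * Matrix.det (A.submatrix f id) := by
    symm
    apply Finset.sum_subset (Finset.filter_subset _ _)
    intro f _ hf
    simp only [mem_filter, mem_univ, true_and] at hf
    rw [Function.not_injective_iff] at hf
    obtain ⟨a, b, hab, hne⟩ := hf
    rw [Matrix.det_zero_of_row_eq hne (by ext j; simp [hab]), mul_zero]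
  rw [h2]
  have hmaps : ∀ f ∈ univ.filter (fun f : Fin n → X => Function.Injective f),
      univ.image f ∈ univ.filter (fun K : Finset X => K.card = n) := by
    intro f hf
    simp only [mem_filter, mem_univ, true_and] at hf ⊢
    rw [Finset.card_image_of_injective _ hf]; simp
  rw [← Finset.sum_fiberwise_of_maps_to hmaps]
  refine Finset.sum_congr rfl fun K hK => ?_
  simp only [mem_filter, mem_univ, true_and] at hK
  obtain ⟨hinj, him⟩ := he K hK
  have h3 : ∑ f ∈ (univ.filter (fun f : Fin n → X => Function.Injective f)).filter (fun f => univ.image f = K),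
      (∏ i, A (f i) i) * Matrix.det (A.submatrix f id) =
      ∑ σ : Equiv.Perm (Fin n), (∏ i, A (e K (σ i)) i) * Matrix.det (A.submatrix (e K ∘ σ) id) := by
    symm
    refine Finset.sum_bij (fun σ _ => e K ∘ σ) ?_ ?_ ?_ ?_
    · intro σ _
      simp only [mem_filter, mem_univ, true_and]
      refine ⟨hinj.comp σ.injective, ?_⟩
      refine Eq.trans ?_ him
      ext x; simp only [mem_image, mem_univ, true_and, Function.comp]
      constructor
      · rintro ⟨a, rfl⟩; exact ⟨_, rfl⟩
      · rintro ⟨a, rfl⟩; exact ⟨σ.symm a, by simp⟩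
    · intro σ _ τ _ h
      ext i
      have := congrFun h i
      exact congrArg Fin.val (hinj this)
    · intro f hf
      simp only [mem_filter, mem_univ, true_and] at hf
      obtain ⟨hf, hfK⟩ := hf
      have : ∀ i, ∃ j, e K j = f i := by
        intro i
        have : f i ∈ univ.image (e K) := by rw [him, ← hfK]; simp
        simpa using this
      choose s hs using this
      have hsi : Function.Injective s := fun a b hab => hf (by rw [← hs, ← hs, hab])
      refine ⟨Equiv.ofBijective s (Finite.injective_iff_bijective.mp hsi), mem_univ _, ?_⟩
      funext i; simp [hs]
    · intro σ _; rfl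
  rw [h3]
  have h4 : ∀ σ : Equiv.Perm (Fin n), Matrix.det (A.submatrix (e K ∘ σ) id) = (Equiv.Perm.sign σ : ℤ) * Matrix.det (A.submatrix (e K) id) := by
    intro σ
    rw [← Matrix.det_permute σ (A.submatrix (e K) id)]
    rfl
  simp_rw [h4]
  rw [pow_two]
  conv_rhs => rw [Matrix.det_apply' (A.submatrix (e K) id), Finset.sum_mul]
  refine Finset.sum_congr rfl fun σ _ => ?_
  simp only [Matrix.submatrix_apply, id]
  rw [Matrix.det_apply']
  simp only [Matrix.submatrix_apply, id]
  ring

variable {G : Type} [AddCommGroup G] [Fintype G]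

/-- triples in the kernel of `g` -/
def Ig {n : ℕ} (g : Fin n → G) : Finset (Fin n × Fin n × Fin n) :=
  univ.filter fun x => g x.1 + g x.2.1 + g x.2.2 = 0

def Mg {n : ℕ} (g : Fin n → G) : Matrix (Fin n) (Fin n) ℝ :=
  fun i j => ∑ x ∈ Ig g, (B n x i : ℝ) * (B n x j : ℝ)

/-- `g` generates `G`. -/
def Gen {n : ℕ} (g : Fin n → G) : Prop :=
  ∀ a : G, ∃ l : Fin n → ℤ, ∑ i, l i • g i = a

lemma subdet_sum {n : ℕ} (g : Fin n → G) :
    ∑ K ∈ univ.filter (fun K : Finset (Fin n × Fin n × Fin n) => K.card = n ∧ K ⊆ Ig g), ((subdet n K : ℤ) : ℝ) ^ 2 =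
      (Mg g).det := by
  set A : Matrix (Ig g) (Fin n) ℝ := fun x j => (B n x j : ℝ) with hA
  have hM : Mg g = fun i j => ∑ x, A x i * A x j := by
    funext i j
    rw [Mg, ← Finset.sum_coe_sort]
  by_cases hn : Nonempty (Fin n → Ig g)
  swap
  · -- n > 0 and Ig empty
    have hIe : IsEmpty (Ig g) := by
      by_contra h
      rw [not_isEmpty_iff] at h
      exact hn ⟨fun _ => h.some⟩
    have hn0 : Nonempty (Fin n) := by
      by_contra h
      rw [not_nonempty_iff] at h
      exact hn ⟨fun i => h.elim i⟩
    have : Mg g = 0 := by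
      rw [hM]; funext i j; simp
    rw [this, Matrix.det_zero]
    refine Finset.sum_eq_zero fun K hK => ?_
    exfalso
    simp only [mem_filter, mem_univ, true_and] at hK
    have : K = ∅ := by
      rw [Finset.eq_empty_iff_forall_notMem]
      intro x hx
      exact hIe.elim ⟨x, hK.2 hx⟩
    rw [this] at hK
    have h0 := hn0.some.2
    simp at hK; omega
  set e : Finset (Ig g) → Fin n → Ig g := fun K => if h : K.card = n then fun i => (K.equivFin.symm (Fin.cast h.symm i) : Ig g) else hn.some with he
  rw [hM, cauchy_binet n A e]
  · refine Finset.sum_bij' (fun K _ => K.subtype (· ∈ Ig g)) (fun K _ => K.map (Function.Embedding.subtype _)) ?_ ?_ ?_ ?_ ?_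
    · intro K hK
      simp only [mem_filter, mem_univ, true_and] at hK ⊢
      rw [Finset.card_subtype, Finset.filter_true_of_mem (fun x hx => hK.2 hx)]; exact hK.1
    · intro K hK
      simp only [mem_filter, mem_univ, true_and] at hK ⊢
      refine ⟨by simpa using hK, ?_⟩
      intro x hx
      simp at hx; exact hx.1
    · intro K hK
      simp only [mem_filter, mem_univ, true_and] at hK
      ext x; simp; exact fun hx => hK.2 hx
    · intro K hK
      ext x; simp
    · intro K hK
      simp only [mem_filter, mem_univ, true_and] at hK
      have hc : (K.subtype (· ∈ Ig g)).card = n := by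
        rw [Finset.card_subtype, Finset.filter_true_of_mem (fun x hx => hK.2 hx)]; exact hK.1
      rw [subdet, dif_pos hK.1]
      simp only [he, dif_pos hc]
      -- relate two enumerations by a permutation
      have hx : ∀ i : Fin n, ∃ j : Fin n, ((K.equivFin.symm (Fin.cast hK.1.symm j)) : Fin n × Fin n × Fin n) =
          (((K.subtype (· ∈ Ig g)).equivFin.symm (Fin.cast hc.symm i) : Ig g) : Fin n × Fin n × Fin n) := by
        intro i
        have hm := ((K.subtype (· ∈ Ig g)).equivFin.symm (Fin.cast hc.symm i)).2
        rw [Finset.mem_subtype] at hm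
        refine ⟨Fin.cast hK.1 (K.equivFin ⟨_, hm⟩), ?_⟩
        simp
      choose s hs using hx
      have hsi : Function.Injective s := by
        intro a b hab
        have := (hs a).symm.trans ((congrArg _ (by rw [hab])).trans (hs b))
        have h1 := Subtype.ext (Subtype.ext this)
        have h2 := (K.subtype (· ∈ Ig g)).equivFin.symm.injective h1
        simpa using h2
      set σ : Equiv.Perm (Fin n) := Equiv.ofBijective s (Finite.injective_iff_bijective.mp hsi)
      have hperm : A.submatrix (fun i : Fin n => ((K.subtype (· ∈ Ig g)).equivFin.symm (Fin.cast hc.symm i) : Ig g)) id =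
          (((B n).submatrix
      (fun i : Fin n => ((K.equivFin.symm (Fin.cast hK.1.symm i)) : Fin n × Fin n × Fin n))
      id).map (Int.cast : ℤ → ℝ)).submatrix σ id := by
        ext i j
        simp only [Matrix.submatrix_apply, Matrix.map_apply, id, hA, σ, Equiv.ofBijective_apply]
        rw [hs]
        rfl
      rw [hperm, Matrix.det_permute]
      rw [mul_pow]
      have hsg : (((Equiv.Perm.sign σ : ℤˣ) : ℤ) : ℝ) ^ 2 = 1 := by
        rcases Int.units_eq_one_or (Equiv.Perm.sign σ) with h | h <;> rw [h] <;> simp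
      rw [hsg, one_mul]
      congr 1
      exact Int.cast_det _
  · intro K hK
    simp only [he, dif_pos hK]
    constructor
    · intro a b hab
      have := K.equivFin.symm.injective (Subtype.ext hab)
      simpa using this
    · ext x
      simp only [mem_image, mem_univ, true_and]
      constructor
      · rintro ⟨a, rfl⟩; exact (K.equivFin.symm (Fin.cast hK.symm a)).2
      · intro hx; exact ⟨Fin.cast hK (K.equivFin ⟨x, hx⟩), by simp⟩

end CLAux

namespace CLAux
open CLPaper Finset

lemma finite_cokK (n : ℕ) (K : Finset (Fin n × Fin n × Fin n)) (h : subdet n K ≠ 0) : Finite (cokK n K) := by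
  have hc : K.card = n := by
    by_contra hc; exact h (by rw [subdet, dif_neg hc])
  rw [subdet, dif_pos hc] at h
  set C := ((B n).submatrix
      (fun i : Fin n => ((K.equivFin.symm (Fin.cast hc.symm i)) : Fin n × Fin n × Fin n))
      id) with hC
  set S := Submodule.span ℤ ((fun x => B n x) '' (K : Set (Fin n × Fin n × Fin n)))
  have hrow : ∀ k, C k ∈ S := by
    intro k
    apply Submodule.subset_span
    exact ⟨_, (K.equivFin.symm (Fin.cast hc.symm k)).2, rfl⟩
  have hmem : ∀ x : Fin n → ℤ, C.det • x ∈ S := by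
    intro x
    have : C.det • x = ∑ k, (Matrix.vecMul x C.adjugate) k • C k := by
      have h1 : Matrix.vecMul (Matrix.vecMul x C.adjugate) C = C.det • x := by
        rw [Matrix.vecMul_vecMul, Matrix.adjugate_mul, Matrix.vecMul_smul, Matrix.vecMul_one]
      rw [← h1]
      funext j
      rw [Matrix.vecMul, dotProduct]
      simp [Finset.sum_apply]
    rw [this]
    exact S.sum_mem fun k _ => S.smul_mem _ (hrow k)
  change Finite ((Fin n → ℤ) ⧸ S)
  apply Module.finite_of_fg_torsion
  intro x
  obtain ⟨y, rfl⟩ := Submodule.Quotient.mk_surjective S x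
  refine ⟨⟨C.det, by simpa using h⟩, ?_⟩
  change C.det • Submodule.Quotient.mk y = (0 : (Fin n → ℤ) ⧸ S)
  rw [← Submodule.Quotient.mk_smul, Submodule.Quotient.mk_eq_zero]
  exact hmem y

variable {G : Type} [AddCommGroup G] [Fintype G]

lemma B_row_sum {n : ℕ} (x : Fin n × Fin n × Fin n) (g : Fin n → G) :
    ∑ i, B n x i • g i = g x.1 + g x.2.1 + g x.2.2 := by
  simp [B, add_smul, Finset.sum_add_distrib, ite_smul]

def evalHom {n : ℕ} (g : Fin n → G) : (Fin n → ℤ) →+ G where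
  toFun l := ∑ i, l i • g i
  map_zero' := by simp
  map_add' x y := by simp [add_smul, Finset.sum_add_distrib]

lemma FF_card (n : ℕ) (K : Finset (Fin n × Fin n × Fin n)) :
    FF ∅ (cokK n K) G = (univ.filter (fun g : Fin n → G => Gen g ∧ K ⊆ Ig g)).card := by
  rw [FF, ← Fintype.card_subtype, ← Nat.card_eq_fintype_card]
  set S := Submodule.span ℤ ((fun x => B n x) '' (K : Set (Fin n × Fin n × Fin n))) with hS
  let mk : (Fin n → ℤ) →+ cokK n K := (Submodule.mkQ S).toAddMonoidHom
  have hmk : Function.Surjective mk := Submodule.mkQ_surjective S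
  have hmk0 : ∀ x ∈ K, mk (B n x) = 0 := by
    intro x hx
    exact (Submodule.Quotient.mk_eq_zero S).mpr (Submodule.subset_span ⟨x, hx, rfl⟩)
  let gf : (cokK n K →+ G) → Fin n → G := fun f i => f (mk (Pi.single i 1))
  have hgf : ∀ f l, f (mk l) = ∑ i, l i • gf f i := by
    intro f l
    conv_lhs => rw [← Finset.univ_sum_single l]
    rw [map_sum, map_sum]
    refine Finset.sum_congr rfl fun i _ => ?_
    simp only [gf]
    rw [← map_zsmul, ← map_zsmul]
    congr 2
    rw [← Pi.single_smul]; simp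
  refine Nat.card_eq_of_bijective (fun f => ⟨gf f.1, ?_, ?_⟩) ⟨?_, ?_⟩
  · intro a
    obtain ⟨y, hy⟩ := f.2.1 a
    obtain ⟨l, rfl⟩ := hmk y
    exact ⟨l, by rw [← hgf, hy]⟩
  · intro x hx
    simp only [Ig, mem_filter, mem_univ, true_and]
    rw [← B_row_sum, ← hgf, hmk0 x hx, map_zero]
  · rintro ⟨f, hf⟩ ⟨f', hf'⟩ h
    simp only [Subtype.mk.injEq] at h ⊢
    ext y
    obtain ⟨l, rfl⟩ := hmk y
    rw [hgf, hgf, h]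
  · rintro ⟨g, hg, hK⟩
    have hle : S.toAddSubgroup ≤ (evalHom g).ker := by
      intro y hy
      have : S ≤ LinearMap.ker (evalHom g).toIntLinearMap := by
        rw [hS, Submodule.span_le]
        rintro _ ⟨x, hx, rfl⟩
        have := hK hx
        simp only [Ig, mem_filter, mem_univ, true_and] at this
        rw [← B_row_sum] at this
        exact this
      exact this hy
    let f : cokK n K →+ G := QuotientAddGroup.lift S.toAddSubgroup (evalHom g) hle
    have hf : ∀ l, f (mk l) = ∑ i, l i • g i := fun l => rfl
    refine ⟨⟨f, ?_, by simp⟩, ?_⟩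
    · intro a
      obtain ⟨l, hl⟩ := hg a
      exact ⟨mk l, by rw [hf, hl]⟩
    · simp only [Subtype.mk.injEq]
      funext i
      simp only [gf]
      rw [hf]
      simp [Pi.single_apply]

abbrev Om (n : ℕ) : Type := {K : Finset (Fin n × Fin n × Fin n) // K.card = n ∧ subdet n K ≠ 0}

instance (n : ℕ) (ω : Om n) : Finite (cokK n ω.1) := finite_cokK n ω.1 ω.2.2

def cN (n : ℕ) : ℝ := (3 : ℝ) ^ (n + 1) * (n : ℝ) ^ (2 * n)

lemma moment_reduce (n : ℕ) :
    ∑ ω : Om n, ((subdet n ω.1 : ℝ) ^ 2 / cN n) * (FF ∅ (cokK n ω.1) G : ℝ) =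
      ∑ g ∈ univ.filter (fun g : Fin n → G => Gen g), (Mg g).det / cN n := by
  have h1 : ∑ ω : Om n, ((subdet n ω.1 : ℝ) ^ 2 / cN n) * (FF ∅ (cokK n ω.1) G : ℝ) =
      ∑ K ∈ univ.filter (fun K : Finset (Fin n × Fin n × Fin n) => K.card = n ∧ subdet n K ≠ 0),
        ((subdet n K : ℝ) ^ 2 / cN n) * (FF ∅ (cokK n K) G : ℝ) := by
    symm
    apply Finset.sum_subtype
    simp
  have h2 : ∑ K ∈ univ.filter (fun K : Finset (Fin n × Fin n × Fin n) => K.card = n ∧ subdet n K ≠ 0),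
        ((subdet n K : ℝ) ^ 2 / cN n) * (FF ∅ (cokK n K) G : ℝ) =
      ∑ K ∈ univ.filter (fun K : Finset (Fin n × Fin n × Fin n) => K.card = n),
        ((subdet n K : ℝ) ^ 2 / cN n) * (FF ∅ (cokK n K) G : ℝ) := by
    apply Finset.sum_subset
    · intro K hK; simp at hK ⊢; exact hK.1
    · intro K hK hK2
      simp only [mem_filter, mem_univ, true_and, not_and, not_not] at hK hK2
      rw [hK2 hK]; simp
  rw [h1, h2]
  simp_rw [FF_card, Finset.card_filter, Nat.cast_sum, Finset.mul_sum]
  rw [Finset.sum_comm, Finset.sum_filter]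
  refine Finset.sum_congr rfl fun g _ => ?_
  split_ifs with hg
  · rw [← subdet_sum, Finset.sum_div, ← Finset.filter_filter, Finset.sum_filter _ (f := fun K => ((subdet n K : ℤ) : ℝ) ^ 2 / cN n)]
    refine Finset.sum_congr rfl fun K _ => ?_
    simp [hg]
  · simp [hg]

/-! explicit form of `Mg` -/
def cnt {n : ℕ} (g : Fin n → G) (a : G) : ℝ := ((univ.filter fun i => g i = a).card : ℝ)

def dd (c : G → ℝ) (a : G) : ℝ := ∑ b, c b * c (-a - b)

lemma cnt_eq_sum {n : ℕ} (g : Fin n → G) (a : G) : cnt g a = ∑ i, if g i = a then 1 else 0 := by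
  simp [cnt]

lemma cnt_nonneg {n : ℕ} (g : Fin n → G) (a : G) : 0 ≤ cnt g a := by
  unfold cnt; positivity

lemma sum_comp_cnt {n : ℕ} (g : Fin n → G) (f : G → ℝ) : ∑ i, f (g i) = ∑ a, cnt g a * f a := by
  simp_rw [cnt_eq_sum, Finset.sum_mul]
  rw [Finset.sum_comm]
  simp

lemma prod_comp_cnt {n : ℕ} (g : Fin n → G) (f : G → ℝ) : ∏ i, f (g i) = ∏ a, f a ^ (univ.filter fun i => g i = a).card := by
  rw [← Finset.prod_fiberwise univ g (fun i => f (g i))]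
  refine Finset.prod_congr rfl fun a _ => ?_
  rw [← Finset.prod_const]
  refine Finset.prod_congr rfl fun i hi => ?_
  simp at hi; rw [hi]

lemma cnt_sum {n : ℕ} (g : Fin n → G) : ∑ a, cnt g a = n := by
  have := sum_comp_cnt g (fun _ => 1)
  simp at this
  exact this.symm

lemma Mg_eq {n : ℕ} (g : Fin n → G) (i j : Fin n) :
    Mg g i j = (if i = j then 3 * dd (cnt g) (g i) else 0) + 6 * cnt g (-g i - g j) := by
  have hd : ∀ a, dd (cnt g) a = ∑ y, ∑ z, if a + g y + g z = 0 then (1:ℝ) else 0 := by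
    intro a
    rw [dd, ← sum_comp_cnt g (fun b => cnt g (-a - b))]
    refine Finset.sum_congr rfl fun y _ => ?_
    rw [cnt_eq_sum]
    refine Finset.sum_congr rfl fun z _ => ?_
    refine if_congr ⟨fun h => by rw [h]; abel, fun h => ?_⟩ rfl rfl
    rw [eq_sub_iff_add_eq, eq_neg_iff_add_eq_zero, ← h]; abel
  rw [hd, cnt_eq_sum]
  have key : Mg g i j = ∑ x1, ∑ x2, ∑ x3, (if g x1 + g x2 + g x3 = 0 then (1:ℝ) else 0) *
     (((if x1 = i then 1 else 0) + (if x2 = i then 1 else 0) + (if x3 = i then 1 else 0)) *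
     ((if x1 = j then 1 else 0) + (if x2 = j then 1 else 0) + (if x3 = j then 1 else 0))) := by
    rw [Mg, Ig, Finset.sum_filter, Fintype.sum_prod_type]
    refine Finset.sum_congr rfl fun x1 _ => ?_
    rw [Fintype.sum_prod_type]
    refine Finset.sum_congr rfl fun x2 _ => Finset.sum_congr rfl fun x3 _ => ?_
    simp only [B]
    push_cast
    simp only [ite_mul, one_mul, zero_mul]
  rw [key]
  have e1 : ∀ x1 x2 x3 : Fin n, (if g x1 + g x2 + g x3 = 0 then (1:ℝ) else 0) *
     (((if x1 = i then 1 else 0) + (if x2 = i then 1 else 0) + (if x3 = i then 1 else 0)) *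
     ((if x1 = j then 1 else 0) + (if x2 = j then 1 else 0) + (if x3 = j then 1 else 0))) =
     (if x1 = i then (if x1 = j then (if g x1 + g x2 + g x3 = 0 then (1:ℝ) else 0) else 0) else 0) +
     (if x1 = i then (if x2 = j then (if g x1 + g x2 + g x3 = 0 then (1:ℝ) else 0) else 0) else 0) +
     (if x1 = i then (if x3 = j then (if g x1 + g x2 + g x3 = 0 then (1:ℝ) else 0) else 0) else 0) +
     (if x2 = i then (if x1 = j then (if g x1 + g x2 + g x3 = 0 then (1:ℝ) else 0) else 0) else 0) +
     (if x2 = i then (if x2 = j then (if g x1 + g x2 + g x3 = 0 then (1:ℝ) else 0) else 0) else 0) +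
     (if x2 = i then (if x3 = j then (if g x1 + g x2 + g x3 = 0 then (1:ℝ) else 0) else 0) else 0) +
     (if x3 = i then (if x1 = j then (if g x1 + g x2 + g x3 = 0 then (1:ℝ) else 0) else 0) else 0) +
     (if x3 = i then (if x2 = j then (if g x1 + g x2 + g x3 = 0 then (1:ℝ) else 0) else 0) else 0) +
     (if x3 = i then (if x3 = j then (if g x1 + g x2 + g x3 = 0 then (1:ℝ) else 0) else 0) else 0) := by
    intro x1 x2 x3
    have hm : ∀ (P Q : Prop) [Decidable P] [Decidable Q] (c : ℝ), (if P then (if Q then c else 0) else 0) =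
        (if P then 1 else 0) * (if Q then 1 else 0) * c := by
      intro P Q _ _ c
      by_cases hP : P <;> by_cases hQ : Q <;> simp [hP, hQ]
    generalize (if g x1 + g x2 + g x3 = 0 then (1:ℝ) else 0) = c
    simp only [hm]
    ring
  simp_rw [e1, Finset.sum_add_distrib]
  have sw : ∀ x1 x2 x3 : Fin n, (g x1 + g x2 + g x3 = 0) = (g x2 + g x1 + g x3 = 0) := fun x1 x2 x3 => by rw [add_comm (g x1)]
  have c1 : ∀ z, (g i + g j + g z = 0) = (g z = -g i - g j) := by
    intro z
    rw [eq_sub_iff_add_eq, eq_neg_iff_add_eq_zero]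
    congr 1; abel
  have T : ∀ z, (if g z = -g i - g j then (1:ℝ) else 0) = if g i + g j + g z = 0 then 1 else 0 := fun z => by rw [c1]
  simp_rw [T]
  simp only [Finset.sum_ite_eq', mem_univ, if_true, Finset.sum_ite_irrel, Finset.sum_const_zero]
  have p1 : ∀ z, g i + g z + g j = g i + g j + g z := fun z => by abel
  have p2 : ∀ z, g j + g i + g z = g i + g j + g z := fun z => by abel
  have p3 : ∀ z, g j + g z + g i = g i + g j + g z := fun z => by abel
  have p4 : ∀ z, g z + g i + g j = g i + g j + g z := fun z => by abel
  have p5 : ∀ z, g z + g j + g i = g i + g j + g z := fun z => by abel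
  have q1 : ∀ x y, g x + g i + g y = g i + g x + g y := fun x y => by abel
  have q2 : ∀ x y, g x + g y + g i = g i + g x + g y := fun x y => by abel
  simp only [p1, p2, p3, p4, p5, q1, q2]
  split_ifs <;> ring

end CLAux

namespace CLAux
open CLPaper Finset

lemma hadamard {n : ℕ} (M : Matrix (Fin n) (Fin n) ℝ) (hM : M.PosSemidef) : M.det ≤ ∏ i, M i i := by
  have hdiag : ∀ i, 0 ≤ M i i := fun i => hM.diag_nonneg
  by_cases hz : ∃ i, M i i = 0
  · obtain ⟨i, hi⟩ := hz
    have h1 : M.mulVec (Pi.single i 1) = 0 := by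
      rw [← hM.dotProduct_mulVec_zero_iff]
      simp [hi]
    have h0 : M.det = 0 := by
      rw [← Matrix.exists_mulVec_eq_zero_iff]
      exact ⟨Pi.single i 1, by simp, h1⟩
    rw [h0]
    exact Finset.prod_nonneg fun i _ => hdiag i
  push Not at hz
  have hpos : ∀ i, 0 < M i i := fun i => lt_of_le_of_ne (hdiag i) (hz i).symm
  set D : Matrix (Fin n) (Fin n) ℝ := Matrix.diagonal (fun i => (Real.sqrt (M i i))⁻¹) with hD
  have hN : (D * M * D).PosSemidef := by
    have := hM.mul_mul_conjTranspose_same D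
    have hDD : D.conjTranspose = D := by
      rw [hD, Matrix.diagonal_conjTranspose]; rfl
    rwa [hDD] at this
  have hNd : ∀ i, (D * M * D) i i = 1 := by
    intro i
    rw [hD, Matrix.mul_diagonal, Matrix.diagonal_mul]
    have := Real.mul_self_sqrt (hdiag i)
    have h2 : Real.sqrt (M i i) ≠ 0 := (Real.sqrt_pos.mpr (hpos i)).ne'
    field_simp
    rw [pow_two, this]
  have htr : (D * M * D).trace = n := by
    simp [Matrix.trace, hNd]
  have hdet : (D * M * D).det ≤ 1 := by
    rw [hN.isHermitian.det_eq_prod_eigenvalues]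
    have h1 : ∑ i, hN.isHermitian.eigenvalues i = n := by
      have := hN.isHermitian.trace_eq_sum_eigenvalues
      rw [htr] at this
      simpa using this.symm
    calc ∏ i, ((hN.isHermitian.eigenvalues i : ℝ)) ≤ ∏ i, Real.exp (hN.isHermitian.eigenvalues i - 1) := by
          apply Finset.prod_le_prod
          · intro i _; exact hN.eigenvalues_nonneg i
          · intro i _
            have := Real.add_one_le_exp (hN.isHermitian.eigenvalues i - 1)
            linarith
      _ = 1 := by
          rw [← Real.exp_sum, Finset.sum_sub_distrib, h1]; simp
  have h2 : (D * M * D).det = M.det / ∏ i, M i i := by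
    rw [Matrix.det_mul, Matrix.det_mul, hD, Matrix.det_diagonal]
    have : ∏ i, M i i = (∏ i, Real.sqrt (M i i)) * (∏ i, Real.sqrt (M i i)) := by
      rw [← Finset.prod_mul_distrib]
      exact Finset.prod_congr rfl fun i _ => (Real.mul_self_sqrt (hdiag i)).symm
    rw [this, Finset.prod_inv_distrib]
    have h3 : ∏ i, Real.sqrt (M i i) ≠ 0 := Finset.prod_ne_zero_iff.mpr fun i _ => (Real.sqrt_pos.mpr (hpos i)).ne'
    field_simp
  rw [h2, div_le_one (Finset.prod_pos fun i _ => hpos i)] at hdet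
  exact hdet

lemma hadamard_v {n : ℕ} (M : Matrix (Fin n) (Fin n) ℝ) (hM : M.PosSemidef) (v : Fin n → ℝ) (i0 : Fin n)
    (hv : v i0 ^ 2 = 1) : M.det ≤ (v ⬝ᵥ M.mulVec v) * ∏ i ∈ univ.erase i0, M i i := by
  set P : Matrix (Fin n) (Fin n) ℝ := (1 : Matrix (Fin n) (Fin n) ℝ).updateRow i0 v with hP
  have hN := hM.mul_mul_conjTranspose_same P
  have hdP : P.det = v i0 := by
    rw [hP]
    have h2 := Matrix.det_updateRow_sum (1 : Matrix (Fin n) (Fin n) ℝ) i0 v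
    have h1 : (∑ k, v k • (1 : Matrix (Fin n) (Fin n) ℝ) k) = v := by
      funext j
      simp [Finset.sum_apply, Matrix.one_apply]
    rw [h1] at h2
    simpa using h2
  have hdet : (P * M * P.conjTranspose).det = M.det := by
    rw [Matrix.det_mul, Matrix.det_mul, Matrix.det_conjTranspose, hdP]
    simp only [star_trivial]
    linear_combination M.det * hv
  have hd : ∀ i, (P * M * P.conjTranspose) i i = (P i) ⬝ᵥ M.mulVec (P i) := by
    intro i
    rw [Matrix.mul_assoc, Matrix.mul_apply_eq_vecMul, Matrix.vecMul_eq_sum]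
    simp only [dotProduct, Finset.sum_apply, Pi.smul_apply, smul_eq_mul, Matrix.mulVec, Matrix.mul_apply,
      Matrix.conjTranspose_apply, star_trivial]
  rw [← hdet]
  refine (hadamard _ hN).trans (le_of_eq ?_)
  rw [← Finset.mul_prod_erase univ _ (mem_univ i0), hd]
  congr 1
  · rw [hP, Matrix.updateRow_self]
  · refine Finset.prod_congr rfl fun i hi => ?_
    rw [hd, hP, Matrix.updateRow_ne (Finset.ne_of_mem_erase hi)]
    have h1 : (1 : Matrix (Fin n) (Fin n) ℝ) i = Pi.single i 1 := by
      funext j; simp [Matrix.one_apply, Pi.single_apply, eq_comm]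
    rw [h1]
    simp

variable {G : Type} [AddCommGroup G] [Fintype G]

lemma Mg_quad {n : ℕ} (g : Fin n → G) (v : Fin n → ℝ) :
    v ⬝ᵥ (Mg g).mulVec v = ∑ x ∈ Ig g, (v x.1 + v x.2.1 + v x.2.2) ^ 2 := by
  have h : ∀ x : Fin n × Fin n × Fin n, v x.1 + v x.2.1 + v x.2.2 = ∑ i, (B n x i : ℝ) * v i := by
    intro x
    simp [B, add_mul, Finset.sum_add_distrib]
  simp only [dotProduct, Matrix.mulVec, Mg]
  simp_rw [h, pow_two, Finset.sum_mul_sum, Finset.sum_mul, Finset.mul_sum]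
  conv_rhs => rw [Finset.sum_comm]
  refine Finset.sum_congr rfl fun i _ => ?_
  conv_rhs => rw [Finset.sum_comm]
  refine Finset.sum_congr rfl fun j _ => Finset.sum_congr rfl fun x _ => ?_
  ring

lemma Mg_psd {n : ℕ} (g : Fin n → G) : (Mg g).PosSemidef := by
  refine Matrix.PosSemidef.of_dotProduct_mulVec_nonneg ?_ ?_
  · ext i j
    simp only [Matrix.conjTranspose_apply, star_trivial, Mg]
    exact Finset.sum_congr rfl fun x _ => mul_comm _ _
  · intro v
    have := Mg_quad g v
    simp only [star_trivial]
    rw [this]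
    positivity

end CLAux

namespace CLAux
open CLPaper Finset

variable {G : Type} [AddCommGroup G] [Fintype G]

def uH (H : AddSubgroup G) (a : G) : ℝ := if a ∈ H then ((Nat.card H : ℝ))⁻¹ else 0

lemma card_filter_H (H : AddSubgroup G) : ((univ.filter (fun a : G => a ∈ H)).card : ℝ) = Nat.card H := by
  rw [Nat.card_eq_fintype_card, Fintype.card_subtype]

lemma cardH_pos (H : AddSubgroup G) : (0:ℝ) < Nat.card H := by
  exact_mod_cast Nat.card_pos

lemma uH_sum (H : AddSubgroup G) : ∑ a, uH H a = 1 := by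
  simp only [uH]
  rw [← Finset.sum_filter, Finset.sum_const, nsmul_eq_mul, card_filter_H]
  exact mul_inv_cancel₀ (cardH_pos H).ne'

lemma sum_refl (f : G → ℝ) (a : G) : ∑ b, f (-a - b) = ∑ b, f b :=
  Equiv.sum_comp (Equiv.subLeft (-a)) f

lemma dd_sum (μ : G → ℝ) : ∑ a, dd μ a = (∑ a, μ a) ^ 2 := by
  simp only [dd]
  rw [Finset.sum_comm, pow_two, Finset.sum_mul]
  refine Finset.sum_congr rfl fun b _ => ?_
  rw [← Finset.mul_sum]
  congr 1
  have : ∀ a, -a - b = -b - a := fun a => by abel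
  simp_rw [this]
  exact sum_refl μ b

lemma exact_sol (h3 : Nat.Coprime (Nat.card G) 3) (μ : G → ℝ) (h0 : ∀ a, 0 ≤ μ a) (h1 : ∑ a, μ a = 1)
    (hsol : ∀ a, μ a = dd μ a) : ∃ H : AddSubgroup G, ∀ a, μ a = uH H a := by
  obtain ⟨a0, -, ha0⟩ := Finset.exists_max_image univ μ ⟨0, mem_univ _⟩
  set m := μ a0 with hm
  have hle : ∀ a, μ a ≤ m := fun a => ha0 a (mem_univ a)
  have hmpos : 0 < m := by
    by_contra hcon
    have : ∑ a, μ a ≤ 0 := Finset.sum_nonpos fun a _ => (hle a).trans (not_lt.mp hcon)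
    linarith
  -- key step
  have key : ∀ a, μ a = m → ∀ b, 0 < μ b → μ (-a - b) = m := by
    intro a ha b hb
    have hs : ∑ b, μ b * (m - μ (-a - b)) = 0 := by
      have : ∑ b, μ b * (m - μ (-a - b)) = (∑ b, μ b) * m - dd μ a := by
        rw [dd, Finset.sum_mul, ← Finset.sum_sub_distrib]
        exact Finset.sum_congr rfl fun b _ => by ring
      rw [this, h1, ← hsol, ha]; ring
    have hn : ∀ b ∈ univ, 0 ≤ μ b * (m - μ (-a - b)) := fun b _ => mul_nonneg (h0 b) (by linarith [hle (-a - b)])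
    have := (Finset.sum_eq_zero_iff_of_nonneg hn).mp hs b (mem_univ b)
    rcases mul_eq_zero.mp this with h | h
    · linarith
    · linarith
  set A : Finset G := univ.filter (fun a => μ a = m) with hA
  set S : Finset G := univ.filter (fun a => 0 < μ a) with hS
  have hAS : A ⊆ S := by
    intro a ha
    simp only [hA, hS, mem_filter, mem_univ, true_and] at ha ⊢
    rw [ha]; exact hmpos
  have hcard : S.card ≤ A.card := by
    refine Finset.card_le_card_of_injOn (fun b => -a0 - b) ?_ ?_
    · intro b hb
      simp only [hA, hS, mem_filter, mem_univ, true_and, Finset.coe_filter, Set.mem_setOf_eq] at hb ⊢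
      exact key a0 rfl b hb
    · intro b _ b' _ h
      simpa using h
  have hEq : A = S := Finset.eq_of_subset_of_card_le hAS hcard
  have hAiff : ∀ a, μ a = m ∨ μ a = 0 := by
    intro a
    by_cases h : 0 < μ a
    · left
      have : a ∈ S := by simp [hS, h]
      rw [← hEq] at this
      simpa [hA] using this
    · right; exact le_antisymm (not_lt.mp h) (h0 a)
  have cl : ∀ a b, μ a = m → μ b = m → μ (-a - b) = m := fun a b ha hb => key a ha b (by rw [hb]; exact hmpos)
  have tr : ∀ k : ℕ, μ (a0 + (3 * k) • a0) = m := by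
    intro k
    induction k with
    | zero => simp [hm]
    | succ k ih =>
      have e2 : μ (-a0 - a0) = m := cl a0 a0 rfl rfl
      have e3 := cl _ _ (show μ a0 = m from rfl) ih
      have e4 := cl _ _ e2 e3
      convert e4 using 2
      rw [mul_add, add_smul]
      simp only [mul_one]
      have : (3:ℕ) • a0 = a0 + a0 + a0 := by rw [succ_nsmul, two_nsmul]
      rw [this]
      abel
  have z : μ 0 = m := by
    have : ∃ k : ℕ, a0 + (3 * k) • a0 = 0 := by
      have hc : Nat.card G % 3 = 1 ∨ Nat.card G % 3 = 2 := by
        have : ¬ 3 ∣ Nat.card G := by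
          intro hd
          have := Nat.dvd_gcd hd (dvd_refl 3)
          rw [h3] at this
          omega
        omega
      have hz : ∀ t : ℕ, (t * Nat.card G) • a0 = 0 := fun t => by
        rw [mul_smul, card_nsmul_eq_zero', smul_zero]
      have hx : ∀ k, a0 + (3 * k) • a0 = (3 * k + 1) • a0 := fun k => by rw [add_smul, one_smul, add_comm]
      rcases hc with hc | hc
      · refine ⟨Nat.card G / 3, ?_⟩
        rw [hx, show 3 * (Nat.card G / 3) + 1 = 1 * Nat.card G by omega]
        exact hz 1
      · refine ⟨2 * (Nat.card G / 3) + 1, ?_⟩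
        rw [hx, show 3 * (2 * (Nat.card G / 3) + 1) + 1 = 2 * Nat.card G by omega]
        exact hz 2
    obtain ⟨k, hk⟩ := this
    rw [← hk]; exact tr k
  have hneg : ∀ a, μ a = m → μ (-a) = m := fun a ha => by
    have := cl a 0 ha z; simpa using this
  let H : AddSubgroup G :=
    { carrier := {a | μ a = m}
      zero_mem' := z
      add_mem' := by
        intro a b ha hb
        have := cl _ _ (hneg a ha) (hneg b hb)
        simpa using this
      neg_mem' := by
        intro a ha; exact hneg a ha }
  have hH : ∀ a, a ∈ H ↔ μ a = m := fun a => Iff.rfl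
  refine ⟨H, fun a => ?_⟩
  have hmH : m * Nat.card H = 1 := by
    rw [← h1, ← card_filter_H, mul_comm, ← nsmul_eq_mul, ← Finset.sum_const, Finset.sum_filter]
    refine Finset.sum_congr rfl fun a _ => ?_
    rw [hH]
    rcases hAiff a with h | h
    · rw [if_pos h, h]
    · rw [if_neg (by rw [h]; exact hmpos.ne), h]
  simp only [uH, hH]
  split_ifs with h
  · rw [h]; exact eq_inv_of_mul_eq_one_left hmH
  · exact (hAiff a).resolve_left h

lemma nu_H_split (μ : G → ℝ) (H : AddSubgroup G) (a : G) (ha : a ∈ H) :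
    dd μ a = (Nat.card H : ℝ)⁻¹ + 2 * (Nat.card H : ℝ)⁻¹ * ((∑ b ∈ univ.filter (· ∈ H), μ b) - 1) +
      ∑ b, (μ b - uH H b) * (μ (-a - b) - uH H (-a - b)) := by
  have hm : ∀ b, (-a - b ∈ H) ↔ b ∈ H := by
    intro b
    rw [sub_eq_add_neg, H.add_mem_cancel_left (H.neg_mem ha), H.neg_mem_iff]
  have hu : ∀ b, uH H (-a - b) = uH H b := fun b => by simp only [uH, hm]
  have hcp := cardH_pos H
  have e1 : ∑ b, uH H b * μ b = (Nat.card H : ℝ)⁻¹ * ∑ b ∈ univ.filter (· ∈ H), μ b := by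
    rw [Finset.mul_sum, Finset.sum_filter]
    refine Finset.sum_congr rfl fun b _ => ?_
    simp only [uH]; split_ifs <;> simp
  have e2 : ∑ b, uH H b * μ (-a - b) = (Nat.card H : ℝ)⁻¹ * ∑ b ∈ univ.filter (· ∈ H), μ b := by
    rw [← e1, ← sum_refl (fun b => uH H b * μ b) a]
    exact Finset.sum_congr rfl fun b _ => by rw [hu]
  have e3 : ∑ b, uH H b * uH H b = (Nat.card H : ℝ)⁻¹ := by
    have : ∀ b, uH H b * uH H b = (Nat.card H : ℝ)⁻¹ * uH H b := by
      intro b; simp only [uH]; split_ifs <;> simp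
    simp_rw [this]
    rw [← Finset.mul_sum, uH_sum, mul_one]
  have : ∑ b, (μ b - uH H b) * (μ (-a - b) - uH H (-a - b)) =
      dd μ a - ∑ b, uH H b * μ b - ∑ b, uH H b * μ (-a - b) + ∑ b, uH H b * uH H b := by
    rw [dd, ← Finset.sum_sub_distrib, ← Finset.sum_sub_distrib, ← Finset.sum_add_distrib]
    refine Finset.sum_congr rfl fun b _ => ?_
    rw [hu]; ring
  rw [this, e1, e2, e3]; ring

lemma out_sum_ge (μ : G → ℝ) (h0 : ∀ a, 0 ≤ μ a) (H : AddSubgroup G) :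
    2 * ((∑ b ∈ univ.filter (· ∈ H), μ b) * (∑ b ∈ univ.filter (· ∉ H), μ b)) ≤ ∑ a ∈ univ.filter (· ∉ H), dd μ a := by
  have e1 : ∑ a ∈ univ.filter (· ∉ H), dd μ a = ∑ b, ∑ c, (if b + c ∈ H then 0 else 1) * (μ b * μ c) := by
    rw [Finset.sum_filter]
    simp only [dd]
    have : ∀ a : G, (if a ∉ H then ∑ b, μ b * μ (-a - b) else 0) = ∑ b, (if a ∈ H then 0 else 1) * (μ b * μ (-a - b)) := by
      intro a; split_ifs <;> simp_all
    simp_rw [this]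
    rw [Finset.sum_comm]
    refine Finset.sum_congr rfl fun b _ => ?_
    rw [← sum_refl (fun c => (if b + c ∈ H then 0 else 1) * (μ b * μ c)) b]
    refine Finset.sum_congr rfl fun a _ => ?_
    have h2 : b + (-b - a) = -a := by abel
    have h3 : -b - a = -a - b := by abel
    rw [h2, H.neg_mem_iff, h3]
  have e2 : (∑ b ∈ univ.filter (· ∈ H), μ b) * (∑ b ∈ univ.filter (· ∉ H), μ b) =
      ∑ b, ∑ c, (if b ∈ H ∧ c ∉ H then 1 else 0) * (μ b * μ c) := by
    rw [Finset.sum_filter, Finset.sum_filter, Finset.sum_mul_sum]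
    refine Finset.sum_congr rfl fun b _ => Finset.sum_congr rfl fun c _ => ?_
    by_cases hb : b ∈ H <;> by_cases hc : c ∈ H <;> simp [hb, hc]
  have e3 : (∑ b ∈ univ.filter (· ∈ H), μ b) * (∑ b ∈ univ.filter (· ∉ H), μ b) =
      ∑ b, ∑ c, (if c ∈ H ∧ b ∉ H then 1 else 0) * (μ b * μ c) := by
    rw [e2, Finset.sum_comm]
    refine Finset.sum_congr rfl fun b _ => Finset.sum_congr rfl fun c _ => ?_
    ring
  rw [two_mul]
  nth_rewrite 1 [e2]
  rw [e3, e1, ← Finset.sum_add_distrib]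
  refine Finset.sum_le_sum fun b _ => ?_
  rw [← Finset.sum_add_distrib]
  refine Finset.sum_le_sum fun c _ => ?_
  have hp := mul_nonneg (h0 b) (h0 c)
  by_cases hb : b ∈ H <;> by_cases hc : c ∈ H
  · simp [hb, hc, H.add_mem hb hc]
  · simp [hb, hc, H.add_mem_cancel_left hb]
  · simp [hb, hc, H.add_mem_cancel_right hc]
  · simp only [hb, hc]; simp; split_ifs <;> simp [hp]

lemma stab_local (μ : G → ℝ) (h0 : ∀ a, 0 ≤ μ a) (h1 : ∑ a, μ a = 1) (H : AddSubgroup G)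
    (hρ : ‖μ - uH H‖ ≤ 1 / (4 * (Fintype.card G : ℝ))) :
    ‖μ - uH H‖ ≤ 2 * (1 + 4 * (Fintype.card G : ℝ)) * ‖μ - dd μ‖ := by
  set N : ℝ := (Fintype.card G : ℝ) with hN
  have hN1 : 1 ≤ N := by
    rw [hN]; exact_mod_cast Fintype.card_pos
  set ρ := ‖μ - uH H‖ with hρd
  set D := ‖μ - dd μ‖ with hDd
  have hD0 : 0 ≤ D := norm_nonneg _
  have hρ0 : 0 ≤ ρ := norm_nonneg _
  have hδ : ∀ a, |μ a - uH H a| ≤ ρ := fun a => norm_le_pi_norm (μ - uH H) a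
  have hDa : ∀ a, |μ a - dd μ a| ≤ D := fun a => norm_le_pi_norm (μ - dd μ) a
  set τ := ∑ b ∈ univ.filter (· ∉ H), μ b with hτ
  have hsplit : (∑ b ∈ univ.filter (· ∈ H), μ b) = 1 - τ := by
    rw [← h1, hτ, ← Finset.sum_filter_add_sum_filter_not univ (· ∈ H)]; ring
  have hτ0 : 0 ≤ τ := Finset.sum_nonneg fun a _ => h0 a
  have hcardle : ((univ.filter (fun a : G => a ∉ H)).card : ℝ) ≤ N := by
    rw [hN]; exact_mod_cast Finset.card_le_univ _
  have hτN : τ ≤ N * ρ := by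
    calc τ ≤ ∑ b ∈ univ.filter (· ∉ H), ρ := by
          refine Finset.sum_le_sum fun b hb => ?_
          have := hδ b
          simp only [mem_filter, mem_univ, true_and] at hb
          simp only [uH, if_neg hb, sub_zero] at this
          exact (le_abs_self _).trans this
      _ ≤ N * ρ := by
          rw [Finset.sum_const, nsmul_eq_mul]
          gcongr
  have hNρ : N * ρ ≤ 1 / 4 := by
    calc N * ρ ≤ N * (1 / (4 * N)) := by gcongr
      _ = 1 / 4 := by field_simp
  have hτD : τ ≤ 2 * N * D := by
    have h2 := out_sum_ge μ h0 H
    rw [hsplit, ← hτ] at h2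
    have h3 : ∑ a ∈ univ.filter (· ∉ H), dd μ a - τ ≤ N * D := by
      rw [hτ, ← Finset.sum_sub_distrib]
      calc _ ≤ ∑ a ∈ univ.filter (fun a : G => a ∉ H), D := by
            refine Finset.sum_le_sum fun a _ => ?_
            have := hDa a
            rw [abs_le] at this
            linarith [this.1]
        _ ≤ N * D := by
          rw [Finset.sum_const, nsmul_eq_mul]
          gcongr
    nlinarith
  have hch : (1:ℝ) ≤ Nat.card H := by exact_mod_cast Nat.card_pos
  have hchi : (Nat.card H : ℝ)⁻¹ ≤ 1 := inv_le_one_of_one_le₀ hch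
  have hchp : 0 < (Nat.card H : ℝ)⁻¹ := inv_pos.mpr (by linarith)
  have hall : ∀ a, |μ a - uH H a| ≤ D + 2 * τ + ρ / 2 := by
    intro a
    by_cases ha : a ∈ H
    · have h2 := nu_H_split μ H a ha
      rw [hsplit] at h2
      set E := ∑ b, (μ b - uH H b) * (μ (-a - b) - uH H (-a - b)) with hE
      have hEb : |E| ≤ ρ / 2 := by
        calc |E| ≤ ∑ b, |(μ b - uH H b) * (μ (-a - b) - uH H (-a - b))| := Finset.abs_sum_le_sum_abs _ _
          _ ≤ ∑ b : G, ρ * ρ := by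
            refine Finset.sum_le_sum fun b _ => ?_
            rw [abs_mul]
            exact mul_le_mul (hδ _) (hδ _) (abs_nonneg _) hρ0
          _ = N * ρ * ρ := by simp [hN]; ring
          _ ≤ ρ / 2 := by nlinarith
      have h3 := hDa a
      have : μ a - uH H a = (μ a - dd μ a) - 2 * (Nat.card H : ℝ)⁻¹ * τ + E := by
        rw [h2, uH, if_pos ha]; ring
      rw [this]
      have hτ1 : (Nat.card H : ℝ)⁻¹ * τ ≤ τ := by nlinarith
      have hτ2 : 0 ≤ (Nat.card H : ℝ)⁻¹ * τ := by positivity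
      rw [abs_le] at h3 hEb ⊢
      constructor <;> nlinarith [h3.1, h3.2, hEb.1, hEb.2]
    · simp only [uH, if_neg ha, sub_zero]
      rw [abs_of_nonneg (h0 a)]
      have : μ a ≤ τ := by
        rw [hτ]; exact Finset.single_le_sum (f := μ) (fun b _ => h0 b) (by simp [ha])
      linarith
  have hfin : ρ ≤ D + 2 * τ + ρ / 2 := by
    rw [hρd]
    refine (pi_norm_le_iff_of_nonneg (by positivity)).mpr ?_
    intro a; exact hall a
  nlinarith

theorem stability (h3 : Nat.Coprime (Nat.card G) 3) : ∃ c > 0, ∃ r0 > 0, ∀ μ : G → ℝ, (∀ a, 0 ≤ μ a) → ∑ a, μ a = 1 →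
    ∀ r, 0 < r → r ≤ r0 → (∀ H : AddSubgroup G, r < ‖μ - uH H‖) → c * r ≤ ‖μ - dd μ‖ := by
  set N : ℝ := (Fintype.card G : ℝ) with hN
  have hN1 : 1 ≤ N := by
    rw [hN]; exact_mod_cast Fintype.card_pos
  set ρ0 := 1 / (4 * N) with hρ0
  have hrhopos : 0 < ρ0 := by positivity
  set S : Set (G → ℝ) := stdSimplex ℝ G ∩ {μ | ∀ H : AddSubgroup G, ρ0 ≤ ‖μ - uH H‖} with hS
  have hScl : IsClosed {μ : G → ℝ | ∀ H : AddSubgroup G, ρ0 ≤ ‖μ - uH H‖} := by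
    have : {μ : G → ℝ | ∀ H : AddSubgroup G, ρ0 ≤ ‖μ - uH H‖} = ⋂ H : AddSubgroup G, {μ | ρ0 ≤ ‖μ - uH H‖} := by
      ext; simp
    rw [this]
    exact isClosed_iInter fun H => isClosed_le continuous_const (by fun_prop)
  have hSc : IsCompact S := (isCompact_stdSimplex ℝ G).inter_right hScl
  have hcont : Continuous fun μ : G → ℝ => ‖μ - dd μ‖ := by
    have : Continuous fun μ : G → ℝ => dd μ := by
      refine continuous_pi fun a => ?_
      simp only [dd]
      fun_prop
    fun_prop
  obtain ⟨m, hm, hmS⟩ : ∃ m > 0, ∀ μ ∈ S, m ≤ ‖μ - dd μ‖ := by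
    rcases S.eq_empty_or_nonempty with h | h
    · exact ⟨1, one_pos, by simp [h]⟩
    · obtain ⟨x, hx, hmin⟩ := hSc.exists_isMinOn h hcont.continuousOn
      refine ⟨‖x - dd x‖, ?_, fun μ hμ => hmin hμ⟩
      rw [gt_iff_lt, norm_pos_iff]
      intro hz
      have hz' : ∀ a, x a = dd x a := fun a => by
        have := congrFun hz a
        simp only [Pi.sub_apply, Pi.zero_apply] at this
        linarith
      obtain ⟨H, hH⟩ := exact_sol h3 x hx.1.1 hx.1.2 hz'
      have := hx.2 H
      rw [show x = uH H from funext hH] at this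
      simp at this
      linarith
  refine ⟨min (m / ρ0) (1 / (2 * (1 + 4 * N))), by positivity, ρ0, hrhopos, ?_⟩
  intro μ h0 h1 r hr hr0 hfar
  by_cases hx : ∀ H : AddSubgroup G, ρ0 ≤ ‖μ - uH H‖
  · have := hmS μ ⟨⟨h0, h1⟩, hx⟩
    calc min (m / ρ0) (1 / (2 * (1 + 4 * N))) * r ≤ (m / ρ0) * ρ0 := by
          gcongr; exact min_le_left _ _
      _ = m := by field_simp
      _ ≤ _ := this
  · push Not at hx
    obtain ⟨H, hH⟩ := hx
    have := stab_local μ h0 h1 H hH.le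
    have h2 := hfar H
    calc min (m / ρ0) (1 / (2 * (1 + 4 * N))) * r ≤ (1 / (2 * (1 + 4 * N))) * ‖μ - uH H‖ := by
          gcongr; exact min_le_right _ _
      _ ≤ (1 / (2 * (1 + 4 * N))) * (2 * (1 + 4 * N) * ‖μ - dd μ‖) := by gcongr
      _ = ‖μ - dd μ‖ := by field_simp

end CLAux

namespace CLAux
open CLPaper Finset Filter

variable {G : Type} [AddCommGroup G] [Fintype G]

def mu {n : ℕ} (g : Fin n → G) (a : G) : ℝ := cnt g a / n

/-- normalized diagonal of `Mg` -/
def nv (n : ℕ) (μ : G → ℝ) (a : G) : ℝ := dd μ a + 2 * μ (-a - a) / n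

lemma mu_nonneg {n : ℕ} (g : Fin n → G) (a : G) : 0 ≤ mu g a :=
  div_nonneg (cnt_nonneg g a) (Nat.cast_nonneg n)

lemma mu_sum {n : ℕ} (hn : 0 < n) (g : Fin n → G) : ∑ a, mu g a = 1 := by
  simp only [mu]
  rw [← Finset.sum_div, cnt_sum]
  exact div_self (by positivity)

lemma cnt_eq_mu {n : ℕ} (hn : 0 < n) (g : Fin n → G) (a : G) : cnt g a = n * mu g a := by
  simp only [mu]
  have : (n:ℝ) ≠ 0 := by positivity
  field_simp

lemma mu_le_one {n : ℕ} (hn : 0 < n) (g : Fin n → G) (a : G) : mu g a ≤ 1 := by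
  rw [← mu_sum hn g]
  exact Finset.single_le_sum (f := mu g) (fun b _ => mu_nonneg g b) (mem_univ a)

lemma dd_nonneg (μ : G → ℝ) (h0 : ∀ a, 0 ≤ μ a) (a : G) : 0 ≤ dd μ a :=
  Finset.sum_nonneg fun b _ => mul_nonneg (h0 b) (h0 _)

lemma nv_nonneg (n : ℕ) (μ : G → ℝ) (h0 : ∀ a, 0 ≤ μ a) (a : G) : 0 ≤ nv n μ a := by
  have := dd_nonneg μ h0 a
  have := h0 (-a - a)
  unfold nv; positivity

lemma dd_mu {n : ℕ} (hn : 0 < n) (g : Fin n → G) (a : G) : dd (cnt g) a = n ^ 2 * dd (mu g) a := by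
  simp only [dd]
  rw [Finset.mul_sum]
  refine Finset.sum_congr rfl fun b _ => ?_
  rw [cnt_eq_mu hn, cnt_eq_mu hn]; ring

lemma Mg_diag {n : ℕ} (hn : 0 < n) (g : Fin n → G) (i : Fin n) :
    Mg g i i = 3 * (n:ℝ) ^ 2 * nv n (mu g) (g i) := by
  rw [Mg_eq, if_pos rfl, dd_mu hn, cnt_eq_mu hn, nv]
  have : (n:ℝ) ≠ 0 := by positivity
  field_simp; ring

def WW {n : ℕ} (g : Fin n → G) : ℝ := (Mg g).det / cN n

lemma cN_nonneg (n : ℕ) : 0 ≤ cN n := by unfold cN; positivity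
lemma cN_pos {n : ℕ} (hn : 0 < n) : 0 < cN n := by unfold cN; positivity

lemma WW_nonneg {n : ℕ} (g : Fin n → G) : 0 ≤ WW g :=
  div_nonneg (Mg_psd g).det_nonneg (cN_nonneg n)

lemma WW_le {n : ℕ} (hn : 0 < n) (g : Fin n → G) : WW g ≤ ∏ j, nv n (mu g) (g j) := by
  have h := hadamard _ (Mg_psd g)
  simp_rw [Mg_diag hn] at h
  rw [Finset.prod_mul_distrib] at h
  rw [WW, div_le_iff₀ (cN_pos hn)]
  refine h.trans ?_
  have h2 : (∏ i : Fin n, (3:ℝ) * (n:ℝ) ^ 2) ≤ cN n := by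
    rw [Finset.prod_const, cN, mul_pow, ← pow_mul, Finset.card_univ, Fintype.card_fin]
    gcongr <;> simp
  have h3 : 0 ≤ ∏ j, nv n (mu g) (g j) := Finset.prod_nonneg fun j _ => nv_nonneg n _ (mu_nonneg g) _
  rw [mul_comm]
  gcongr

lemma dd_le_one (μ : G → ℝ) (h0 : ∀ a, 0 ≤ μ a) (h1 : ∑ a, μ a = 1) (a : G) : dd μ a ≤ 1 := by
  have := dd_sum μ
  rw [h1] at this
  have h2 := Finset.single_le_sum (f := dd μ) (fun b _ => dd_nonneg μ h0 b) (mem_univ a)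
  linarith

lemma sum_prod_pow (n : ℕ) (f : G → ℝ) : ∑ g : Fin n → G, ∏ j, f (g j) = (∑ a, f a) ^ n := by
  rw [Fintype.sum_pow]

lemma chernoff (n : ℕ) (hn : 0 < n) (ν : G → ℝ) (hν : ∀ a, 0 ≤ ν a) (z : ℝ) (hz : ∑ a, ν a ≤ 1 + z) (a : G) (ha : ν a ≤ 3)
    (y : ℝ) (hy : |y - ν a| ≤ 6) (F : Finset (Fin n → G)) (hF : ∀ g ∈ F, mu g a = y) :
    ∑ g ∈ F, ∏ j, ν (g j) ≤ Real.exp (n * z - n * (y - ν a) ^ 2 / 12) := by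
  set l := (y - ν a) / 6 with hl
  have hl1 : |l| ≤ 1 := by
    rw [hl, abs_div, abs_of_pos (by norm_num : (0:ℝ) < 6)]
    linarith
  set f : G → ℝ := fun b => ν b * (if b = a then Real.exp l else 1) with hf
  have hf0 : ∀ b, 0 ≤ f b := fun b => by
    have := hν b
    simp only [hf]; split_ifs <;> positivity
  have hprod : ∀ g ∈ F, ∏ j, ν (g j) = Real.exp (-(l * (n * y))) * ∏ j, f (g j) := by
    intro g hg
    simp only [hf]
    rw [Finset.prod_mul_distrib, Finset.prod_ite, Finset.prod_const, Finset.prod_const_one, mul_one, ← Real.exp_nat_mul]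
    have : ((univ.filter fun i => g i = a).card : ℝ) = n * y := by
      rw [← hF g hg, ← cnt_eq_mu hn]; rfl
    rw [this, mul_comm (∏ j, ν (g j)), ← mul_assoc, ← Real.exp_add]
    rw [show -(l * (n * y)) + n * y * l = 0 by ring, Real.exp_zero, one_mul]
  rw [Finset.sum_congr rfl hprod, ← Finset.mul_sum]
  have hsumf : ∑ b, f b = ∑ b, ν b + ν a * (Real.exp l - 1) := by
    have : ∀ b, f b = ν b + if b = a then ν b * (Real.exp l - 1) else 0 := by
      intro b; simp only [hf]; split_ifs <;> ring
    simp_rw [this]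
    rw [Finset.sum_add_distrib]; simp
  have hexp : Real.exp l - 1 ≤ l + l ^ 2 := by
    have := Real.abs_exp_sub_one_sub_id_le hl1
    rw [abs_le] at this
    linarith [this.2]
  have hsle : ∑ b, f b ≤ Real.exp (z + ν a * l + 3 * l ^ 2) := by
    rw [hsumf]
    have h1 : ν a * (Real.exp l - 1) ≤ ν a * (l + l ^ 2) := mul_le_mul_of_nonneg_left hexp (hν a)
    have h2 : ν a * l ^ 2 ≤ 3 * l ^ 2 := by gcongr
    have h3 := Real.add_one_le_exp (z + ν a * l + 3 * l ^ 2)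
    nlinarith
  calc Real.exp (-(l * (n * y))) * ∑ g ∈ F, ∏ j, f (g j)
      ≤ Real.exp (-(l * (n * y))) * ∑ g : Fin n → G, ∏ j, f (g j) := by
        gcongr
        · intro g _ _; exact Finset.prod_nonneg fun j _ => hf0 _
        · exact Finset.subset_univ F
    _ = Real.exp (-(l * (n * y))) * (∑ b, f b) ^ n := by rw [sum_prod_pow]
    _ ≤ Real.exp (-(l * (n * y))) * (Real.exp (z + ν a * l + 3 * l ^ 2)) ^ n := by
        have : 0 ≤ ∑ b, f b := Finset.sum_nonneg fun b _ => hf0 b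
        gcongr
    _ = Real.exp (n * z - n * (y - ν a) ^ 2 / 12) := by
        rw [← Real.exp_nat_mul, ← Real.exp_add]
        congr 1
        rw [hl]; ring

lemma card_types (n : ℕ) : ((univ : Finset (Fin n → G)).image mu).card ≤ (n + 1) ^ (Fintype.card G) := by
  have : (univ : Finset (Fin n → G)).image mu ⊆
      (univ : Finset (G → Fin (n + 1))).image (fun t a => ((t a : ℕ) : ℝ) / n) := by
    intro m hm
    simp only [mem_image, mem_univ, true_and] at hm ⊢
    obtain ⟨g, rfl⟩ := hm
    refine ⟨fun a => ⟨(univ.filter fun i => g i = a).card, ?_⟩, rfl⟩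
    have := Finset.card_le_univ (univ.filter fun i => g i = a)
    simp at this
    omega
  refine (Finset.card_le_card this).trans (Finset.card_image_le.trans ?_)
  simp

lemma tail_bound (n : ℕ) (hn : 0 < n) (V : (G → ℝ) → G → ℝ) (z s : ℝ) (hs : 0 ≤ s)
    (F : Finset (Fin n → G)) (h0 : ∀ g : Fin n → G, ∀ a, 0 ≤ V (mu g) a) (hz : ∀ g : Fin n → G, ∑ a, V (mu g) a ≤ 1 + z)
    (h3 : ∀ g : Fin n → G, ∀ a, V (mu g) a ≤ 3) (hF : ∀ g ∈ F, ∃ a, s ≤ |mu g a - V (mu g) a|) :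
    ∑ g ∈ F, ∏ j, V (mu g) (g j) ≤ ((n:ℝ) + 1) ^ (Fintype.card G) * Real.exp (n * z - n * s ^ 2 / 12) := by
  rw [← Finset.sum_fiberwise_of_maps_to (s := F) (t := univ.image mu) (g := mu) (fun g _ => Finset.mem_image_of_mem mu (mem_univ g))]
  calc _ ≤ ∑ m ∈ (univ : Finset (Fin n → G)).image mu, Real.exp (n * z - n * s ^ 2 / 12) := by
        refine Finset.sum_le_sum fun m hm => ?_
        rcases (F.filter (fun g => mu g = m)).eq_empty_or_nonempty with h | ⟨g0, hg0⟩
        · rw [h, Finset.sum_empty]; positivity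
        simp only [mem_filter] at hg0
        obtain ⟨hg0F, rfl⟩ := hg0
        obtain ⟨a, ha⟩ := hF g0 hg0F
        have e : ∑ g ∈ F.filter (fun g => mu g = mu g0), ∏ j, V (mu g) (g j) =
            ∑ g ∈ F.filter (fun g => mu g = mu g0), ∏ j, V (mu g0) (g j) := by
          refine Finset.sum_congr rfl fun g hg => ?_
          simp only [mem_filter] at hg
          rw [hg.2]
        rw [e]
        refine (chernoff n hn (V (mu g0)) (h0 g0) z (hz g0) a (h3 g0 a) (mu g0 a) ?_ _ ?_).trans ?_
        · have := h0 g0 a; have := h3 g0 a; have := mu_nonneg g0 a; have := mu_le_one hn g0 a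
          rw [abs_le]; constructor <;> linarith
        · intro g hg
          simp only [mem_filter] at hg
          rw [hg.2]
        · have : s ^ 2 ≤ (mu g0 a - V (mu g0) a) ^ 2 := by
            rw [← sq_abs (mu g0 a - V (mu g0) a)]
            gcongr
          gcongr
    _ ≤ _ := by
        rw [Finset.sum_const, nsmul_eq_mul]
        gcongr
        exact_mod_cast card_types n

lemma nv_sum_le (n : ℕ) (μ : G → ℝ) (h0 : ∀ a, 0 ≤ μ a) (h1 : ∑ a, μ a = 1) :
    ∑ a, nv n μ a ≤ 1 + 2 * (Fintype.card G : ℝ) / n := by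
  simp only [nv]
  rw [Finset.sum_add_distrib, dd_sum, h1]
  have : ∑ a : G, 2 * μ (-a - a) / n ≤ ∑ a : G, 2 * 1 / (n:ℝ) := by
    refine Finset.sum_le_sum fun a _ => ?_
    have := Finset.single_le_sum (f := μ) (fun b _ => h0 b) (mem_univ (-a - a))
    rw [h1] at this
    gcongr
  refine (add_le_add_right this _).trans (le_of_eq ?_)
  simp; ring

lemma far_bound (n : ℕ) (hn : 0 < n) (s : ℝ) (hs : 0 ≤ s) (F : Finset (Fin n → G))
    (hF : ∀ g ∈ F, s + 2 / n ≤ ‖mu g - dd (mu g)‖) :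
    ∑ g ∈ F, WW g ≤ ((n:ℝ) + 1) ^ (Fintype.card G) * Real.exp (2 * Fintype.card G - n * s ^ 2 / 12) := by
  have hn' : (0:ℝ) < n := by exact_mod_cast hn
  have hn1 : (1:ℝ) ≤ n := by exact_mod_cast hn
  calc ∑ g ∈ F, WW g ≤ ∑ g ∈ F, ∏ j, nv n (mu g) (g j) := Finset.sum_le_sum fun g _ => WW_le hn g
    _ ≤ ((n:ℝ) + 1) ^ (Fintype.card G) * Real.exp (n * (2 * (Fintype.card G : ℝ) / n) - n * s ^ 2 / 12) := by
        refine tail_bound n hn (nv n) _ s hs F ?_ ?_ ?_ ?_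
        · exact fun g a => nv_nonneg n _ (mu_nonneg g) a
        · exact fun g => nv_sum_le n _ (mu_nonneg g) (mu_sum hn g)
        · intro g a
          have h1 := dd_le_one _ (mu_nonneg g) (mu_sum hn g) a
          have h2 : 2 * mu g (-a - a) / n ≤ 2 := by
            rw [div_le_iff₀ hn']
            have := mu_le_one hn g (-a - a)
            nlinarith
          simp only [nv]; linarith
        · intro g hg
          have h1 := hF g hg
          by_contra hcon
          push Not at hcon
          have : ‖mu g - dd (mu g)‖ < s + 2 / n := by
            rw [pi_norm_lt_iff (by positivity)]
            intro a
            have h2 := hcon a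
            simp only [Pi.sub_apply, Real.norm_eq_abs]
            have h3 : 2 * mu g (-a - a) / n ≤ 2 / n := by
              have := mu_le_one hn g (-a - a)
              gcongr; linarith
            have h4 : 0 ≤ 2 * mu g (-a - a) / n := by
              have := mu_nonneg g (-a - a); positivity
            simp only [nv] at h2
            rw [abs_lt] at h2 ⊢
            constructor <;> linarith [h2.1, h2.2]
          linarith
    _ = _ := by
        congr 3
        field_simp

end CLAux

namespace CLAux
open CLPaper Finset Filter

variable {G : Type} [AddCommGroup G] [Fintype G]

def xs (n : ℕ) : ℝ := (n:ℝ) ^ ((1:ℝ) / 5)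
def rs (n : ℕ) : ℝ := ((xs n) ^ 2)⁻¹

lemma xs_pow (n : ℕ) : xs n ^ 5 = n := by
  rw [xs, ← Real.rpow_natCast, ← Real.rpow_mul (Nat.cast_nonneg n)]
  norm_num

lemma xs_tendsto : Tendsto xs atTop atTop :=
  (tendsto_rpow_atTop (by norm_num : (0:ℝ) < 1 / 5)).comp tendsto_natCast_atTop_atTop

lemma xs_pos {n : ℕ} (hn : 0 < n) : 0 < xs n := by
  unfold xs; positivity

lemma rs_pos {n : ℕ} (hn : 0 < n) : 0 < rs n := by
  have := xs_pos hn
  unfold rs; positivity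

lemma n_rs2 {n : ℕ} (hn : 0 < n) : n * rs n ^ 2 = xs n := by
  have := xs_pos hn
  rw [← xs_pow, rs]; field_simp

lemma n_rs3 {n : ℕ} (hn : 0 < n) : n * rs n ^ 3 = (xs n)⁻¹ := by
  have := xs_pos hn
  rw [← xs_pow, rs]; field_simp

lemma n_rs {n : ℕ} (hn : 0 < n) : n * rs n = xs n ^ 3 := by
  have := xs_pos hn
  rw [← xs_pow, rs]; field_simp

lemma rs_tendsto : Tendsto rs atTop (nhds 0) :=
  tendsto_inv_atTop_zero.comp ((tendsto_pow_atTop (by norm_num)).comp xs_tendsto)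

lemma xs_inv_tendsto : Tendsto (fun n => (xs n)⁻¹) atTop (nhds 0) :=
  tendsto_inv_atTop_zero.comp xs_tendsto

lemma expdecay (N : ℕ) (C k : ℝ) (hk : 0 < k) :
    Tendsto (fun n : ℕ => ((n:ℝ) + 1) ^ N * Real.exp (C - k * xs n)) atTop (nhds 0) := by
  have h1 := (tendsto_rpow_mul_exp_neg_mul_atTop_nhds_zero ((5 * N : ℕ) : ℝ) k hk).comp xs_tendsto
  have h2 := h1.const_mul (2 ^ N * Real.exp C)
  rw [mul_zero] at h2
  refine squeeze_zero' (Eventually.of_forall fun n => by positivity) ?_ h2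
  filter_upwards [eventually_ge_atTop 1] with n hn
  have hn1 : (1:ℝ) ≤ n := by exact_mod_cast hn
  simp only [Function.comp]
  rw [Real.rpow_natCast, pow_mul, xs_pow]
  calc ((n:ℝ) + 1) ^ N * Real.exp (C - k * xs n) ≤ (2 * n) ^ N * Real.exp (C - k * xs n) := by
        gcongr; linarith
    _ = _ := by
        rw [mul_pow, sub_eq_add_neg, Real.exp_add, neg_mul]; ring

def Far (n : ℕ) : Finset (Fin n → G) := univ.filter fun g => ∀ H : AddSubgroup G, rs n < ‖mu g - uH H‖
def Near (n : ℕ) (H : AddSubgroup G) : Finset (Fin n → G) := univ.filter fun g => ‖mu g - uH H‖ ≤ rs n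

lemma far_tendsto (h3 : Nat.Coprime (Nat.card G) 3) :
    Tendsto (fun n => ∑ g ∈ (Far n : Finset (Fin n → G)), WW g) atTop (nhds 0) := by
  obtain ⟨c, hc, r0, hr0, hst⟩ := stability (G := G) h3
  have hd := expdecay (Fintype.card G) (2 * Fintype.card G) ((c / 2) ^ 2 / 12) (by positivity)
  refine squeeze_zero' (Eventually.of_forall fun n => Finset.sum_nonneg fun g _ => WW_nonneg g) ?_ hd
  have e1 : ∀ᶠ n in atTop, rs n ≤ r0 := rs_tendsto.eventually (ge_mem_nhds hr0)
  have e2 : ∀ᶠ n in atTop, max 1 (4 / c) ≤ xs n := xs_tendsto.eventually_ge_atTop _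
  filter_upwards [eventually_gt_atTop 0, e1, e2] with n hn h1 h2
  have hn' : (0:ℝ) < n := by exact_mod_cast hn
  have hx1 : 1 ≤ xs n := (le_max_left _ _).trans h2
  have hxc : 4 / c ≤ xs n := (le_max_right _ _).trans h2
  have hr := rs_pos hn
  refine (far_bound n hn (c / 2 * rs n) (by positivity) _ ?_).trans (le_of_eq ?_)
  · intro g hg
    simp only [Far, mem_filter, mem_univ, true_and] at hg
    have := hst (mu g) (mu_nonneg g) (mu_sum hn g) (rs n) hr h1 hg
    refine le_trans ?_ this
    have : 2 / (n:ℝ) ≤ c / 2 * rs n := by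
      rw [div_le_iff₀ hn']
      have h3 := n_rs hn
      have h4 : xs n ≤ xs n ^ 3 := by
        nlinarith [mul_nonneg (sub_nonneg.mpr hx1) (sub_nonneg.mpr hx1)]
      rw [div_le_iff₀ hc] at hxc
      calc (2:ℝ) ≤ c / 2 * xs n := by linarith
        _ ≤ c / 2 * xs n ^ 3 := by gcongr
        _ = c / 2 * rs n * n := by rw [← h3]; ring
    linarith
  · congr 3
    rw [← n_rs2 hn]; ring

/-- fraction of uniform `g` near the uniform distribution -/
lemma near_top_card :
    Tendsto (fun n => ((Near n (⊤ : AddSubgroup G)).card : ℝ) / (Fintype.card G : ℝ) ^ n) atTop (nhds 1) := by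
  set N : ℝ := (Fintype.card G : ℝ) with hN
  have hN1 : 1 ≤ N := by
    rw [hN]; exact_mod_cast Fintype.card_pos
  have hd := expdecay (Fintype.card G) 0 (1 / 12) (by norm_num)
  have hd2 : Tendsto (fun n : ℕ => 1 - ((n:ℝ) + 1) ^ (Fintype.card G) * Real.exp (0 - 1 / 12 * xs n)) atTop (nhds 1) := by
    simpa using hd.const_sub 1
  refine tendsto_of_tendsto_of_tendsto_of_le_of_le' hd2 tendsto_const_nhds ?_ ?_
  · filter_upwards [eventually_gt_atTop 0] with n hn
    have htot : ((Near n (⊤ : AddSubgroup G)).card : ℝ) + ((univ \ Near n (⊤ : AddSubgroup G)).card : ℝ) = N ^ n := by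
      have := Finset.card_sdiff_add_card_eq_card (Finset.subset_univ (Near n (⊤ : AddSubgroup G)))
      rw [Finset.card_univ, Fintype.card_fun, Fintype.card_fin] at this
      rw [hN]
      exact_mod_cast (by rw [← this]; ring)
    have hb := tail_bound n hn (fun _ _ => (N:ℝ)⁻¹) 0 (rs n) (rs_pos hn).le (univ \ Near n (⊤ : AddSubgroup G))
      (fun _ _ => by positivity) (fun _ => by
        rw [Finset.sum_const, Finset.card_univ, nsmul_eq_mul, ← hN, mul_inv_cancel₀ (by positivity)]; simp)
      (fun _ _ => by
        have := inv_le_one_of_one_le₀ hN1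
        linarith) (by
        intro g hg
        simp only [Near, Finset.mem_sdiff, Finset.mem_univ, true_and, Finset.mem_filter, not_le] at hg
        by_contra hcon
        push Not at hcon
        have : ‖mu g - uH (⊤ : AddSubgroup G)‖ < rs n := by
          rw [pi_norm_lt_iff (rs_pos hn)]
          intro a
          have := hcon a
          simpa [uH, hN] using this
        linarith)
    rw [Finset.sum_const, nsmul_eq_mul, Finset.prod_const, Finset.card_univ, Fintype.card_fin] at hb
    have hNn : 0 < N ^ n := by positivity
    rw [le_div_iff₀ hNn]
    have e : n * (0:ℝ) - n * rs n ^ 2 / 12 = 0 - 1 / 12 * xs n := by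
      rw [← n_rs2 hn]; ring
    rw [e, inv_pow] at hb
    have hb2 := mul_le_mul_of_nonneg_right hb hNn.le
    rw [mul_assoc, inv_mul_cancel₀ hNn.ne', mul_one] at hb2
    linarith
  · refine Eventually.of_forall fun n => ?_
    have hNn : 0 < N ^ n := by positivity
    rw [div_le_one hNn]
    have := Finset.card_le_univ (Near n (⊤ : AddSubgroup G))
    rw [Fintype.card_fun, Fintype.card_fin] at this
    rw [hN]; exact_mod_cast this

end CLAux

namespace CLAux
open CLPaper Finset Filter

variable {G : Type} [AddCommGroup G] [Fintype G]

def detC (μ : G → ℝ) : ℝ := Matrix.det (1 + Matrix.of (fun a b : G => 2 * μ (-a - b) * μ b / dd μ b))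

lemma Mg_det {n : ℕ} (hn : 0 < n) (g : Fin n → G) (hd : ∀ a, dd (mu g) a ≠ 0) :
    (Mg g).det = (∏ i, (3 * (n:ℝ) ^ 2 * dd (mu g) (g i))) * detC (mu g) := by
  have hn' : (n:ℝ) ≠ 0 := by positivity
  set D : Matrix (Fin n) (Fin n) ℝ := Matrix.diagonal (fun i => 3 * (n:ℝ) ^ 2 * dd (mu g) (g i)) with hD
  set V : Matrix (Fin n) G ℝ := fun i a => if g i = a then (3 * (n:ℝ) ^ 2 * dd (mu g) a)⁻¹ else 0 with hV
  set T : Matrix G (Fin n) ℝ := fun a j => 6 * cnt g (-a - g j) with hT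
  have h1 : Mg g = D * (1 + V * T) := by
    ext i j
    rw [hD, Matrix.diagonal_mul, Matrix.add_apply, Matrix.mul_apply]
    have : ∑ a, V i a * T a j = (3 * (n:ℝ) ^ 2 * dd (mu g) (g i))⁻¹ * (6 * cnt g (-g i - g j)) := by
      simp only [hV, hT, ite_mul, zero_mul]
      simp
    rw [this, Mg_eq, dd_mu hn, Matrix.one_apply]
    have := hd (g i)
    split_ifs <;> field_simp <;> ring
  have h2 : T * V = Matrix.of (fun a b : G => 2 * (mu g) (-a - b) * (mu g) b / dd (mu g) b) := by
    ext a b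
    rw [Matrix.mul_apply, Matrix.of_apply]
    have : ∀ j, T a j * V j b = (if g j = b then 1 else 0) * (6 * cnt g (-a - b) * (3 * (n:ℝ) ^ 2 * dd (mu g) b)⁻¹) := by
      intro j
      simp only [hV, hT]
      split_ifs with h
      · rw [h]; ring
      · simp
    simp_rw [this]
    rw [← Finset.sum_mul, ← cnt_eq_sum, cnt_eq_mu hn, cnt_eq_mu hn]
    have := hd b
    field_simp; ring
  rw [h1, Matrix.det_mul, Matrix.det_one_add_mul_comm, h2, hD, Matrix.det_diagonal]
  rfl

lemma WW_eq {n : ℕ} (hn : 0 < n) (g : Fin n → G) (hd : ∀ a, dd (mu g) a ≠ 0) :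
    WW g = (∏ i, dd (mu g) (g i)) * (detC (mu g) / 3) := by
  rw [WW, Mg_det hn g hd, Finset.prod_mul_distrib, Finset.prod_const, Finset.card_univ, Fintype.card_fin, cN]
  have hn' : (n:ℝ) ≠ 0 := by positivity
  rw [mul_pow, ← pow_mul, pow_succ]
  field_simp

lemma dd_top (a : G) : dd (uH (⊤ : AddSubgroup G)) a = (Fintype.card G : ℝ)⁻¹ := by
  have hN : (Fintype.card G : ℝ) ≠ 0 := by exact_mod_cast Fintype.card_ne_zero
  simp [dd, uH]

lemma detC_cont : ContinuousAt (detC (G := G)) (uH ⊤) := by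
  have hN : (Fintype.card G : ℝ) ≠ 0 := by exact_mod_cast Fintype.card_ne_zero
  unfold detC
  refine ContinuousAt.comp (g := fun M : Matrix G G ℝ => M.det) (f := fun μ => 1 + Matrix.of (fun a b : G => 2 * μ (-a - b) * μ b / dd μ b)) ?_ ?_
  · exact (Continuous.matrix_det continuous_id).continuousAt
  · refine ContinuousAt.add continuousAt_const ?_
    refine continuousAt_pi.mpr fun a => continuousAt_pi.mpr fun b => ?_
    simp only [Matrix.of_apply]
    refine ContinuousAt.div (by fun_prop) ?_ ?_
    · simp only [dd]; fun_prop
    · rw [dd_top]; exact inv_ne_zero hN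

lemma detC_top : detC (uH (⊤ : AddSubgroup G)) = 3 := by
  have hN : (Fintype.card G : ℝ) ≠ 0 := by exact_mod_cast Fintype.card_ne_zero
  have : Matrix.of (fun a b : G => 2 * uH (⊤ : AddSubgroup G) (-a - b) * uH ⊤ b / dd (uH ⊤) b) =
      Matrix.replicateCol Unit (fun _ : G => (1:ℝ)) * Matrix.replicateRow Unit (fun _ : G => 2 * (Fintype.card G : ℝ)⁻¹) := by
    ext a b
    simp only [Matrix.of_apply, dd_top, Matrix.mul_apply]
    simp [uH]
  rw [detC, this, Matrix.det_one_add_replicateCol_mul_replicateRow]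
  simp [dotProduct]
  field_simp; norm_num

lemma exp_low (y : ℝ) (hy : |y| ≤ 1 / 2) : Real.exp (y - 2 * y ^ 2) ≤ 1 + y := by
  rw [abs_le] at hy
  have hp : 0 < 1 + y := by linarith [hy.1]
  rw [← Real.le_log_iff_exp_le hp]
  refine le_trans ?_ (Real.one_sub_inv_le_log_of_pos hp)
  have : 1 - (1 + y)⁻¹ = y / (1 + y) := by field_simp; ring
  rw [this, le_div_iff₀ hp]
  nlinarith [sq_nonneg y, mul_nonneg (sq_nonneg y) (by linarith [hy.1] : (0:ℝ) ≤ 1 + 2 * y)]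

lemma main_prod {n : ℕ} (hn : 0 < n) (g : Fin n → G) (r : ℝ) (hr0 : 0 ≤ r) (hr1 : r ≤ 1)
    (hr : (Fintype.card G : ℝ) ^ 2 * r ^ 2 ≤ 1 / 2) (hg : ‖mu g - uH (⊤ : AddSubgroup G)‖ ≤ r) :
    Real.exp (-(3 * (Fintype.card G : ℝ) ^ 4 * (n * r ^ 3))) ≤ ∏ j, ((Fintype.card G : ℝ) * dd (mu g) (g j)) ∧
     ∏ j, ((Fintype.card G : ℝ) * dd (mu g) (g j)) ≤ Real.exp (3 * (Fintype.card G : ℝ) ^ 4 * (n * r ^ 3)) ∧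
     ∀ a, 0 < dd (mu g) a := by
  set N : ℝ := (Fintype.card G : ℝ) with hN
  have hN1 : 1 ≤ N := by
    rw [hN]; exact_mod_cast Fintype.card_pos
  set δ : G → ℝ := fun a => mu g a - uH (⊤ : AddSubgroup G) a with hδ
  have hδr : ∀ a, |δ a| ≤ r := fun a => (norm_le_pi_norm (mu g - uH ⊤) a).trans hg
  set ε : G → ℝ := fun a => ∑ b, δ b * δ (-a - b) with hε
  have hdd : ∀ a, dd (mu g) a = N⁻¹ + ε a := by
    intro a
    have := nu_H_split (mu g) ⊤ a (AddSubgroup.mem_top a)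
    simp only [AddSubgroup.mem_top, Finset.filter_true, mu_sum hn] at this
    rw [this]
    simp [hN, hε, hδ]
  have hεb : ∀ a, |ε a| ≤ N * r ^ 2 := by
    intro a
    calc |ε a| ≤ ∑ b, |δ b * δ (-a - b)| := Finset.abs_sum_le_sum_abs _ _
      _ ≤ ∑ b : G, r * r := by
        refine Finset.sum_le_sum fun b _ => ?_
        rw [abs_mul]
        exact mul_le_mul (hδr _) (hδr _) (abs_nonneg _) hr0
      _ = N * r ^ 2 := by simp [hN]; ring
  have hεs : ∑ a, ε a = 0 := by
    have h1 : ∑ a, dd (mu g) a = 1 := by rw [dd_sum, mu_sum hn]; norm_num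
    simp_rw [hdd] at h1
    rw [Finset.sum_add_distrib, Finset.sum_const, Finset.card_univ, nsmul_eq_mul, ← hN,
      mul_inv_cancel₀ (by positivity)] at h1
    linarith
  set y : G → ℝ := fun a => N * ε a with hy
  have hyb : ∀ a, |y a| ≤ N ^ 2 * r ^ 2 := by
    intro a
    simp only [hy]
    rw [abs_mul, abs_of_pos (by linarith : 0 < N)]
    calc N * |ε a| ≤ N * (N * r ^ 2) := by gcongr; exact hεb a
      _ = _ := by ring
  have hNd : ∀ a, N * dd (mu g) a = 1 + y a := by
    intro a
    rw [hdd, mul_add, mul_inv_cancel₀ (by positivity)]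
  have hS : |∑ j, y (g j)| ≤ N ^ 3 * (n * r ^ 3) := by
    rw [sum_comp_cnt g y]
    have : ∑ a, cnt g a * y a = n * N * ∑ a, δ a * ε a := by
      have h2 : ∀ a, cnt g a * y a = n * N * (δ a * ε a) + n * ε a := by
        intro a
        rw [cnt_eq_mu hn]
        have : mu g a = δ a + N⁻¹ := by simp [hδ, uH, hN]
        rw [this]; simp only [hy]
        field_simp
      simp_rw [h2]
      rw [Finset.sum_add_distrib, ← Finset.mul_sum, ← Finset.mul_sum, hεs]; ring
    rw [this, abs_mul, abs_of_nonneg (by positivity : 0 ≤ n * N)]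
    have h3 : |∑ a, δ a * ε a| ≤ N * (r * (N * r ^ 2)) := by
      calc |∑ a, δ a * ε a| ≤ ∑ a, |δ a * ε a| := Finset.abs_sum_le_sum_abs _ _
        _ ≤ ∑ a : G, r * (N * r ^ 2) := by
          refine Finset.sum_le_sum fun b _ => ?_
          rw [abs_mul]
          exact mul_le_mul (hδr _) (hεb _) (abs_nonneg _) hr0
        _ = _ := by simp [hN]
    calc n * N * |∑ a, δ a * ε a| ≤ n * N * (N * (r * (N * r ^ 2))) := by gcongr
      _ = _ := by ring
  have hS2 : ∑ j, 2 * y (g j) ^ 2 ≤ 2 * N ^ 4 * (n * r ^ 3) := by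
    calc ∑ j, 2 * y (g j) ^ 2 ≤ ∑ j : Fin n, 2 * (N ^ 2 * r ^ 2) ^ 2 := by
          refine Finset.sum_le_sum fun j _ => ?_
          rw [← sq_abs (y (g j))]
          have := hyb (g j)
          gcongr
      _ = 2 * N ^ 4 * (n * (r ^ 3 * r)) := by simp; ring
      _ ≤ 2 * N ^ 4 * (n * (r ^ 3 * 1)) := by gcongr
      _ = _ := by ring
  have hN34 : N ^ 3 * (n * r ^ 3) ≤ N ^ 4 * (n * r ^ 3) := by
    gcongr
    norm_num
  have hK : 0 ≤ N ^ 4 * (n * r ^ 3) := by positivity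
  rw [abs_le] at hS
  refine ⟨?_, ?_, ?_⟩
  · calc Real.exp (-(3 * N ^ 4 * (n * r ^ 3))) ≤ Real.exp (∑ j, (y (g j) - 2 * y (g j) ^ 2)) := by
          rw [Finset.sum_sub_distrib]
          gcongr
          linarith [hS.1]
      _ = ∏ j, Real.exp (y (g j) - 2 * y (g j) ^ 2) := by rw [Real.exp_sum]
      _ ≤ _ := by
          refine Finset.prod_le_prod (fun j _ => (Real.exp_pos _).le) fun j _ => ?_
          rw [hNd]
          exact exp_low _ ((hyb _).trans hr)
  · calc ∏ j, (N * dd (mu g) (g j)) ≤ ∏ j, Real.exp (y (g j)) := by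
          refine Finset.prod_le_prod (fun j _ => ?_) fun j _ => ?_
          · exact mul_nonneg (by positivity) (dd_nonneg _ (mu_nonneg g) _)
          · rw [hNd, add_comm]; exact Real.add_one_le_exp _
      _ = Real.exp (∑ j, y (g j)) := by rw [Real.exp_sum]
      _ ≤ _ := by
          gcongr
          linarith [hS.2]
  · intro a
    have h1 := hNd a
    have h2 := (hyb a).trans hr
    rw [abs_le] at h2
    have : 0 < N * dd (mu g) a := by rw [h1]; linarith [h2.1]
    exact pos_of_mul_pos_right this (by positivity)

lemma near_top_tendsto :
    Tendsto (fun n => ∑ g ∈ Near n (⊤ : AddSubgroup G), WW g) atTop (nhds 1) := by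
  set N : ℝ := (Fintype.card G : ℝ) with hN
  have hN1 : 1 ≤ N := by
    rw [hN]; exact_mod_cast Fintype.card_pos
  -- uniform estimate
  have key : ∀ ε > 0, ∀ᶠ n in atTop, ∀ g ∈ Near n (⊤ : AddSubgroup G), |N ^ n * WW g - 1| ≤ ε := by
    intro ε hε
    -- continuity of (t, d) ↦ exp t * d / 3
    set ε' := min ε 1 / 4 with hε'
    have hε'p : 0 < ε' := by positivity
    have hc := Metric.continuousAt_iff.mp (detC_cont (G := G)) ε' hε'p
    obtain ⟨δ, hδ, hcδ⟩ := hc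
    have e1 : ∀ᶠ n in atTop, rs n < δ := rs_tendsto.eventually (gt_mem_nhds hδ)
    have e2 : ∀ᶠ n in atTop, rs n ≤ 1 := rs_tendsto.eventually (ge_mem_nhds one_pos)
    have e3 : ∀ᶠ n in atTop, N ^ 2 * rs n ^ 2 ≤ 1 / 2 := by
      have : Tendsto (fun n => N ^ 2 * rs n ^ 2) atTop (nhds (N ^ 2 * 0 ^ 2)) := (rs_tendsto.pow 2).const_mul _
      refine this.eventually (ge_mem_nhds (by norm_num))
    have e4 : ∀ᶠ n in atTop, Real.exp (3 * N ^ 4 * (xs n)⁻¹) ≤ 1 + ε' := by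
      have : Tendsto (fun n => Real.exp (3 * N ^ 4 * (xs n)⁻¹)) atTop (nhds (Real.exp (3 * N ^ 4 * 0))) :=
        (Real.continuous_exp.tendsto _).comp (xs_inv_tendsto.const_mul _)
      refine this.eventually (ge_mem_nhds (by simp; exact hε'p))
    have e5 : ∀ᶠ n in atTop, 1 - ε' ≤ Real.exp (-(3 * N ^ 4 * (xs n)⁻¹)) := by
      have : Tendsto (fun n => Real.exp (-(3 * N ^ 4 * (xs n)⁻¹))) atTop (nhds (Real.exp (-(3 * N ^ 4 * 0)))) :=
        (Real.continuous_exp.tendsto _).comp (xs_inv_tendsto.const_mul _).neg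
      refine this.eventually (le_mem_nhds (by simp; exact hε'p))
    filter_upwards [eventually_gt_atTop 0, e1, e2, e3, e4, e5] with n hn h1 h2 h3 h4 h5 g hg
    simp only [Near, mem_filter, mem_univ, true_and] at hg
    obtain ⟨p1, p2, p3⟩ := main_prod hn g (rs n) (rs_pos hn).le h2 h3 hg
    rw [n_rs3 hn] at p1 p2
    rw [WW_eq hn g (fun a => (p3 a).ne')]
    have hdet := hcδ (x := mu g) (by rw [dist_eq_norm]; linarith)
    rw [detC_top, Real.dist_eq] at hdet
    have hP : N ^ n * ((∏ i, dd (mu g) (g i)) * (detC (mu g) / 3)) = (∏ j, (N * dd (mu g) (g j))) * (detC (mu g) / 3) := by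
      rw [Finset.prod_mul_distrib, Finset.prod_const, Finset.card_univ, Fintype.card_fin]; ring
    rw [hP]
    set P := ∏ j, (N * dd (mu g) (g j))
    set d := detC (mu g)
    have q1 : 1 - ε' ≤ P := h5.trans p1
    have q2 : P ≤ 1 + ε' := p2.trans h4
    have hm1 : 4 * ε' ≤ ε := by rw [hε']; linarith [min_le_left ε 1]
    have hm2 : 4 * ε' ≤ 1 := by rw [hε']; linarith [min_le_right ε 1]
    rw [abs_lt] at hdet
    have hPd : |P - 1| ≤ ε' := by rw [abs_le]; constructor <;> linarith
    have hdd : |d / 3 - 1| ≤ ε' := by rw [abs_le]; constructor <;> linarith [hdet.1, hdet.2]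
    have : P * (d / 3) - 1 = (P - 1) * (d / 3 - 1) + (P - 1) + (d / 3 - 1) := by ring
    rw [this]
    calc |(P - 1) * (d / 3 - 1) + (P - 1) + (d / 3 - 1)| ≤ |(P - 1) * (d / 3 - 1)| + |P - 1| + |d / 3 - 1| := abs_add_three _ _ _
      _ ≤ ε' * ε' + ε' + ε' := by
          rw [abs_mul]; gcongr
      _ ≤ ε := by nlinarith
  have hcard := near_top_card (G := G)
  rw [← hN] at hcard
  have hdiff : Tendsto (fun n => (∑ g ∈ Near n (⊤ : AddSubgroup G), WW g) - ((Near n (⊤ : AddSubgroup G)).card : ℝ) / N ^ n)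
      atTop (nhds 0) := by
    rw [Metric.tendsto_atTop']
    intro ε hε
    obtain ⟨n0, hn0⟩ := eventually_atTop.mp (key (ε / 2) (by positivity))
    refine ⟨n0, fun n hn => ?_⟩
    have hk := hn0 n hn.le
    have hNn : 0 < N ^ n := by positivity
    rw [dist_zero_right, Real.norm_eq_abs]
    have : (∑ g ∈ Near n (⊤ : AddSubgroup G), WW g) - ((Near n (⊤ : AddSubgroup G)).card : ℝ) / N ^ n =
        (∑ g ∈ Near n (⊤ : AddSubgroup G), (N ^ n * WW g - 1)) / N ^ n := by
      rw [Finset.sum_sub_distrib, ← Finset.mul_sum]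
      simp
      field_simp
    rw [this, abs_div, abs_of_pos hNn, div_lt_iff₀ hNn]
    have hle : ((Near n (⊤ : AddSubgroup G)).card : ℝ) ≤ N ^ n := by
      have := Finset.card_le_univ (Near n (⊤ : AddSubgroup G))
      rw [Fintype.card_fun, Fintype.card_fin] at this
      rw [hN]; exact_mod_cast this
    calc |∑ g ∈ Near n (⊤ : AddSubgroup G), (N ^ n * WW g - 1)| ≤ ∑ g ∈ Near n (⊤ : AddSubgroup G), |N ^ n * WW g - 1| := Finset.abs_sum_le_sum_abs _ _
      _ ≤ ∑ g ∈ Near n (⊤ : AddSubgroup G), ε / 2 := Finset.sum_le_sum hk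
      _ = ((Near n (⊤ : AddSubgroup G)).card : ℝ) * (ε / 2) := by simp
      _ ≤ N ^ n * (ε / 2) := by gcongr
      _ < ε * N ^ n := by nlinarith
  have := hdiff.add hcard
  simpa using this

/-- near-uniform `g` are generating -/
lemma near_top_gen : ∀ᶠ n in atTop, ∀ g ∈ Near n (⊤ : AddSubgroup G), Gen g := by
  set N : ℝ := (Fintype.card G : ℝ) with hN
  have hN1 : 1 ≤ N := by
    rw [hN]; exact_mod_cast Fintype.card_pos
  have e1 : ∀ᶠ n in atTop, rs n < N⁻¹ := rs_tendsto.eventually (gt_mem_nhds (by positivity))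
  filter_upwards [e1] with n h1 g hg
  simp only [Near, mem_filter, mem_univ, true_and] at hg
  intro a
  have h2 : |mu g a - uH (⊤ : AddSubgroup G) a| ≤ rs n := (norm_le_pi_norm (mu g - uH ⊤) a).trans hg
  have h3 : uH (⊤ : AddSubgroup G) a = N⁻¹ := by simp [uH, hN]
  rw [h3, abs_le] at h2
  have h4 : mu g a ≠ 0 := by linarith [h2.1]
  have h5 : ∃ i, g i = a := by
    by_contra hcon
    push Not at hcon
    apply h4
    simp [mu, cnt, hcon]
  obtain ⟨i, hi⟩ := h5
  refine ⟨Pi.single i 1, ?_⟩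
  simp [Pi.single_apply, hi]

end CLAux

namespace CLAux
open CLPaper Finset Filter

variable {G : Type} [AddCommGroup G] [Fintype G]

def kk (H : AddSubgroup G) {n : ℕ} (g : Fin n → G) : ℕ := (univ.filter fun j => g j ∉ H).card
def mm (H : AddSubgroup G) {n : ℕ} (g : Fin n → G) (a : G) : ℕ :=
  (univ.filter fun j => g j ∉ H ∧ g j - a ∈ H).card

lemma half_mem (hodd : Odd (Nat.card G)) (H : AddSubgroup G) (a : G) (ha : a + a ∈ H) : a ∈ H := by
  obtain ⟨m, hm⟩ := hodd
  have h0 : Nat.card G • a = 0 := card_nsmul_eq_zero'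
  rw [hm, add_smul, mul_comm, mul_smul, two_smul, one_smul] at h0
  have : a = -(m • (a + a)) := by rw [eq_neg_iff_add_eq_zero, add_comm]; exact h0
  rw [this]
  exact H.neg_mem (H.nsmul_mem ha m)

lemma exists_sigma (hodd : Odd (Nat.card G)) (H : AddSubgroup G) :
    ∃ σ : G → ℝ, (∀ a ∈ H, σ a = 0) ∧ (∀ a, a ∉ H → σ a ^ 2 = 1) ∧
      ∀ a b, a + b ∈ H → σ a + σ b = 0 := by
  let e := Fintype.equivFin (G ⧸ H)
  let s : G ⧸ H → ℝ := fun q => if e (-q) < e q then 1 else if e q < e (-q) then -1 else 0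
  have hs : ∀ q, s q + s (-q) = 0 := by
    intro q
    simp only [s, neg_neg]
    rcases lt_trichotomy (e (-q)) (e q) with h | h | h
    · simp [h, h.not_gt]
    · simp [h]
    · simp [h, h.not_gt]
  have hab : ∀ a b : G, a + b ∈ H → (b : G ⧸ H) = -(a : G ⧸ H) := by
    intro a b h
    rw [eq_neg_iff_add_eq_zero, ← QuotientAddGroup.mk_add, QuotientAddGroup.eq_zero_iff, add_comm]
    exact h
  refine ⟨fun a => s a, ?_, ?_, ?_⟩
  · intro a ha
    have : (a : G ⧸ H) = 0 := (QuotientAddGroup.eq_zero_iff a).2 ha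
    simp [s, this]
  · intro a ha
    have hne : e (-(a : G ⧸ H)) ≠ e (a : G ⧸ H) := by
      intro h
      apply ha
      apply half_mem hodd H
      have := e.injective h
      rw [neg_eq_iff_add_eq_zero, ← QuotientAddGroup.mk_add, QuotientAddGroup.eq_zero_iff] at this
      exact this
    simp only [s]
    rcases lt_or_gt_of_ne hne with h | h
    · simp [h]
    · simp [h, h.not_gt]
  · intro a b h
    simp only [hab a b h]
    exact hs _

lemma quad_le (hodd : Odd (Nat.card G)) (H : AddSubgroup G) (σ : G → ℝ) (h1 : ∀ a ∈ H, σ a = 0)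
    (h2 : ∀ a, a ∉ H → σ a ^ 2 = 1) (h3 : ∀ a b, a + b ∈ H → σ a + σ b = 0) {n : ℕ} (g : Fin n → G) :
    (fun j => σ (g j)) ⬝ᵥ (Mg g).mulVec (fun j => σ (g j)) ≤ 9 * (kk H g : ℝ) ^ 3 := by
  rw [Mg_quad]
  set S := univ.filter fun j => g j ∉ H with hS
  have key : ∀ x ∈ Ig g, (σ (g x.1) + σ (g x.2.1) + σ (g x.2.2)) ^ 2 ≤
      if x ∈ S ×ˢ S ×ˢ S then 9 else 0 := by
    rintro ⟨x, y, z⟩ hx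
    simp only [Ig, mem_filter, mem_univ, true_and] at hx
    simp only [mem_product, hS, mem_filter, mem_univ, true_and]
    split_ifs with hc
    · have a1 := h2 _ hc.1
      have a2 := h2 _ hc.2.1
      have a3 := h2 _ hc.2.2
      nlinarith [sq_nonneg (σ (g x) - σ (g y)), sq_nonneg (σ (g x) - σ (g z)), sq_nonneg (σ (g y) - σ (g z))]
    · apply le_of_eq
      by_cases hx' : g x ∈ H
      · have := h3 (g y) (g z) (by
          have : g y + g z = -(g x) := by rw [eq_neg_iff_add_eq_zero, ← hx]; abel
          rw [this]; exact H.neg_mem hx')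
        rw [h1 _ hx', zero_add, this]; norm_num
      · by_cases hy' : g y ∈ H
        · have := h3 (g x) (g z) (by
            have : g x + g z = -(g y) := by rw [eq_neg_iff_add_eq_zero, ← hx]; abel
            rw [this]; exact H.neg_mem hy')
          rw [h1 _ hy', add_zero, this]; norm_num
        · have hz' : g z ∈ H := by
            by_contra hz; exact hc ⟨hx', hy', hz⟩
          have := h3 (g x) (g y) (by
            have : g x + g y = -(g z) := by rw [eq_neg_iff_add_eq_zero, ← hx]
            rw [this]; exact H.neg_mem hz')
          rw [h1 _ hz', this]; norm_num
  refine (Finset.sum_le_sum key).trans ?_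
  refine (Finset.sum_le_sum_of_subset_of_nonneg (Finset.subset_univ _) ?_).trans ?_
  · intro i _ _; split_ifs <;> norm_num
  · rw [← Finset.sum_filter, Finset.sum_const, Finset.filter_mem_eq_inter, Finset.univ_inter,
      Finset.card_product, Finset.card_product, nsmul_eq_mul]
    simp only [kk, ← hS]
    push_cast
    apply le_of_eq; ring

lemma sum_ind {n : ℕ} (hn : 0 < n) (g : Fin n → G) (P : G → Prop) [DecidablePred P] :
    ∑ a, (if P a then mu g a else 0) = ((univ.filter fun j => P (g j)).card : ℝ) / n := by
  have := sum_comp_cnt g (fun a => if P a then (1:ℝ) else 0)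
  rw [Finset.sum_boole] at this
  rw [this, Finset.sum_div]
  refine Finset.sum_congr rfl fun a _ => ?_
  simp only [mu]
  split_ifs <;> simp

lemma tau_eq (H : AddSubgroup G) {n : ℕ} (hn : 0 < n) (g : Fin n → G) :
    ∑ a, (if a ∉ H then mu g a else 0) = (kk H g : ℝ) / n := by
  rw [sum_ind hn g (fun a => a ∉ H), kk]

lemma mass_eq (H : AddSubgroup G) {n : ℕ} (hn : 0 < n) (g : Fin n → G) (a : G) (ha : a ∉ H) :
    ∑ b, (if -a - b ∈ H then mu g b else 0) = (mm H g (-a) : ℝ) / n := by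
  rw [sum_ind hn g (fun b => -a - b ∈ H), mm]
  congr 3
  ext j
  simp only [mem_filter, mem_univ, true_and]
  have h1 : -a - g j ∈ H ↔ g j - -a ∈ H := by
    rw [← H.neg_mem_iff]; congr! 1; abel
  constructor
  · intro h
    refine ⟨fun h' => ha ?_, h1.1 h⟩
    have := H.add_mem h h'
    simpa using this
  · intro h; exact h1.2 h.2

lemma near_bd {H : AddSubgroup G} {n : ℕ} {g : Fin n → G} (hg : g ∈ Near n H) (b : G) :
    |mu g b - uH H b| ≤ rs n := by
  have := (mem_filter.1 hg).2
  exact (norm_le_pi_norm (mu g - uH H) b).trans this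

lemma nv_off (hodd : Odd (Nat.card G)) (H : AddSubgroup G) {n : ℕ} (hn : 0 < n) (g : Fin n → G) (hg : g ∈ Near n H)
    (a : G) (ha : a ∉ H) (hk : 1 ≤ kk H g) (η : ℝ) (hη : 3 / 2 * Nat.card H * rs n ≤ η) :
    nv n (mu g) a ≤ 2 * (1 + Nat.card H * rs n) * ((Nat.card H : ℝ)⁻¹ * ((mm H g (-a) + η * kk H g) / n)) := by
  set h : ℝ := (Nat.card H : ℝ) with hh
  have hpos : 0 < h := by rw [hh]; exact_mod_cast Nat.card_pos
  set r := rs n with hr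
  have hr0 : 0 < r := rs_pos hn
  have hin : ∀ b ∈ H, mu g b ≤ h⁻¹ + r := fun b hb => by
    have := near_bd hg b
    rw [uH, if_pos hb, abs_le] at this
    linarith [this.2]
  have hout : ∀ b, b ∉ H → mu g b ≤ r := fun b hb => by
    have := near_bd hg b
    rw [uH, if_neg hb, abs_le] at this
    linarith [this.2]
  have hm0 := mu_nonneg g
  have hn' : (0:ℝ) < n := by exact_mod_cast hn
  have pt : ∀ b, mu g b * mu g (-a - b) ≤ (h⁻¹ + r) * (if -a - (-a - b) ∈ H then mu g (-a - b) else 0) +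
      (h⁻¹ + r) * (if -a - b ∈ H then mu g b else 0) + r * (if b ∉ H then mu g b else 0) := by
    intro b
    have e : -a - (-a - b) = b := by abel
    rw [e]
    have := hm0 b
    have := hm0 (-a - b)
    have hi : 0 < h⁻¹ := by positivity
    by_cases hb : b ∈ H
    · rw [if_pos hb, if_neg (not_not.2 hb)]
      have h1 := hin b hb
      have : 0 ≤ (if -a - b ∈ H then mu g b else 0) := by split_ifs <;> simp [hm0]
      nlinarith
    · rw [if_neg hb, if_pos hb]
      by_cases hb' : -a - b ∈ H
      · rw [if_pos hb']
        have h1 := hin _ hb'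
        nlinarith
      · rw [if_neg hb']
        have h1 := hout _ hb'
        nlinarith
  have hdd : dd (mu g) a ≤ (h⁻¹ + r) * (mm H g (-a) / n) + (h⁻¹ + r) * (mm H g (-a) / n) + r * (kk H g / n) := by
    unfold dd
    refine (Finset.sum_le_sum fun b _ => pt b).trans ?_
    rw [Finset.sum_add_distrib, Finset.sum_add_distrib, ← Finset.mul_sum, ← Finset.mul_sum, ← Finset.mul_sum,
      tau_eq H hn, mass_eq H hn g a ha, sum_refl (fun c => if -a - c ∈ H then mu g c else 0) a, mass_eq H hn g a ha]
  have h2 : mu g (-a - a) ≤ r := hout _ (fun h' => ha (half_mem hodd H a (by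
    have := H.neg_mem h'; have e : -(-a - a) = a + a := by abel
    rwa [e] at this)))
  have hk' : (1:ℝ) ≤ kk H g := by exact_mod_cast hk
  have h3 : 2 * mu g (-a - a) / n ≤ 2 * r * (kk H g / n) := by
    rw [← mul_div_assoc]
    refine div_le_div_of_nonneg_right ?_ hn'.le
    nlinarith
  have h4 : 3 * r ≤ 2 * h⁻¹ * η := by
    have : 3 * r = 2 * h⁻¹ * (3 / 2 * h * r) := by field_simp
    rw [this]; gcongr
  have hη0 : 0 ≤ η := le_trans (by positivity) hη
  have h5 : 3 * r * (kk H g / n) ≤ 2 * h⁻¹ * η * (kk H g / n) := by gcongr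
  have h6 : 0 ≤ 2 * r * η * (kk H g / n) := by positivity
  have e1 : 2 * (1 + h * r) * (h⁻¹ * ((mm H g (-a) + η * kk H g) / n)) =
      2 * (h⁻¹ + r) * (mm H g (-a) / n) + 2 * h⁻¹ * η * (kk H g / n) + 2 * r * η * (kk H g / n) := by
    field_simp; ring
  rw [e1, nv]
  linarith

end CLAux

namespace CLAux
open CLPaper Finset Filter

variable {G : Type} [AddCommGroup G] [Fintype G]

/-- deviation restricted to H -/
def dv (H : AddSubgroup G) {n : ℕ} (g : Fin n → G) (a : G) : ℝ := if a ∈ H then mu g a - uH H a else 0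

lemma dv_abs {H : AddSubgroup G} {n : ℕ} (hn : 0 < n) {g : Fin n → G} (hg : g ∈ Near n H) (b : G) : |dv H g b| ≤ rs n := by
  unfold dv
  split_ifs
  · exact near_bd hg b
  · simpa using (rs_pos hn).le

lemma mu_H_sum (H : AddSubgroup G) {n : ℕ} (hn : 0 < n) (g : Fin n → G) :
    (∑ b ∈ univ.filter (· ∈ H), mu g b) - 1 = - ((kk H g : ℝ) / n) := by
  rw [← tau_eq H hn, ← mu_sum hn g, Finset.sum_filter, ← Finset.sum_sub_distrib, ← Finset.sum_neg_distrib]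
  refine Finset.sum_congr rfl fun a _ => ?_
  by_cases h : a ∈ H <;> simp [h]

lemma dv_sum (H : AddSubgroup G) {n : ℕ} (hn : 0 < n) (g : Fin n → G) :
    ∑ a, dv H g a = - ((kk H g : ℝ) / n) := by
  rw [← mu_H_sum H hn, ← uH_sum H, Finset.sum_filter, ← Finset.sum_sub_distrib]
  refine Finset.sum_congr rfl fun a _ => ?_
  unfold dv
  by_cases h : a ∈ H <;> simp [h, uH]

lemma tau_le {H : AddSubgroup G} {n : ℕ} (hn : 0 < n) {g : Fin n → G} (hg : g ∈ Near n H) :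
    (kk H g : ℝ) / n ≤ Fintype.card G * rs n := by
  rw [← tau_eq H hn, ← nsmul_eq_mul, ← Finset.card_univ, ← Finset.sum_const]
  refine Finset.sum_le_sum fun b _ => ?_
  by_cases hb : b ∈ H
  · rw [if_neg (not_not.2 hb)]; exact (rs_pos hn).le
  · rw [if_pos hb]
    have := near_bd hg b
    rw [uH, if_neg hb, abs_le] at this
    linarith [this.2]

lemma nv_in (H : AddSubgroup G) {n : ℕ} (hn : 0 < n) (g : Fin n → G) (hg : g ∈ Near n H)
    (a : G) (ha : a ∈ H) :
    nv n (mu g) a ≤ (Nat.card H : ℝ)⁻¹ * Real.exp (-2 * ((kk H g : ℝ) / n) + Nat.card H * dd (dv H g) a +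
      Nat.card H * rs n * ((kk H g : ℝ) / n) + 2 * Nat.card H / n) := by
  set h : ℝ := (Nat.card H : ℝ) with hh
  have hpos : 0 < h := by rw [hh]; exact_mod_cast Nat.card_pos
  set τ := (kk H g : ℝ) / n with hτ
  have hn' : (0:ℝ) < n := by exact_mod_cast hn
  have hs := nu_H_split (mu g) H a ha
  rw [mu_H_sum H hn, ← hτ, ← hh] at hs
  have hE : ∑ b, (mu g b - uH H b) * (mu g (-a - b) - uH H (-a - b)) ≤ dd (dv H g) a + rs n * τ := by
    rw [hτ, ← tau_eq H hn, dd, Finset.mul_sum, ← Finset.sum_add_distrib]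
    refine Finset.sum_le_sum fun b _ => ?_
    have hiff : -a - b ∈ H ↔ b ∈ H := by
      rw [sub_eq_add_neg, H.add_mem_cancel_left (H.neg_mem ha), H.neg_mem_iff]
    unfold dv
    by_cases hb : b ∈ H
    · simp [hb, hiff.2 hb]
    · have hb' : -a - b ∉ H := fun h => hb (hiff.1 h)
      have h1 := near_bd hg (-a - b)
      simp only [hb, hb', uH, if_false, sub_zero] at h1 ⊢
      rw [if_pos not_false, zero_mul, zero_add, mul_comm]
      exact mul_le_mul_of_nonneg_right ((le_abs_self _).trans h1) (mu_nonneg g b)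
  have h1 : nv n (mu g) a ≤ h⁻¹ * (1 + (-2 * τ + h * dd (dv H g) a + h * rs n * τ + 2 * h / n)) := by
    have h2 : 2 * mu g (-a - a) / n ≤ 2 * 1 / n := by
      have := mu_le_one hn g (-a - a)
      gcongr
    have : h⁻¹ * (1 + (-2 * τ + h * dd (dv H g) a + h * rs n * τ + 2 * h / n)) =
       h⁻¹ + 2 * h⁻¹ * (-τ) + (dd (dv H g) a + rs n * τ) + 2 * 1 / n := by
      field_simp; ring
    rw [this, nv, hs]
    linarith
  refine h1.trans ?_
  gcongr
  rw [add_comm]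
  exact Real.add_one_le_exp _

lemma prod_in (H : AddSubgroup G) {n : ℕ} (hn : 0 < n) (hx : 1 ≤ xs n) (g : Fin n → G) (hg : g ∈ Near n H) :
    ∏ j ∈ univ.filter (fun j => g j ∈ H), nv n (mu g) (g j) ≤
      (∏ j ∈ univ.filter (fun j => g j ∈ H), (Nat.card H : ℝ)⁻¹) *
      (Real.exp ((Fintype.card G : ℝ) ^ 3 + 2 * Fintype.card G) * Real.exp (4 * Fintype.card G * rs n - 2) ^ (kk H g)) := by
  set h : ℝ := (Nat.card H : ℝ) with hh
  have hpos : 0 < h := by rw [hh]; exact_mod_cast Nat.card_pos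
  set N : ℝ := (Fintype.card G : ℝ) with hN
  have hhN : h ≤ N := by
    rw [hh, hN, ← Nat.card_eq_fintype_card]
    exact_mod_cast AddSubgroup.card_le_card_addGroup H
  set τ := (kk H g : ℝ) / n with hτ
  have hn' : (0:ℝ) < n := by exact_mod_cast hn
  have hr0 := rs_pos hn
  have hkn : (kk H g : ℝ) = n * τ := by rw [hτ]; field_simp
  have hτN : τ ≤ N * rs n := tau_le hn hg
  have hτ0 : 0 ≤ τ := by positivity
  refine (Finset.prod_le_prod (fun j _ => nv_nonneg n _ (mu_nonneg g) _)
    (fun j hj => nv_in H hn g hg (g j) (mem_filter.1 hj).2)).trans ?_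
  rw [Finset.prod_mul_distrib, ← Real.exp_sum, ← Real.exp_nat_mul, ← Real.exp_add]
  refine mul_le_mul_of_nonneg_left (Real.exp_le_exp.2 ?_) (by positivity)
  have hcard : ((univ.filter (fun j => g j ∈ H)).card : ℝ) = n - kk H g := by
    have := Finset.card_filter_add_card_filter_not (s := (univ : Finset (Fin n))) (fun j => g j ∈ H)
    rw [Finset.card_univ, Fintype.card_fin] at this
    have h2 : ((univ.filter (fun j => g j ∈ H)).card : ℝ) + (univ.filter (fun j => g j ∉ H)).card = n := by
      exact_mod_cast this
    rw [kk]; linarith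
  have hEsum : ∑ j ∈ univ.filter (fun j => g j ∈ H), dd (dv H g) (g j) ≤ n * (h⁻¹ * τ ^ 2 + N ^ 2 * rs n ^ 3) := by
    have hoff : ∀ a, a ∉ H → dd (dv H g) a = 0 := by
      intro a ha
      refine Finset.sum_eq_zero fun b _ => ?_
      unfold dv
      by_cases hb : b ∈ H
      · have : -a - b ∉ H := fun h' => ha (by
          have := H.neg_mem (H.add_mem h' hb); simpa using this)
        simp [this]
      · simp [hb]
    rw [Finset.sum_filter, sum_comp_cnt g (fun a => if a ∈ H then dd (dv H g) a else 0)]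
    have : ∀ a, cnt g a * (if a ∈ H then dd (dv H g) a else 0) ≤
        n * (h⁻¹ * dd (dv H g) a + N * rs n ^ 3) := by
      intro a
      rw [cnt_eq_mu hn, mul_assoc]
      refine mul_le_mul_of_nonneg_left ?_ hn'.le
      have hle : |dv H g a * dd (dv H g) a| ≤ N * rs n ^ 3 := by
        rw [abs_mul]
        have h1 : |dd (dv H g) a| ≤ N * rs n ^ 2 := by
          rw [hN, ← Finset.card_univ, ← nsmul_eq_mul, ← Finset.sum_const]
          refine (Finset.abs_sum_le_sum_abs _ _).trans (Finset.sum_le_sum fun b _ => ?_)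
          rw [abs_mul, sq]
          exact mul_le_mul (dv_abs hn hg _) (dv_abs hn hg _) (abs_nonneg _) hr0.le
        calc _ ≤ rs n * (N * rs n ^ 2) := mul_le_mul (dv_abs hn hg _) h1 (abs_nonneg _) hr0.le
          _ = _ := by ring
      by_cases ha : a ∈ H
      · rw [if_pos ha]
        have e : mu g a = h⁻¹ + dv H g a := by rw [dv, if_pos ha, uH, if_pos ha]; ring
        rw [e, add_mul]
        linarith [le_abs_self (dv H g a * dd (dv H g) a)]
      · rw [if_neg ha, hoff a ha]
        have : 0 ≤ N * rs n ^ 3 := by positivity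
        simpa using this
    refine (Finset.sum_le_sum fun a _ => this a).trans ?_
    rw [← Finset.mul_sum, Finset.sum_add_distrib, ← Finset.mul_sum, dd_sum, dv_sum H hn, ← hτ, Finset.sum_const,
      Finset.card_univ, nsmul_eq_mul, ← hN]
    apply le_of_eq; ring
  simp only [← hτ, ← hh]
  rw [Finset.sum_add_distrib, Finset.sum_add_distrib, Finset.sum_add_distrib]
  simp only [Finset.sum_const, nsmul_eq_mul]
  rw [← Finset.mul_sum, hcard, hkn]
  have hn3 : n * rs n ^ 3 ≤ 1 := by rw [n_rs3 hn]; exact inv_le_one_of_one_le₀ hx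
  have hτ1 : τ ≤ 1 := by
    rw [hτ, div_le_one hn']
    have := Finset.card_le_univ (univ.filter fun j => g j ∉ H)
    rw [Fintype.card_fin] at this
    exact_mod_cast this
  have a1 : h * ∑ j ∈ univ.filter (fun j => g j ∈ H), dd (dv H g) (g j) ≤ n * τ * (N * rs n) + N ^ 3 := by
    calc _ ≤ h * (n * (h⁻¹ * τ ^ 2 + N ^ 2 * rs n ^ 3)) := by gcongr
      _ = n * τ * τ + h * N ^ 2 * (n * rs n ^ 3) := by field_simp
      _ ≤ n * τ * (N * rs n) + N * N ^ 2 * 1 := by gcongr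
      _ = _ := by ring
  have a2 : (n - n * τ) * (-2 * τ) ≤ -2 * (n * τ) + 2 * (n * τ * (N * rs n)) := by
    have : n * τ * τ ≤ n * τ * (N * rs n) := by gcongr
    nlinarith
  have a3 : (n - n * τ) * (h * rs n * τ) ≤ n * τ * (N * rs n) := by
    calc _ ≤ n * (h * rs n * τ) := by
          refine mul_le_mul_of_nonneg_right ?_ (by positivity)
          have : 0 ≤ n * τ := by positivity
          linarith
      _ ≤ n * (N * rs n * τ) := by gcongr
      _ = _ := by ring
  have a4 : (n - n * τ) * (2 * h / n) ≤ 2 * N := by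
    calc _ ≤ n * (2 * h / n) := by
          refine mul_le_mul_of_nonneg_right ?_ (by positivity)
          have : 0 ≤ n * τ := by positivity
          linarith
      _ = 2 * h := by field_simp
      _ ≤ _ := by linarith
  have e : N ^ 3 + 2 * N + n * τ * (4 * N * rs n - 2) = (-2 * (n * τ) + 2 * (n * τ * (N * rs n))) +
    (n * τ * (N * rs n) + N ^ 3) + n * τ * (N * rs n) + 2 * N := by ring
  rw [e]
  linarith

end CLAux

namespace CLAux
open CLPaper Finset Filter

variable {G : Type} [AddCommGroup G] [Fintype G]

def FT (H : AddSubgroup G) (n : ℕ) (η : ℝ) (k : ℕ) (T : G → ℕ) (a : G) : ℝ :=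
  if a ∈ H then (Nat.card H : ℝ)⁻¹ else (Nat.card H : ℝ)⁻¹ * ((T (-a) + η * k) / n)

lemma FT_nonneg (H : AddSubgroup G) (n : ℕ) (η : ℝ) (hη : 0 ≤ η) (k : ℕ) (T : G → ℕ) (a : G) : 0 ≤ FT H n η k T a := by
  unfold FT
  split_ifs <;> positivity

lemma WW_bound (hodd : Odd (Nat.card G)) (H : AddSubgroup G) {n : ℕ} (hn : 0 < n) (hx : 1 ≤ xs n) (g : Fin n → G)
    (hg : g ∈ Near n H) (hk : 1 ≤ kk H g) (η : ℝ) (hη0 : 0 < η) (hη : 3 / 2 * Nat.card H * rs n ≤ η) :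
    WW g ≤ ((kk H g : ℝ) ^ 2 / n) * (Nat.card H / (2 * η)) * Real.exp ((Fintype.card G : ℝ) ^ 3 + 2 * Fintype.card G) *
      (2 * (1 + Nat.card H * rs n) * Real.exp (4 * Fintype.card G * rs n - 2)) ^ (kk H g) *
      ∏ j, FT H n η (kk H g) (mm H g) (g j) := by
  have hpi := prod_in H hn hx g hg
  have hoff := fun a ha => nv_off hodd H hn g hg a ha hk η hη
  set h : ℝ := (Nat.card H : ℝ) with hh
  have hpos : 0 < h := by rw [hh]; exact_mod_cast Nat.card_pos
  set N : ℝ := (Fintype.card G : ℝ) with hN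
  have hn' : (0:ℝ) < n := by exact_mod_cast hn
  have hr0 := rs_pos hn
  set r := rs n with hr
  set k := kk H g with hkd
  have hk0 : (1:ℝ) ≤ k := by exact_mod_cast hk
  obtain ⟨i0, hi0⟩ : ∃ i0, g i0 ∉ H := by
    have : 0 < (univ.filter fun j => g j ∉ H).card := hk
    obtain ⟨i, hi⟩ := Finset.card_pos.1 this
    exact ⟨i, (mem_filter.1 hi).2⟩
  obtain ⟨σ, s1, s2, s3⟩ := exists_sigma hodd H
  set U : G → ℝ := fun a => 2 * (1 + h * r) * (h⁻¹ * ((mm H g (-a) + η * k) / n)) with hU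
  set f : Fin n → ℝ := fun j => if g j ∈ H then nv n (mu g) (g j) else U (g j) with hf
  have hnvf : ∀ j, nv n (mu g) (g j) ≤ f j := by
    intro j
    simp only [hf]
    split_ifs with hj
    · exact le_rfl
    · exact hoff _ hj
  have hnv0 : ∀ a, 0 ≤ nv n (mu g) a := nv_nonneg n _ (mu_nonneg g)
  have hf0 : ∀ j, 0 ≤ f j := fun j => (hnv0 _).trans (hnvf j)
  have hdet := hadamard_v (Mg g) (Mg_psd g) (fun j => σ (g j)) i0 (s2 _ hi0)
  have hq := quad_le hodd H σ s1 s2 s3 g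
  rw [← hkd] at hq
  have hprod : ∏ i ∈ univ.erase i0, Mg g i i ≤ (3 * (n:ℝ) ^ 2) ^ (n - 1) * ∏ i ∈ univ.erase i0, f i := by
    simp_rw [Mg_diag hn]
    rw [Finset.prod_mul_distrib, Finset.prod_const, Finset.card_erase_of_mem (mem_univ _), Finset.card_univ, Fintype.card_fin]
    gcongr with j hj
    · intro j _; exact hnv0 _
    · exact hnvf j
  have hPe : 0 ≤ ∏ i ∈ univ.erase i0, f i := Finset.prod_nonneg fun j _ => hf0 j
  have hWW1 : WW g ≤ ((k:ℝ) ^ 3 / n ^ 2) * ∏ i ∈ univ.erase i0, f i := by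
    rw [WW, div_le_iff₀ (cN_pos hn)]
    have hcN : cN n = 9 * (n:ℝ) ^ 2 * (3 * (n:ℝ) ^ 2) ^ (n - 1) := by
      obtain ⟨m, rfl⟩ : ∃ m, n = m + 1 := ⟨n - 1, by omega⟩
      rw [cN, Nat.add_sub_cancel, mul_pow, ← pow_mul, pow_add, pow_add, mul_add, pow_add]
      ring
    have hd0 : 0 ≤ ∏ i ∈ univ.erase i0, Mg g i i := Finset.prod_nonneg fun i _ => by
      rw [Mg_diag hn]; have := hnv0 (g i); positivity
    calc (Mg g).det ≤ (9 * (k:ℝ) ^ 3) * ((3 * (n:ℝ) ^ 2) ^ (n - 1) * ∏ i ∈ univ.erase i0, f i) :=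
          hdet.trans (mul_le_mul hq hprod hd0 (by positivity))
      _ = _ := by rw [hcN]; field_simp
  have hfi0 : (k:ℝ) ^ 3 / n ^ 2 ≤ ((k : ℝ) ^ 2 / n) * (h / (2 * η)) * f i0 := by
    simp only [hf, if_neg hi0, hU]
    have : 2 * 1 * (h⁻¹ * ((0 + η * k) / n)) ≤ 2 * (1 + h * r) * (h⁻¹ * ((mm H g (-g i0) + η * k) / n)) := by
      have : (0:ℝ) ≤ mm H g (-g i0) := by positivity
      have h2 : 0 < h * r := by positivity
      gcongr
      linarith
    calc (k:ℝ) ^ 3 / n ^ 2 = ((k : ℝ) ^ 2 / n) * (h / (2 * η)) * (2 * 1 * (h⁻¹ * ((0 + η * k) / n))) := by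
          field_simp; ring
      _ ≤ _ := by gcongr
  have hsplit : f i0 * ∏ i ∈ univ.erase i0, f i = ∏ i, f i := Finset.mul_prod_erase univ f (mem_univ i0)
  have hprodf : ∏ i, f i ≤ Real.exp (N ^ 3 + 2 * N) * (2 * (1 + h * r) * Real.exp (4 * N * r - 2)) ^ k *
      ∏ j, FT H n η k (mm H g) (g j) := by
    simp only [hf, FT]
    rw [Finset.prod_ite, Finset.prod_ite]
    simp only [hU]
    rw [Finset.prod_mul_distrib (f := fun _ => 2 * (1 + h * r)), Finset.prod_const (2 * (1 + h * r))]
    have hkk : (univ.filter fun j => g j ∉ H).card = k := rfl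
    rw [hkk, mul_pow (2 * (1 + h * r)) (Real.exp (4 * N * r - 2)) k]
    have hP : 0 ≤ ∏ j ∈ univ.filter (fun j => g j ∉ H), (h⁻¹ * (((mm H g (-g j) : ℝ) + η * k) / n)) :=
      Finset.prod_nonneg fun j _ => by positivity
    have hD : 0 ≤ (2 * (1 + h * r)) ^ k := by positivity
    refine (mul_le_mul_of_nonneg_right hpi (mul_nonneg hD hP)).trans (le_of_eq ?_)
    ring
  calc WW g ≤ (((k : ℝ) ^ 2 / n) * (h / (2 * η)) * f i0) * ∏ i ∈ univ.erase i0, f i :=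
        hWW1.trans (mul_le_mul_of_nonneg_right hfi0 hPe)
    _ = ((k : ℝ) ^ 2 / n) * (h / (2 * η)) * ∏ i, f i := by rw [mul_assoc, hsplit]
    _ ≤ ((k : ℝ) ^ 2 / n) * (h / (2 * η)) * (Real.exp (N ^ 3 + 2 * N) * (2 * (1 + h * r) * Real.exp (4 * N * r - 2)) ^ k *
      ∏ j, FT H n η k (mm H g) (g j)) := by gcongr
    _ = _ := by ring

lemma mm_sum (H : AddSubgroup G) {n : ℕ} (g : Fin n → G) :
    ∑ a, mm H g a = Nat.card H * kk H g := by
  simp only [mm, Finset.card_filter]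
  rw [Finset.sum_comm, kk, Finset.card_filter, Finset.mul_sum]
  refine Finset.sum_congr rfl fun j _ => ?_
  by_cases hj : g j ∈ H
  · simp [hj]
  · simp only [hj, not_false_eq_true, true_and, if_true, mul_one]
    rw [← Finset.card_filter, Nat.card_eq_fintype_card, Fintype.card_subtype]
    refine Finset.card_bij (fun a _ => g j - a) ?_ ?_ ?_
    · intro a ha; simpa using ha
    · intro a _ b _ h; simpa using h
    · intro b hb; exact ⟨g j - b, by simpa using hb, by simp⟩

lemma FT_sum (H : AddSubgroup G) {n : ℕ} (hn : 0 < n) (η : ℝ) (hη : 0 ≤ η) (g : Fin n → G) :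
    ∑ a, FT H n η (kk H g) (mm H g) a ≤ Real.exp ((kk H g : ℝ) * (1 + Fintype.card G * η) / n) := by
  have hpos := cardH_pos H
  have hn' : (0:ℝ) < n := by exact_mod_cast hn
  have h1 : (1:ℝ) ≤ Nat.card H := by exact_mod_cast Nat.card_pos
  have hi1 : (Nat.card H : ℝ)⁻¹ ≤ 1 := inv_le_one_of_one_le₀ h1
  have key : ∀ a, FT H n η (kk H g) (mm H g) a ≤ uH H a + ((Nat.card H : ℝ)⁻¹ * mm H g (-a) / n + η * kk H g / n) := by
    intro a
    unfold FT uH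
    split_ifs
    · have : 0 ≤ ((Nat.card H : ℝ)⁻¹ * mm H g (-a) / n + η * kk H g / n) := by positivity
      linarith
    · have : (Nat.card H : ℝ)⁻¹ * (η * kk H g / n) ≤ 1 * (η * kk H g / n) := by gcongr
      have e : (Nat.card H : ℝ)⁻¹ * ((mm H g (-a) + η * kk H g) / n) =
         (Nat.card H : ℝ)⁻¹ * mm H g (-a) / n + (Nat.card H : ℝ)⁻¹ * (η * kk H g / n) := by ring
      rw [e]; linarith
  refine (Finset.sum_le_sum fun a _ => key a).trans ?_
  rw [Finset.sum_add_distrib, Finset.sum_add_distrib, uH_sum, ← Finset.sum_div, ← Finset.mul_sum, Finset.sum_const]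
  have e : ∑ a, (mm H g (-a) : ℝ) = Nat.card H * kk H g := by
    refine (Equiv.sum_comp (Equiv.neg G) (fun a => (mm H g a : ℝ))).trans ?_
    exact_mod_cast mm_sum H g
  rw [e, Finset.card_univ, nsmul_eq_mul]
  have e2 : (Nat.card H : ℝ)⁻¹ * (Nat.card H * kk H g) / n + Fintype.card G * (η * kk H g / n) =
     (kk H g : ℝ) * (1 + Fintype.card G * η) / n := by field_simp
  rw [e2, add_comm]
  exact Real.add_one_le_exp _

lemma type_sum (H : AddSubgroup G) {n : ℕ} (hn : 0 < n) (η : ℝ) (hη : 0 ≤ η) (k : ℕ) (T : G → ℕ)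
    (S : Finset (Fin n → G)) (hS : ∀ g ∈ S, kk H g = k ∧ mm H g = T) :
    ∑ g ∈ S, ∏ j, FT H n η k T (g j) ≤ Real.exp (1 + Fintype.card G * η) ^ k := by
  rcases S.eq_empty_or_nonempty with rfl | ⟨g, hg⟩
  · simp; positivity
  obtain ⟨rfl, rfl⟩ := hS g hg
  have h0 := FT_nonneg H n η hη (kk H g) (mm H g)
  calc _ ≤ ∑ g' : Fin n → G, ∏ j, FT H n η (kk H g) (mm H g) (g' j) :=
        Finset.sum_le_sum_of_subset_of_nonneg (Finset.subset_univ _) fun g _ _ => Finset.prod_nonneg fun j _ => h0 _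
    _ = (∑ a, FT H n η (kk H g) (mm H g) a) ^ n := sum_prod_pow n _
    _ ≤ Real.exp ((kk H g : ℝ) * (1 + Fintype.card G * η) / n) ^ n := by
        gcongr
        · exact Finset.sum_nonneg fun a _ => h0 a
        · exact FT_sum H hn η hη g
    _ = _ := by
        rw [← Real.exp_nat_mul, ← Real.exp_nat_mul]
        congr 1
        have hn' : (0:ℝ) < n := by exact_mod_cast hn
        field_simp

lemma mm_le (H : AddSubgroup G) {n : ℕ} (g : Fin n → G) (a : G) : mm H g a ≤ kk H g :=
  Finset.card_le_card fun j hj => by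
    simp only [mem_filter] at hj ⊢; exact ⟨hj.1, hj.2.1⟩

lemma region_bound (hodd : Odd (Nat.card G)) (H : AddSubgroup G) {n : ℕ} (hn : 0 < n) (hx : 1 ≤ xs n)
    (η : ℝ) (hη0 : 0 < η) (hη : 3 / 2 * Nat.card H * rs n ≤ η)
    (hθ : 2 * (1 + Nat.card H * rs n) * Real.exp (4 * Fintype.card G * rs n - 2) * Real.exp (1 + Fintype.card G * η) ≤ 9 / 10) :
    ∑ g ∈ (Near n H).filter (fun g => ∃ j, g j ∉ H), WW g ≤
      ∑ k ∈ range (n + 1), (n:ℝ)⁻¹ * ((Nat.card H / (2 * η)) * Real.exp ((Fintype.card G : ℝ) ^ 3 + 2 * Fintype.card G) *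
        2 ^ (Fintype.card G)) * ((k:ℝ) ^ (Fintype.card G + 2) * (9 / 10) ^ k) := by
  set S := (Near n H).filter (fun g => ∃ j, g j ∉ H) with hS
  set C := (Nat.card H / (2 * η)) * Real.exp ((Fintype.card G : ℝ) ^ 3 + 2 * Fintype.card G) with hC
  have hC0 : 0 ≤ C := by rw [hC]; positivity
  have hn' : (0:ℝ) < n := by exact_mod_cast hn
  set q := 2 * (1 + Nat.card H * rs n) * Real.exp (4 * Fintype.card G * rs n - 2) with hq
  have hq0 : 0 ≤ q := by rw [hq]; have := rs_pos hn; positivity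
  have hkk : ∀ g ∈ S, kk H g ∈ range (n + 1) := fun g _ => by
    have := Finset.card_le_univ (univ.filter fun j => g j ∉ H)
    rw [Fintype.card_fin] at this
    rw [mem_range, kk]; omega
  rw [← Finset.sum_fiberwise_of_maps_to hkk]
  refine Finset.sum_le_sum fun k _ => ?_
  have hmm : ∀ g ∈ S.filter (fun g => kk H g = k), mm H g ∈ Fintype.piFinset (fun _ : G => range (k + 1)) := by
    intro g hg
    rw [Fintype.mem_piFinset]
    intro a
    have := mm_le H g a
    rw [(mem_filter.1 hg).2] at this
    rw [mem_range]; omega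
  rw [← Finset.sum_fiberwise_of_maps_to hmm]
  rcases Nat.eq_zero_or_pos k with rfl | hk
  · have : S.filter (fun g => kk H g = 0) = ∅ := by
      rw [Finset.filter_eq_empty_iff]
      intro g hg h0
      obtain ⟨j, hj⟩ := (mem_filter.1 hg).2
      rw [kk, Finset.card_eq_zero, Finset.filter_eq_empty_iff] at h0
      exact h0 (mem_univ j) hj
    rw [this]
    simp
  have hk1 : (1:ℝ) ≤ k := by exact_mod_cast hk
  have inner : ∀ T ∈ Fintype.piFinset (fun _ : G => range (k + 1)),
      ∑ g ∈ (S.filter (fun g => kk H g = k)).filter (fun g => mm H g = T), WW g ≤ (k:ℝ) ^ 2 / n * C * (9 / 10) ^ k := by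
    intro T _
    have hb : ∀ g ∈ (S.filter (fun g => kk H g = k)).filter (fun g => mm H g = T),
        WW g ≤ (k:ℝ) ^ 2 / n * C * q ^ k * ∏ j, FT H n η k T (g j) := by
      intro g hg
      simp only [mem_filter, hS] at hg
      obtain ⟨⟨⟨hg1, hg2⟩, hg3⟩, hg4⟩ := hg
      have := WW_bound hodd H hn hx g hg1 (by omega) η hη0 hη
      rw [hg3, hg4] at this
      refine this.trans (le_of_eq ?_)
      rw [hC, hq]; ring
    refine (Finset.sum_le_sum hb).trans ?_
    rw [← Finset.mul_sum]
    have ht := type_sum H hn η hη0.le k T ((S.filter (fun g => kk H g = k)).filter (fun g => mm H g = T)) (by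
      intro g hg; simp only [mem_filter] at hg; exact ⟨hg.1.2, hg.2⟩)
    calc _ ≤ (k:ℝ) ^ 2 / n * C * q ^ k * Real.exp (1 + Fintype.card G * η) ^ k := by gcongr
      _ = (k:ℝ) ^ 2 / n * C * (q * Real.exp (1 + Fintype.card G * η)) ^ k := by rw [mul_pow q]; ring
      _ ≤ _ := by gcongr
  refine (Finset.sum_le_sum inner).trans ?_
  rw [Finset.sum_const, Fintype.card_piFinset, nsmul_eq_mul]
  simp only [card_range, prod_const, Finset.card_univ]
  push_cast
  calc ((k:ℝ) + 1) ^ Fintype.card G * ((k:ℝ) ^ 2 / n * C * (9 / 10) ^ k)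
      ≤ (2 * k) ^ Fintype.card G * ((k:ℝ) ^ 2 / n * C * (9 / 10) ^ k) := by gcongr; linarith
    _ = _ := by rw [mul_pow, pow_add]; field_simp

lemma near_proper_tendsto (hodd : Odd (Nat.card G)) (H : AddSubgroup G) :
    Tendsto (fun n => ∑ g ∈ (Near n H).filter (fun g => ∃ j, g j ∉ H), WW g) atTop (nhds 0) := by
  have hNpos : (0:ℝ) < Fintype.card G := by exact_mod_cast Fintype.card_pos
  set N := Fintype.card G with hN
  set η : ℝ := (10 * (N:ℝ))⁻¹ with hη
  have hη0 : 0 < η := by positivity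
  have hNη : N * η = 1 / 10 := by rw [hη]; field_simp
  have e1 : ∀ᶠ n in atTop, 3 / 2 * (Nat.card H : ℝ) * rs n ≤ η := by
    have : Tendsto (fun n => 3 / 2 * (Nat.card H : ℝ) * rs n) atTop (nhds (3 / 2 * (Nat.card H : ℝ) * 0)) :=
      rs_tendsto.const_mul _
    rw [mul_zero] at this
    exact this.eventually_le_const hη0
  have e2 : ∀ᶠ n in atTop, 2 * (1 + Nat.card H * rs n) * Real.exp (4 * N * rs n - 2) * Real.exp (1 + N * η) ≤ 9 / 10 := by
    have hc : Continuous (fun r : ℝ => 2 * (1 + Nat.card H * r) * Real.exp (4 * N * r - 2) * Real.exp (1 + N * η)) := by fun_prop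
    have := (hc.tendsto 0).comp rs_tendsto
    refine this.eventually_le_const ?_
    simp only [mul_zero, add_zero, mul_one, zero_sub]
    rw [mul_assoc, ← Real.exp_add, hNη]
    rw [show (-2 + (1 + 1 / 10) : ℝ) = -(9 / 10) by norm_num, Real.exp_neg]
    have h1 := Real.quadratic_le_exp_of_nonneg (show (0:ℝ) ≤ 9 / 10 by norm_num)
    rw [← div_eq_mul_inv, div_lt_iff₀ (Real.exp_pos _)]
    norm_num at h1 ⊢
    linarith
  have hsum : Summable (fun k : ℕ => (k:ℝ) ^ (N + 2) * (9 / 10 : ℝ) ^ k) :=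
    summable_pow_mul_geometric_of_norm_lt_one (N + 2) (by rw [Real.norm_eq_abs, abs_of_pos] <;> norm_num)
  set D := (Nat.card H / (2 * η)) * Real.exp ((N : ℝ) ^ 3 + 2 * N) * 2 ^ N with hD
  have hD0 : 0 ≤ D := by rw [hD]; positivity
  have hlim : Tendsto (fun n : ℕ => (n:ℝ)⁻¹ * (D * ∑' k : ℕ, (k:ℝ) ^ (N + 2) * (9 / 10 : ℝ) ^ k)) atTop (nhds 0) := by
    have := (tendsto_inv_atTop_zero.comp (tendsto_natCast_atTop_atTop (R := ℝ))).mul_const (D * ∑' k : ℕ, (k:ℝ) ^ (N + 2) * (9 / 10 : ℝ) ^ k)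
    rw [zero_mul] at this
    exact this
  refine squeeze_zero' (Eventually.of_forall fun n => Finset.sum_nonneg fun g _ => WW_nonneg g) ?_ hlim
  filter_upwards [e1, e2, eventually_gt_atTop 0, xs_tendsto.eventually_ge_atTop 1] with n h1 h2 hn hx
  refine (region_bound hodd H hn hx η hη0 h1 h2).trans ?_
  rw [← Finset.mul_sum, ← hN, ← hD, mul_assoc]
  have := hsum.sum_le_tsum (range (n + 1)) (fun k _ => by positivity)
  gcongr

end CLAux

namespace CLAux
open CLPaper Finset Filter

variable {G : Type} [AddCommGroup G] [Fintype G]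

lemma gen_not_mem {n : ℕ} (g : Fin n → G) (hg : Gen g) (H : AddSubgroup G) (hH : H ≠ ⊤) : ∃ j, g j ∉ H := by
  by_contra hc
  push Not at hc
  apply hH
  rw [AddSubgroup.eq_top_iff']
  intro a
  obtain ⟨l, rfl⟩ := hg a
  exact H.sum_mem fun i _ => H.zsmul_mem (hc i) _

lemma moment_one (h6 : Nat.Coprime (Nat.card G) 6) :
    Tendsto (fun n => ∑ ω : Om n, ((subdet n ω.1 : ℝ) ^ 2 / cN n) * (FF ∅ (cokK n ω.1) G : ℝ)) atTop (nhds 1) := by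
  have h3 : Nat.Coprime (Nat.card G) 3 := Nat.Coprime.coprime_dvd_right (by norm_num) h6
  have h2 : Nat.Coprime (Nat.card G) 2 := Nat.Coprime.coprime_dvd_right (by norm_num) h6
  have hodd : Odd (Nat.card G) := by
    rw [Nat.coprime_comm, Nat.coprime_two_left] at h2; exact h2
  simp_rw [moment_reduce]
  have hfar := far_tendsto (G := G) h3
  have hprop : Tendsto (fun n => ∑ H ∈ (univ : Finset (AddSubgroup G)),
      ∑ g ∈ (Near n H).filter (fun g => ∃ j, g j ∉ H), WW g) atTop (nhds (∑ H ∈ (univ : Finset (AddSubgroup G)), 0)) :=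
    tendsto_finsetSum _ fun H _ => near_proper_tendsto hodd H
  rw [Finset.sum_const_zero] at hprop
  have hup := (near_top_tendsto (G := G)).add (hfar.add hprop)
  rw [add_zero, add_zero] at hup
  refine tendsto_of_tendsto_of_tendsto_of_le_of_le' (near_top_tendsto (G := G)) hup ?_ ?_
  · filter_upwards [near_top_gen (G := G)] with n hn
    refine Finset.sum_le_sum_of_subset_of_nonneg ?_ fun g _ _ => WW_nonneg g
    intro g hg
    exact mem_filter.2 ⟨mem_univ _, hn g hg⟩
  · refine Eventually.of_forall fun n => ?_
    have hcov : ∀ g ∈ univ.filter (fun g : Fin n → G => Gen g), (Mg g).det / cN n ≤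
        (if g ∈ Near n (⊤ : AddSubgroup G) then WW g else 0) + ((if g ∈ (Far n : Finset (Fin n → G)) then WW g else 0) +
        ∑ H ∈ (univ : Finset (AddSubgroup G)), if g ∈ (Near n H).filter (fun g => ∃ j, g j ∉ H) then WW g else 0) := by
      intro g hg
      have hg := (mem_filter.1 hg).2
      have hW : (Mg g).det / cN n = WW g := rfl
      have w0 := WW_nonneg g
      rw [hW]
      have n0 : ∀ H ∈ (univ : Finset (AddSubgroup G)), 0 ≤ (if g ∈ (Near n H).filter (fun g => ∃ j, g j ∉ H) then WW g else 0) := by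
        intro H _; split_ifs <;> simp [w0]
      have n1 := Finset.sum_nonneg n0
      have n2 : 0 ≤ (if g ∈ Near n (⊤ : AddSubgroup G) then WW g else 0) := by split_ifs <;> simp [w0]
      have n3 : 0 ≤ (if g ∈ (Far n : Finset (Fin n → G)) then WW g else 0) := by split_ifs <;> simp [w0]
      by_cases hf : g ∈ (Far n : Finset (Fin n → G))
      · rw [if_pos hf] at n3 ⊢; linarith
      · simp only [Far, mem_filter, mem_univ, true_and, not_forall, not_lt] at hf
        obtain ⟨H, hH⟩ := hf
        have hmem : g ∈ Near n H := mem_filter.2 ⟨mem_univ _, hH⟩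
        by_cases ht : H = ⊤
        · subst ht
          rw [if_pos hmem]; linarith
        · have := Finset.single_le_sum n0 (mem_univ H)
          rw [if_pos (mem_filter.2 ⟨hmem, gen_not_mem g hg H ht⟩)] at this
          linarith
    refine (Finset.sum_le_sum hcov).trans ?_
    refine (Finset.sum_le_sum_of_subset_of_nonneg (Finset.subset_univ _) ?_).trans (le_of_eq ?_)
    · intro g _ _
      have w0 := WW_nonneg g
      refine add_nonneg (by split_ifs <;> simp [w0]) (add_nonneg (by split_ifs <;> simp [w0]) (Finset.sum_nonneg fun H _ => by split_ifs <;> simp [w0]))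
    · rw [Finset.sum_add_distrib, Finset.sum_add_distrib, Finset.sum_comm]
      simp only [← Finset.sum_filter, Finset.filter_mem_eq_inter, Finset.univ_inter]

end CLAux

open CLPaper Filter

/-- **Theorem 1.** For primes `5 ≤ p₁ < ⋯ < p_s` and finite abelian `p_i`-groups `G_i`,
the determinantally biased probability that the joint `p_i`-Sylow subgroups of the
cokernel are isomorphic to `⊕ G_i` converges to the Cohen–Lenstra probability. -/
theorem sylow_cokernel_cohen_lenstra
    (s : ℕ) (p : Fin s → ℕ) (hprime : ∀ i, (p i).Prime) (hp5 : ∀ i, 5 ≤ p i)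
    (hmono : StrictMono p)
    (Gi : Fin s → Type) [∀ i, AddCommGroup (Gi i)] [∀ i, Fintype (Gi i)]
    (hGp : ∀ i, ∃ k : ℕ, Nat.card (Gi i) = p i ^ k) :
    Tendsto
      (fun n : ℕ =>
        (1 / ((3 : ℝ) ^ (n + 1) * (n : ℝ) ^ (2 * n))) *
          ∑ K ∈ Finset.univ.filter
              (fun K : Finset (Fin n × Fin n × Fin n) => K.card = n ∧ subdet n K ≠ 0),
            (subdet n K : ℝ) ^ 2 *
              (if Nonempty ((∀ i, sylow (p i) (cokK n K)) ≃+ (∀ i, Gi i)) then 1 else 0))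
      atTop
      (nhds (∏ i, ((Nat.card (Gi i ≃+ Gi i) : ℝ))⁻¹ *
        ∏' j : ℕ, (1 - ((p i : ℝ))⁻¹ ^ (j + 1)))) := by
  have h6 : Nat.Coprime (Nat.card (∀ i, Gi i)) 6 := by
    rw [Nat.card_pi]
    refine Nat.Coprime.prod_left fun i _ => ?_
    obtain ⟨k, hk⟩ := hGp i
    rw [hk]
    refine Nat.Coprime.pow_left k ?_
    rw [show (6:ℕ) = 2 * 3 by norm_num]
    refine Nat.Coprime.mul_right ?_ ?_
    · exact (Nat.coprime_primes (hprime i) Nat.prime_two).2 (by have := hp5 i; omega)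
    · exact (Nat.coprime_primes (hprime i) Nat.prime_three).2 (by have := hp5 i; omega)
  have main := CLAux.moment_CL CLAux.Om (fun n ω => (subdet n ω.1 : ℝ) ^ 2 / CLAux.cN n)
    (fun n ω => div_nonneg (sq_nonneg _) (CLAux.cN_nonneg n)) (fun n ω => cokK n ω.1)
    (fun G _ _ hG => CLAux.moment_one hG) (Finset.univ.image p)
    (by
      intro q hq
      obtain ⟨i, _, rfl⟩ := Finset.mem_image.1 hq
      exact ⟨hprime i, hp5 i⟩) (∀ i, Gi i) h6
  rw [Finset.prod_image (fun i _ j _ h => hmono.injective h)] at main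
  set D : ℝ := ∏ i, (Nat.card (Gi i ≃+ Gi i) : ℝ) with hD
  have hD0 : D ≠ 0 := by
    rw [hD, Finset.prod_ne_zero_iff]
    intro i _
    have : Finite (Gi i ≃+ Gi i) := inferInstance
    exact_mod_cast Nat.card_pos.ne'
  have main2 := main.const_mul D⁻¹
  rw [Finset.prod_mul_distrib, Finset.prod_inv_distrib, ← hD]
  refine main2.congr fun n => ?_
  have h1 : ∑ K ∈ Finset.univ.filter
              (fun K : Finset (Fin n × Fin n × Fin n) => K.card = n ∧ subdet n K ≠ 0),
            (subdet n K : ℝ) ^ 2 *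
              (if Nonempty ((∀ i, sylow (p i) (cokK n K)) ≃+ (∀ i, Gi i)) then (1:ℝ) else 0) =
      ∑ ω : CLAux.Om n, (subdet n ω.1 : ℝ) ^ 2 *
              (if Nonempty ((∀ i, sylow (p i) (cokK n ω.1)) ≃+ (∀ i, Gi i)) then (1:ℝ) else 0) := by
    apply Finset.sum_subtype
    simp
  rw [h1, Finset.mul_sum, Finset.mul_sum]
  refine Finset.sum_congr rfl fun ω _ => ?_
  rw [CLAux.FF_final p hprime hmono Gi hGp (cokK n ω.1), CLAux.cN]
  push_cast
  rw [← hD]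
  field_simp
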